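/- arXiv:1203.4600 — 3 statements merged into one kernel-verified Lean document; each statement's English description precedes it below -/
import Mathlib

section
/- Let P be a collection of m points and L a collection of n lines in ℝ². Then the number of incidences (pairs (p,ℓ) with p ∈ P, ℓ ∈ L, p ∈ ℓ) is O(m^{2/3}n^{2/3} + m + n). -/
namespace SzemerediTrotter

/-- A non-vertical segment, carried by the line `y = slope * x + icpt`, over the interval
`[left, right]`. -/
@[ext]
structure Edge where
  left : ℝ
  right : ℝ
  slope : ℝ
  icpt : ℝ

namespace Edge

/-- The height at abscissa `x` of the line carrying the edge. -/
def height (e : Edge) (x : ℝ) : ℝ := e.slope * x + e.icpt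

/-- The left endpoint. -/
def source (e : Edge) : ℝ × ℝ := (e.left, e.height e.left)

/-- The right endpoint. -/
def target (e : Edge) : ℝ × ℝ := (e.right, e.height e.right)

/-- The relative interior of `e` meets the closed edge `f`. -/
def Cross (e f : Edge) : Prop :=
  e ≠ f ∧ ∃ x, e.left < x ∧ x < e.right ∧ f.left ≤ x ∧ x ≤ f.right ∧ e.height x = f.height x

theorem continuous_height (e : Edge) : Continuous e.height := by
  unfold height; fun_prop

theorem exists_height_eq_Ioc {e f : Edge} {x y : ℝ} (hxy : x ≤ y)
    (hx : e.height x < f.height x) (hy : f.height y ≤ e.height y) :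
    ∃ z, x < z ∧ z ≤ y ∧ e.height z = f.height z := by
  obtain ⟨z, hz, h⟩ := isPreconnected_Icc.intermediate_value₂ (Set.left_mem_Icc.2 hxy)
    (Set.right_mem_Icc.2 hxy) e.continuous_height.continuousOn f.continuous_height.continuousOn
    hx.le hy
  refine ⟨z, lt_of_le_of_ne hz.1 ?_, hz.2, h⟩
  rintro rfl
  exact hx.ne h

theorem exists_height_eq_Ico {e f : Edge} {x y : ℝ} (hxy : x ≤ y)
    (hx : f.height x ≤ e.height x) (hy : e.height y < f.height y) :
    ∃ z, x ≤ z ∧ z < y ∧ e.height z = f.height z := by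
  obtain ⟨z, hz, h⟩ := isPreconnected_Icc.intermediate_value₂ (Set.left_mem_Icc.2 hxy)
    (Set.right_mem_Icc.2 hxy) f.continuous_height.continuousOn e.continuous_height.continuousOn
    hx hy.le
  refine ⟨z, hz.1, lt_of_le_of_ne hz.2 ?_, h.symm⟩
  rintro rfl
  exact hy.ne h.symm

theorem eq_of_height_eq {e f : Edge} (hs : e.slope ≠ f.slope) {x y : ℝ}
    (hx : e.height x = f.height x) (hy : e.height y = f.height y) : x = y := by
  unfold height at hx hy
  have : (e.slope - f.slope) * (x - y) = 0 := by linarith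
  rcases mul_eq_zero.1 this with h | h
  · exact absurd (sub_eq_zero.1 h) hs
  · exact sub_eq_zero.1 h

theorem height_lt_of_slope_lt {e f : Edge} {x y : ℝ} (hs : e.slope < f.slope)
    (hx : e.height x = f.height x) (hxy : x < y) : e.height y < f.height y := by
  unfold height at *
  nlinarith [mul_pos (sub_pos.2 hs) (sub_pos.2 hxy)]

theorem source_eq_iff {e f : Edge} :
    e.source = f.source ↔ e.left = f.left ∧ e.height e.left = f.height e.left := by
  simp only [source, Prod.mk.injEq]
  constructor <;> rintro ⟨h, h'⟩ <;> simp_all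

theorem target_eq_iff {e f : Edge} :
    e.target = f.target ↔ e.right = f.right ∧ e.height e.right = f.height e.right := by
  simp only [target, Prod.mk.injEq]
  constructor <;> rintro ⟨h, h'⟩ <;> simp_all

theorem height_eq_of_slope_eq {e f : Edge} {x : ℝ} (hs : e.slope = f.slope)
    (hx : e.height x = f.height x) (y : ℝ) : e.height y = f.height y := by
  unfold height at *
  rw [hs] at hx ⊢
  linarith

end Edge

open Edge

/-- An edge `e` which is neither the steepest edge at its left endpoint nor the least steep one at
its right endpoint has a vertex vertically visible above it. -/
theorem exists_visible_vertex {V : Finset (ℝ × ℝ)} {E : Finset Edge}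
    (hE : ∀ e ∈ E, e.left < e.right) (hs : ∀ e ∈ E, e.source ∈ V) (ht : ∀ e ∈ E, e.target ∈ V)
    (hX : ∀ e ∈ E, ∀ f ∈ E, ¬ e.Cross f) {e f₀ g : Edge} (he : e ∈ E)
    (hf₀ : f₀ ∈ E) (hf₀e : f₀.source = e.source) (hf₀s : e.slope < f₀.slope)
    (hg : g ∈ E) (hge : g.target = e.target) (hgs : g.slope < e.slope) :
    ∃ v ∈ V, e.left < v.1 ∧ v.1 < e.right ∧ e.height v.1 < v.2 ∧
      ∀ f ∈ E, f.left < v.1 → v.1 < f.right → f.height v.1 ≤ e.height v.1 ∨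
        v.2 ≤ f.height v.1 := by
  classical
  obtain ⟨f₁, hf₁, hmin⟩ := Finset.exists_min_image
    (E.filter fun f => f.source = e.source ∧ e.slope < f.slope) Edge.slope
    ⟨f₀, by simp [hf₀, hf₀e, hf₀s]⟩
  simp only [Finset.mem_filter, and_imp] at hf₁ hmin
  obtain ⟨hf₁E, hf₁e, hf₁s⟩ := hf₁
  obtain ⟨hl₁, hh₁⟩ := source_eq_iff.1 hf₁e.symm
  obtain ⟨hr, hhr⟩ := target_eq_iff.1 hge.symm
  have hab := hE e he
  have hf₁r := hE f₁ hf₁E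
  have hgr := hE g hg
  have above : ∀ x, e.left < x → e.height x < f₁.height x := fun x hx =>
    height_lt_of_slope_lt hf₁s hh₁ hx
  have gabove : ∀ x, x < e.right → e.height x < g.height x := fun x hx => by
    unfold Edge.height at *
    nlinarith [mul_pos (sub_pos.2 hgs) (sub_pos.2 hx)]
  have hf₁g : f₁ ≠ g := by rintro rfl; linarith
  have hne : (V.filter fun v => e.left < v.1 ∧ v.1 < e.right ∧ e.height v.1 < v.2 ∧
      v.2 ≤ f₁.height v.1).Nonempty := by
    rcases lt_or_ge f₁.right e.right with h | h
    · refine ⟨f₁.target, Finset.mem_filter.2 ⟨ht _ hf₁E, ?_, h, ?_, le_rfl⟩⟩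
      · simp only [target]; linarith
      · exact above _ (by simp only [target]; linarith)
    · have hcr : ∀ x, e.left ≤ x → x < e.right → g.left ≤ x → ¬ f₁.height x < g.height x := by
        intro x h1 h2 h3 hlt
        have h4 := above _ hab
        obtain ⟨z, hz1, hz2, hz⟩ := exists_height_eq_Ioc h2.le hlt (by rw [← hhr]; exact h4.le)
        rcases hz2.eq_or_lt with rfl | hz2
        · linarith
        · exact hX _ hf₁E _ hg ⟨hf₁g, z, by linarith, by linarith, by linarith, by linarith, hz⟩
      rcases le_or_gt g.left e.left with h' | h'
      · exact absurd (by rw [← hh₁]; exact gabove _ hab) (hcr e.left le_rfl hab h')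
      · refine ⟨g.source, Finset.mem_filter.2 ⟨hs _ hg, h', ?_, gabove _ ?_,
          not_lt.1 (hcr g.left h'.le (by linarith) le_rfl)⟩⟩ <;>
        · simp only [source]; linarith
  obtain ⟨v, hv, hvmin⟩ := Finset.exists_min_image _ Prod.fst hne
  simp only [Finset.mem_filter, and_imp] at hv hvmin
  obtain ⟨hvV, hv1, hv2, hv3, hv4⟩ := hv
  refine ⟨v, hvV, hv1, hv2, hv3, fun f hf hfl hfr => ?_⟩
  by_contra! hcon
  obtain ⟨hc1, hc2⟩ := hcon
  have hvr : v.1 ≤ f₁.right := by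
    by_contra! hlt
    have := hvmin f₁.target (ht _ hf₁E) (by simp only [target]; linarith)
      (by simp only [target]; linarith) (above _ (by simp only [target]; linarith)) le_rfl
    simp only [target] at this
    linarith
  have hfe : f ≠ e := by rintro rfl; linarith
  have hff₁ : f ≠ f₁ := by rintro rfl; linarith
  have hlow : ∀ x, e.left ≤ x → f.left ≤ x → x ≤ v.1 → (e.left < x ∨ f.left < x) →
      e.height x < f.height x := by
    intro x h1 h2 h3 h4
    by_contra! hle
    obtain ⟨z, hz1, hz2, hz⟩ := exists_height_eq_Ico h3 hle hc1
    rcases h4 with h4 | h4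
    · exact hX _ he _ hf ⟨hfe.symm, z, by linarith, by linarith, by linarith, by linarith, hz⟩
    · exact hX _ hf _ he ⟨hfe, z, by linarith, by linarith, by linarith, by linarith, hz.symm⟩
  have hupp : ∀ x, e.left ≤ x → f.left ≤ x → x ≤ v.1 → (e.left < x ∨ f.left < x) →
      f.height x < f₁.height x := by
    intro x h1 h2 h3 h4
    by_contra! hle
    obtain ⟨z, hz1, hz2, hz⟩ := exists_height_eq_Ico h3 hle (hc2.trans_le hv4)
    rcases h4 with h4 | h4
    · exact hX _ hf₁E _ hf ⟨hff₁.symm, z, by linarith, by linarith, by linarith, by linarith,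
        hz.symm⟩
    · exact hX _ hf _ hf₁E ⟨hff₁, z, by linarith, by linarith, by linarith, by linarith, hz⟩
  rcases lt_trichotomy f.left e.left with h | h | h
  · have h1 := hlow e.left le_rfl h.le hv1.le (Or.inr h)
    have h2 := hupp e.left le_rfl h.le hv1.le (Or.inr h)
    linarith
  · have h1 : e.height e.left ≤ f.height e.left := by
      by_contra! hlt
      obtain ⟨z, hz1, hz2, hz⟩ := exists_height_eq_Ioc hv1.le hlt hc1.le
      exact hX _ he _ hf ⟨hfe.symm, z, by linarith, by linarith, by linarith, by linarith,
        hz.symm⟩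
    have h2 : f.height e.left ≤ f₁.height e.left := by
      by_contra! hlt
      obtain ⟨z, hz1, hz2, hz⟩ := exists_height_eq_Ioc hv1.le hlt (hc2.trans_le hv4).le
      exact hX _ hf _ hf₁E ⟨hff₁, z, by linarith, by linarith, by linarith, by linarith, hz.symm⟩
    have h3 : e.height e.left = f.height e.left := by linarith
    have h4 : f.source = e.source := (source_eq_iff.2 ⟨h.symm, h3⟩).symm
    have h5 : e.slope < f.slope := by
      unfold Edge.height at h3 hc1
      by_contra! hle
      nlinarith [mul_nonneg (sub_nonneg.2 hle) (sub_nonneg.2 hv1.le)]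
    have h6 := hmin f hf h4 h5
    have hc3 := hc2.trans_le hv4
    unfold Edge.height at h3 hh₁ hc3
    nlinarith [mul_nonneg (sub_nonneg.2 h6) (sub_nonneg.2 hv1.le)]
  · have := hvmin f.source (hs _ hf) h (by simp only [source]; linarith)
      (hlow f.left h.le le_rfl hfl.le (Or.inl h)) (hupp f.left h.le le_rfl hfl.le (Or.inl h)).le
    simp only [source] at this
    linarith

/-- A straight-line graph without crossings has at most three times as many edges as vertices. -/
theorem card_le_of_noncrossing {V : Finset (ℝ × ℝ)} {E : Finset Edge}
    (hE : ∀ e ∈ E, e.left < e.right) (hs : ∀ e ∈ E, e.source ∈ V) (ht : ∀ e ∈ E, e.target ∈ V)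
    (hX : ∀ e ∈ E, ∀ f ∈ E, ¬ e.Cross f) : E.card ≤ 3 * V.card := by
  classical
  set A := E.filter fun e => ∀ f ∈ E, f.source = e.source → f.slope ≤ e.slope with hA
  set B := E.filter fun e => ∀ f ∈ E, f.target = e.target → e.slope ≤ f.slope with hB
  set R := E.filter fun e => ¬ (∀ f ∈ E, f.source = e.source → f.slope ≤ e.slope) ∧
    ¬ (∀ f ∈ E, f.target = e.target → e.slope ≤ f.slope) with hR
  have hcover : E ⊆ A ∪ B ∪ R := by
    intro e he
    simp only [hA, hB, hR, Finset.mem_union, Finset.mem_filter, he, true_and]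
    tauto
  have hAc : A.card ≤ V.card := by
    refine Finset.card_le_card_of_injOn Edge.source (fun e he => hs e (Finset.mem_filter.1 he).1) ?_
    intro e he f hf hef
    obtain ⟨heE, he⟩ := Finset.mem_filter.1 he
    obtain ⟨hfE, hf⟩ := Finset.mem_filter.1 hf
    have hsl := le_antisymm (hf e heE hef) (he f hfE hef.symm)
    obtain ⟨hl, hh⟩ := source_eq_iff.1 hef
    by_contra hne
    obtain ⟨x, hx1, hx2⟩ := exists_between (lt_min (hE e heE) (hl ▸ hE f hfE))
    rw [lt_min_iff] at hx2
    exact hX e heE f hfE ⟨hne, x, hx1, hx2.1, by linarith, hx2.2.le,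
      height_eq_of_slope_eq hsl hh x⟩
  have hBc : B.card ≤ V.card := by
    refine Finset.card_le_card_of_injOn Edge.target (fun e he => ht e (Finset.mem_filter.1 he).1) ?_
    intro e he f hf hef
    obtain ⟨heE, he⟩ := Finset.mem_filter.1 he
    obtain ⟨hfE, hf⟩ := Finset.mem_filter.1 hf
    have hsl := le_antisymm (he f hfE hef.symm) (hf e heE hef)
    obtain ⟨hl, hh⟩ := target_eq_iff.1 hef
    by_contra hne
    obtain ⟨x, hx1, hx2⟩ := exists_between (max_lt (hE e heE) (hl ▸ hE f hfE))
    rw [max_lt_iff] at hx1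
    exact hX e heE f hfE ⟨hne, x, hx1.1, hx2, hx1.2.le, by linarith,
      height_eq_of_slope_eq hsl hh x⟩
  have hRc : R.card ≤ V.card := by
    have hvis : ∀ e ∈ R, ∃ v ∈ V, e.left < v.1 ∧ v.1 < e.right ∧ e.height v.1 < v.2 ∧
        ∀ f ∈ E, f.left < v.1 → v.1 < f.right → f.height v.1 ≤ e.height v.1 ∨
          v.2 ≤ f.height v.1 := by
      intro e he
      obtain ⟨heE, h1, h2⟩ := Finset.mem_filter.1 he
      push Not at h1 h2
      obtain ⟨f, hf, hfe, hfs⟩ := h1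
      obtain ⟨g, hg, hge, hgs⟩ := h2
      exact exists_visible_vertex hE hs ht hX heE hf hfe hfs hg hge hgs
    choose! φ hφV hφ using hvis
    refine Finset.card_le_card_of_injOn φ hφV ?_
    intro e he f hf hef
    have heE := (Finset.mem_filter.1 he).1
    have hfE := (Finset.mem_filter.1 hf).1
    obtain ⟨e1, e2, e3, e4⟩ := hφ e he
    obtain ⟨f1, f2, f3, f4⟩ := hφ f hf
    rw [← hef] at f1 f2 f3 f4
    by_contra hne
    refine hX e heE f hfE ⟨hne, _, e1, e2, f1.le, f2.le, le_antisymm ?_ ?_⟩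
    · exact (f4 e heE e1 e2).resolve_right (not_le.2 e3)
    · exact (e4 f hfE f1 f2).resolve_right (not_le.2 f3)
  have h1 := Finset.card_le_card hcover
  have h2 := Finset.card_union_le (A ∪ B) R
  have h3 := Finset.card_union_le A B
  omega

open Classical in
/-- Deleting one edge from every crossing bounds the number of edges by that of vertices and
crossings. -/
theorem card_le_add_crossings {V : Finset (ℝ × ℝ)} {E : Finset Edge}
    (hE : ∀ e ∈ E, e.left < e.right) (hs : ∀ e ∈ E, e.source ∈ V) (ht : ∀ e ∈ E, e.target ∈ V) :
    E.card ≤ 3 * V.card + ((E ×ˢ E).filter fun x => x.1.Cross x.2).card := by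
  induction E using Finset.strongInduction with
  | H E ih =>
    by_cases hX : ∀ e ∈ E, ∀ f ∈ E, ¬ e.Cross f
    · exact (card_le_of_noncrossing hE hs ht hX).trans (Nat.le_add_right _ _)
    · push Not at hX
      obtain ⟨e, he, f, hf, hef⟩ := hX
      have h1 := ih (E.erase e) (Finset.erase_ssubset he)
        (fun g hg => hE g (Finset.mem_of_mem_erase hg))
        (fun g hg => hs g (Finset.mem_of_mem_erase hg))
        (fun g hg => ht g (Finset.mem_of_mem_erase hg))
      have h2 : (((E.erase e) ×ˢ (E.erase e)).filter fun x => x.1.Cross x.2).card <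
          ((E ×ˢ E).filter fun x => x.1.Cross x.2).card := by
        apply Finset.card_lt_card
        refine (Finset.ssubset_iff_of_subset ?_).2 ⟨(e, f), by simp [he, hf, hef], by simp⟩
        exact Finset.filter_subset_filter _
          (Finset.product_subset_product (Finset.erase_subset _ _) (Finset.erase_subset _ _))
      have h3 := Finset.card_erase_add_one he
      omega

/-- If each element of `V` is kept independently with probability `p`, the expected number of
indices `i ∈ A` for which `T i` survives is `∑ i ∈ A, p ^ #(T i)`. -/
theorem sum_weight_mul_card {α ι : Type*} [DecidableEq α] (V : Finset α) (A : Finset ι)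
    (T : ι → Finset α) (hT : ∀ i ∈ A, T i ⊆ V) (p : ℝ) :
    ∑ S ∈ V.powerset, p ^ S.card * (1 - p) ^ (V \ S).card *
      ((A.filter fun i => T i ⊆ S).card : ℝ) = ∑ i ∈ A, p ^ (T i).card := by
  simp only [Finset.card_filter, Nat.cast_sum, Finset.mul_sum]
  rw [Finset.sum_comm]
  refine Finset.sum_congr rfl fun i hi => ?_
  have h := Finset.prod_add (fun _ => p) (fun a => if a ∈ T i then 0 else 1 - p) V
  have hl : ∏ a ∈ V, (p + if a ∈ T i then 0 else 1 - p) = p ^ (T i).card := by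
    rw [← Finset.prod_const, ← Finset.prod_subset (hT i hi) (fun a _ ha => by simp [ha])]
    exact Finset.prod_congr rfl fun a ha => by simp [ha]
  rw [← hl, h]
  refine Finset.sum_congr rfl fun S _ => ?_
  rw [Finset.prod_const, mul_assoc]
  congr 1
  by_cases hTS : T i ⊆ S
  · rw [Finset.prod_congr rfl (g := fun _ => 1 - p), Finset.prod_const]
    · simp [hTS]
    · intro a ha
      rw [if_neg fun h => (Finset.mem_sdiff.1 ha).2 (hTS h)]
  · obtain ⟨a, ha, haS⟩ := Finset.not_subset.1 hTS
    rw [Finset.prod_eq_zero (Finset.mem_sdiff.2 ⟨hT i hi ha, haS⟩) (by simp [ha])]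
    simp [hTS]

open Classical in
/-- The crossing inequality, in its probabilistic form. -/
theorem crossing_inequality {V : Finset (ℝ × ℝ)} {E : Finset Edge}
    (hE : ∀ e ∈ E, e.left < e.right) (hs : ∀ e ∈ E, e.source ∈ V) (ht : ∀ e ∈ E, e.target ∈ V)
    (hX : ∀ e ∈ E, ∀ f ∈ E, e.Cross f →
      ({e.source, e.target, f.source, f.target} : Finset (ℝ × ℝ)).card = 4)
    {p : ℝ} (hp₀ : 0 ≤ p) (hp₁ : p ≤ 1) :
    E.card * p ^ 2 ≤ 3 * (V.card * p) +
      ((E ×ˢ E).filter fun x => x.1.Cross x.2).card * p ^ 4 := by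
  set X := (E ×ˢ E).filter fun x => x.1.Cross x.2 with hXdef
  have hXmem : ∀ x ∈ X, x.1 ∈ E ∧ x.2 ∈ E ∧ x.1.Cross x.2 := fun x hx => by
    simpa [hXdef, and_assoc] using hx
  have key : ∀ S ∈ V.powerset,
      ((E.filter fun e => ({e.source, e.target} : Finset _) ⊆ S).card : ℝ) ≤
        3 * ((V.filter fun v => ({v} : Finset _) ⊆ S).card : ℝ) +
        ((X.filter fun x => ({x.1.source, x.1.target, x.2.source, x.2.target} : Finset _) ⊆
          S).card : ℝ) := by
    intro S hS
    rw [Finset.mem_powerset] at hS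
    have h := card_le_add_crossings (V := S)
      (E := E.filter fun e => ({e.source, e.target} : Finset _) ⊆ S)
      (fun e he => hE e (Finset.mem_filter.1 he).1)
      (fun e he => (Finset.mem_filter.1 he).2 (by simp))
      (fun e he => (Finset.mem_filter.1 he).2 (by simp))
    have h1 : (V.filter fun v => ({v} : Finset _) ⊆ S) = S := by
      ext v
      simp only [Finset.mem_filter, Finset.singleton_subset_iff]
      exact ⟨fun h => h.2, fun h => ⟨hS h, h⟩⟩
    rw [h1]
    refine (Nat.cast_le.2 (h.trans (Nat.add_le_add_left (Finset.card_le_card ?_) _))).trans_eq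
      (by push_cast; rfl)
    intro x hx
    simp only [hXdef, Finset.mem_filter, Finset.mem_product, Finset.insert_subset_iff,
      Finset.singleton_subset_iff] at hx ⊢
    tauto
  have hsum := Finset.sum_le_sum fun S hS => mul_le_mul_of_nonneg_left (key S hS)
    (mul_nonneg (pow_nonneg hp₀ S.card) (pow_nonneg (sub_nonneg.2 hp₁) (V \ S).card))
  simp only [mul_add, Finset.sum_add_distrib, mul_left_comm _ (3 : ℝ)] at hsum
  rw [← Finset.mul_sum, sum_weight_mul_card, sum_weight_mul_card, sum_weight_mul_card] at hsum
  · have e1 : ∑ e ∈ E, p ^ ({e.source, e.target} : Finset (ℝ × ℝ)).card = E.card * p ^ 2 := by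
      rw [← nsmul_eq_mul]
      refine Finset.sum_eq_card_nsmul fun e he => ?_
      rw [Finset.card_pair fun h => (hE e he).ne (congrArg Prod.fst h)]
    have e2 : ∑ x ∈ X, p ^ ({x.1.source, x.1.target, x.2.source, x.2.target} :
        Finset (ℝ × ℝ)).card = X.card * p ^ 4 := by
      rw [← nsmul_eq_mul]
      refine Finset.sum_eq_card_nsmul fun x hx => ?_
      obtain ⟨h1, h2, h3⟩ := hXmem x hx
      rw [hX _ h1 _ h2 h3]
    rw [e1, e2] at hsum
    simpa using hsum
  · intro x hx
    obtain ⟨h1, h2, -⟩ := hXmem x hx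
    simp [Finset.insert_subset_iff, hs _ h1, hs _ h2, ht _ h1, ht _ h2]
  · intro v hv
    simpa using hv
  · intro e he
    simp [Finset.insert_subset_iff, hs _ he, ht _ he]

open Classical in
/-- The segments between consecutive points of `P` on the lines `y = d.1 * x + d.2`, `d ∈ D`. -/
noncomputable def edges (P D : Finset (ℝ × ℝ)) : Finset Edge :=
  ((P.image Prod.fst ×ˢ P.image Prod.fst ×ˢ D).image
    fun t => (⟨t.1, t.2.1, t.2.2.1, t.2.2.2⟩ : Edge)).filter fun e =>
      e.left < e.right ∧ e.source ∈ P ∧ e.target ∈ P ∧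
        ∀ x, e.left < x → x < e.right → (x, e.height x) ∉ P

theorem mem_edges {P D : Finset (ℝ × ℝ)} {e : Edge} :
    e ∈ edges P D ↔ (e.slope, e.icpt) ∈ D ∧ e.left < e.right ∧ e.source ∈ P ∧ e.target ∈ P ∧
      ∀ x, e.left < x → x < e.right → (x, e.height x) ∉ P := by
  classical
  simp only [edges, Finset.mem_filter, Finset.mem_image, Finset.mem_product]
  constructor
  · rintro ⟨⟨t, ht, rfl⟩, h⟩
    exact ⟨ht.2.2, h⟩
  · rintro ⟨hD, h⟩
    exact ⟨⟨(e.left, e.right, e.slope, e.icpt),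
      ⟨⟨_, h.2.1, rfl⟩, ⟨_, h.2.2.1, rfl⟩, hD⟩, rfl⟩, h⟩

theorem eq_of_mem_edges {P D : Finset (ℝ × ℝ)} {e f : Edge} (he : e ∈ edges P D)
    (hf : f ∈ edges P D) (hs : e.slope = f.slope) (hi : e.icpt = f.icpt) {x : ℝ}
    (hex : e.left < x) (hxe : x < e.right) (hfx : f.left < x) (hxf : x < f.right) : e = f := by
  obtain ⟨-, -, he1, he2, he3⟩ := mem_edges.1 he
  obtain ⟨-, -, hf1, hf2, hf3⟩ := mem_edges.1 hf
  have hh : ∀ y, e.height y = f.height y := fun y => by simp [Edge.height, hs, hi]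
  simp only [source, target, hh] at he1 he2 he3 hf1 hf2
  refine Edge.ext (le_antisymm ?_ ?_) (le_antisymm ?_ ?_) hs hi <;> by_contra! hlt
  · exact hf3 _ hlt (by linarith) he1
  · exact he3 _ hlt (by linarith) hf1
  · exact he3 _ (by linarith) hlt hf2
  · exact hf3 _ (by linarith) hlt he2

theorem Edge.Cross.exists_interior {P D : Finset (ℝ × ℝ)} {e f : Edge} (he : e ∈ edges P D)
    (hf : f ∈ edges P D) (h : e.Cross f) : e.slope ≠ f.slope ∧
      ∃ x, e.left < x ∧ x < e.right ∧ f.left < x ∧ x < f.right ∧ e.height x = f.height x := by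
  obtain ⟨-, -, he1, he2, he3⟩ := mem_edges.1 he
  obtain ⟨-, -, hf1, hf2, hf3⟩ := mem_edges.1 hf
  obtain ⟨hne, x, h1, h2, h3, h4, h5⟩ := h
  have h3' : f.left < x := by
    refine lt_of_le_of_ne h3 ?_
    rintro rfl
    exact he3 _ h1 h2 (h5 ▸ hf1)
  have h4' : x < f.right := by
    refine lt_of_le_of_ne h4 ?_
    rintro rfl
    exact he3 _ h1 h2 (h5 ▸ hf2)
  refine ⟨fun hs => hne ?_, x, h1, h2, h3', h4', h5⟩
  refine eq_of_mem_edges he hf hs ?_ h1 h2 h3' h4'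
  simp only [Edge.height, hs] at h5
  linarith

open Classical in
theorem card_cross_endpoints {P D : Finset (ℝ × ℝ)} {e f : Edge} (he : e ∈ edges P D)
    (hf : f ∈ edges P D) (h : e.Cross f) :
    ({e.source, e.target, f.source, f.target} : Finset (ℝ × ℝ)).card = 4 := by
  obtain ⟨hs, x, h1, h2, h3, h4, h5⟩ := h.exists_interior he hf
  have meet : ∀ y z, (y, e.height y) = (z, f.height z) → y = x := fun y z hyz => by
    obtain ⟨rfl, hh⟩ := Prod.mk.inj hyz
    exact eq_of_height_eq hs hh h5
  have n1 : e.source ≠ e.target := fun h => by linarith [(Prod.mk.inj h).1]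
  have n2 : f.source ≠ f.target := fun h => by linarith [(Prod.mk.inj h).1]
  have n3 : e.source ≠ f.source := fun h => by linarith [meet _ _ h]
  have n4 : e.source ≠ f.target := fun h => by linarith [meet _ _ h]
  have n5 : e.target ≠ f.source := fun h => by linarith [meet _ _ h]
  have n6 : e.target ≠ f.target := fun h => by linarith [meet _ _ h]
  rw [Finset.card_insert_of_notMem (by simp [n1, n3, n4]),
    Finset.card_insert_of_notMem (by simp [n5, n6]), Finset.card_pair n2]

open Classical in
theorem card_crossings_le (P D : Finset (ℝ × ℝ)) :
    ((edges P D ×ˢ edges P D).filter fun x => x.1.Cross x.2).card ≤ D.card ^ 2 := by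
  rw [sq, ← Finset.card_product]
  refine Finset.card_le_card_of_injOn
    (fun x => ((x.1.slope, x.1.icpt), (x.2.slope, x.2.icpt))) ?_ ?_
  · intro x hx
    simp only [Finset.coe_filter, Finset.mem_product, Set.mem_ofPred_eq] at hx
    simp [(mem_edges.1 hx.1.1).1, (mem_edges.1 hx.1.2).1]
  · rintro ⟨e, f⟩ hx ⟨e', f'⟩ hx' heq
    simp only [Finset.coe_filter, Finset.mem_product, Set.mem_ofPred_eq] at hx hx'
    simp only [Prod.mk.injEq] at heq
    obtain ⟨⟨a1, a2⟩, b1, b2⟩ := heq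
    obtain ⟨⟨he, hf⟩, hc⟩ := hx
    obtain ⟨⟨he', hf'⟩, hc'⟩ := hx'
    obtain ⟨hs, x, h1, h2, h3, h4, h5⟩ := hc.exists_interior he hf
    obtain ⟨hs', x', h1', h2', h3', h4', h5'⟩ := hc'.exists_interior he' hf'
    have hxx : x = x' := eq_of_height_eq hs h5 (by
      simpa [Edge.height, a1, a2, b1, b2] using h5')
    subst hxx
    rw [eq_of_mem_edges he he' a1 a2 h1 h2 h1' h2', eq_of_mem_edges hf hf' b1 b2 h3 h4 h3' h4']

open Classical in
theorem card_incidences_le (P D : Finset (ℝ × ℝ)) :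
    ((P ×ˢ D).filter fun x => x.1.2 = x.2.1 * x.1.1 + x.2.2).card ≤
      (edges P D).card + D.card := by
  set I := (P ×ˢ D).filter fun x => x.1.2 = x.2.1 * x.1.1 + x.2.2 with hI
  have hmem : ∀ x ∈ I, x.1 ∈ P ∧ x.2 ∈ D ∧ x.1.2 = x.2.1 * x.1.1 + x.2.2 := fun x hx => by
    simpa [hI, and_assoc] using hx
  rw [← Finset.card_filter_add_card_filter_not
    (fun x => ∃ q ∈ P, q.2 = x.2.1 * q.1 + x.2.2 ∧ x.1.1 < q.1)]
  refine Nat.add_le_add ?_ ?_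
  · have hedge : ∀ x ∈ I.filter (fun x => ∃ q ∈ P, q.2 = x.2.1 * q.1 + x.2.2 ∧ x.1.1 < q.1),
        ∃ e ∈ edges P D, e.source = x.1 ∧ (e.slope, e.icpt) = x.2 := by
      rintro ⟨p, d⟩ hx
      obtain ⟨hxI, q₀, hq₀, hq₀d, hq₀l⟩ := Finset.mem_filter.1 hx
      obtain ⟨hp, hd, hpd⟩ := hmem _ hxI
      obtain ⟨q, hq, hmin⟩ := Finset.exists_min_image
        (P.filter fun q => q.2 = d.1 * q.1 + d.2 ∧ p.1 < q.1) Prod.fst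
        ⟨q₀, by simp only [Finset.mem_filter]; exact ⟨hq₀, hq₀d, hq₀l⟩⟩
      simp only [Finset.mem_filter, and_imp] at hq hmin
      obtain ⟨hqP, hqd, hql⟩ := hq
      have hsrc : Edge.source ⟨p.1, q.1, d.1, d.2⟩ = p := Prod.ext rfl hpd.symm
      have htgt : Edge.target ⟨p.1, q.1, d.1, d.2⟩ = q := Prod.ext rfl hqd.symm
      refine ⟨⟨p.1, q.1, d.1, d.2⟩, mem_edges.2 ⟨hd, hql, hsrc ▸ hp, htgt ▸ hqP, ?_⟩, hsrc, rfl⟩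
      intro x h1 h2 h3
      exact absurd (hmin _ h3 rfl h1) (not_le.2 h2)
    have : Nonempty Edge := ⟨⟨0, 0, 0, 0⟩⟩
    choose! φ hφE hφs hφd using hedge
    refine Finset.card_le_card_of_injOn φ hφE ?_
    intro x hx y hy hxy
    refine Prod.ext ?_ ?_
    · rw [← hφs x hx, ← hφs y hy, hxy]
    · rw [← hφd x hx, ← hφd y hy, hxy]
  · refine Finset.card_le_card_of_injOn Prod.snd
      (fun x hx => (hmem x (Finset.mem_filter.1 hx).1).2.1) ?_
    rintro ⟨p, d⟩ hx ⟨q, d'⟩ hy hxy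
    obtain rfl : d = d' := hxy
    obtain ⟨hxI, hx⟩ := Finset.mem_filter.1 hx
    obtain ⟨hyI, hy⟩ := Finset.mem_filter.1 hy
    obtain ⟨hp, -, hpd⟩ := hmem _ hxI
    obtain ⟨hq, -, hqd⟩ := hmem _ hyI
    push Not at hx hy
    have h1 : p.1 = q.1 := le_antisymm (hy p hp hpd) (hx q hq hqd)
    have h2 : p = q := Prod.ext h1 (by simp only at hpd hqd; rw [hpd, hqd, h1])
    rw [h2]

/-- Optimising the sampling probability in the crossing inequality. -/
theorem le_of_forall_probability {m n : ℕ} {E : ℝ} (hm : 0 < m)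
    (h : ∀ p : ℝ, 0 ≤ p → p ≤ 1 → E * p ^ 2 ≤ 3 * (m * p) + (n : ℝ) ^ 2 * p ^ 4) :
    E ≤ 4 * ((m : ℝ) ^ ((2 : ℝ) / 3) * (n : ℝ) ^ ((2 : ℝ) / 3) + m) := by
  have cube : ∀ k : ℕ, (((k : ℝ) ^ ((1 : ℝ) / 3)) ^ 3 = k) ∧
      (((k : ℝ) ^ ((1 : ℝ) / 3)) ^ 2 = (k : ℝ) ^ ((2 : ℝ) / 3)) := fun k => by
    constructor <;> rw [← Real.rpow_natCast, ← Real.rpow_mul k.cast_nonneg] <;> norm_num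
  obtain ⟨ha3, ha2⟩ := cube m
  obtain ⟨hb3, hb2⟩ := cube n
  have hmn : 0 ≤ (m : ℝ) ^ ((2 : ℝ) / 3) * (n : ℝ) ^ ((2 : ℝ) / 3) := by positivity
  rcases le_total ((n : ℝ) ^ 2) m with hle | hle
  · have := h 1 zero_le_one le_rfl
    linarith
  have hn : 0 < n := by
    rcases n.eq_zero_or_pos with rfl | hn
    · have : (0 : ℝ) < m := by exact_mod_cast hm
      norm_num at hle
      omega
    · exact hn
  rw [← ha2, ← hb2]
  set a := (m : ℝ) ^ ((1 : ℝ) / 3) with ha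
  set b := (n : ℝ) ^ ((1 : ℝ) / 3) with hb
  have ha0 : 0 < a := by positivity
  have hb0 : 0 < b := by positivity
  rw [← ha3, ← hb3] at h
  rw [← ha3, ← hb3] at hle
  have hab : a ≤ b ^ 2 := by
    refine le_of_pow_le_pow_left₀ three_ne_zero (by positivity) ?_
    calc a ^ 3 ≤ (b ^ 3) ^ 2 := hle
      _ = (b ^ 2) ^ 3 := by ring
  have h1 := h (a / b ^ 2) (by positivity) ((div_le_one (by positivity)).2 hab)
  have h2 : E * a ^ 2 ≤ 4 * (a ^ 2 * b ^ 2) * a ^ 2 := by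
    have := mul_le_mul_of_nonneg_right h1 (by positivity : 0 ≤ b ^ 4)
    field_simp at this
    nlinarith
  have h3 := le_of_mul_le_mul_right h2 (by positivity)
  have : 0 < a ^ 3 := by positivity
  rw [← ha3]
  linarith

open Classical in
/-- The Szemerédi–Trotter bound for non-vertical lines `y = d.1 * x + d.2`. -/
theorem card_incidences_nonvertical_le (P D : Finset (ℝ × ℝ)) {n : ℕ} (hD : D.card ≤ n) :
    (((P ×ˢ D).filter fun x => x.1.2 = x.2.1 * x.1.1 + x.2.2).card : ℝ) ≤
      4 * ((P.card : ℝ) ^ ((2 : ℝ) / 3) * (n : ℝ) ^ ((2 : ℝ) / 3) + P.card) + n := by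
  rcases P.eq_empty_or_nonempty with rfl | hP
  · simp only [Finset.empty_product, Finset.filter_empty, Finset.card_empty, Nat.cast_zero]
    positivity
  have h1 : ((edges P D).card : ℝ) ≤
      4 * ((P.card : ℝ) ^ ((2 : ℝ) / 3) * (n : ℝ) ^ ((2 : ℝ) / 3) + P.card) := by
    refine le_of_forall_probability hP.card_pos fun p hp₀ hp₁ => ?_
    refine (crossing_inequality (V := P) (fun e he => (mem_edges.1 he).2.1)
      (fun e he => (mem_edges.1 he).2.2.1) (fun e he => (mem_edges.1 he).2.2.2.1)
      (fun e he f hf h => card_cross_endpoints he hf h) hp₀ hp₁).trans ?_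
    gcongr
    exact_mod_cast (card_crossings_le P D).trans (Nat.pow_le_pow_left hD 2)
  have h2 : (((P ×ˢ D).filter fun x => x.1.2 = x.2.1 * x.1.1 + x.2.2).card : ℝ) ≤
      (edges P D).card + D.card := by exact_mod_cast card_incidences_le P D
  have h3 : (D.card : ℝ) ≤ n := by exact_mod_cast hD
  linarith

theorem vertical_or_graph {l : Set (ℝ × ℝ)}
    (hl : ∃ a b c : ℝ, (a, b) ≠ (0, 0) ∧ l = {x : ℝ × ℝ | a * x.1 + b * x.2 = c}) :
    (∃ c, l = {x | x.1 = c}) ∨ ∃ d : ℝ × ℝ, l = {x | x.2 = d.1 * x.1 + d.2} := by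
  obtain ⟨a, b, c, hab, rfl⟩ := hl
  rcases eq_or_ne b 0 with rfl | hb
  · have ha : a ≠ 0 := by simpa using hab
    refine Or.inl ⟨c / a, Set.ext fun x => ?_⟩
    simp only [Set.mem_ofPred_eq, eq_div_iff ha]
    constructor <;> intro h <;> linarith
  · refine Or.inr ⟨(-a / b, c / b), Set.ext fun x => ?_⟩
    simp only [Set.mem_ofPred_eq]
    field_simp
    constructor <;> intro h <;> linarith

end SzemerediTrotter

/-- The Szemerédi–Trotter theorem: `m` points and `n` lines in `ℝ²` determine
at most `O(m^(2/3) n^(2/3) + m + n)` incidences. -/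
theorem stmt_2 :
    ∃ C : ℝ, 0 < C ∧ ∀ (m n : ℕ) (P : Finset (ℝ × ℝ)) (L : Finset (Set (ℝ × ℝ))),
      P.card = m → L.card = n →
      (∀ l ∈ L, ∃ a b c : ℝ, (a, b) ≠ (0, 0) ∧ l = {x : ℝ × ℝ | a * x.1 + b * x.2 = c}) →
      (Set.ncard {pl : (ℝ × ℝ) × Set (ℝ × ℝ) | pl.1 ∈ P ∧ pl.2 ∈ L ∧ pl.1 ∈ pl.2} : ℝ) ≤
        C * ((m : ℝ) ^ ((2:ℝ)/3) * (n : ℝ) ^ ((2:ℝ)/3) + (m : ℝ) + (n : ℝ)) := by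
  classical
  refine ⟨5, by norm_num, ?_⟩
  rintro m n P L rfl rfl hL
  set A := {pl : (ℝ × ℝ) × Set (ℝ × ℝ) | pl.1 ∈ P ∧ pl.2 ∈ L ∧ pl.1 ∈ pl.2} with hA
  have hfin : ((P ×ˢ L).filter fun pl => pl.1 ∈ pl.2 : Finset ((ℝ × ℝ) × Set (ℝ × ℝ))) = A := by
    ext pl
    simp [hA, and_assoc]
  rw [← hfin, Set.ncard_coe_finset]
  set I := (P ×ˢ L).filter fun pl => pl.1 ∈ pl.2 with hI
  have hmem : ∀ x ∈ I, x.1 ∈ P ∧ x.2 ∈ L ∧ x.1 ∈ x.2 := fun x hx => by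
    simpa [hI, and_assoc] using hx
  have hv : (I.filter fun x => ∃ c, x.2 = {y | y.1 = c}).card ≤ P.card := by
    refine Finset.card_le_card_of_injOn Prod.fst
      (fun x hx => (hmem x (Finset.mem_filter.1 hx).1).1) ?_
    rintro ⟨p, l⟩ hx ⟨q, l'⟩ hy hxy
    obtain rfl : p = q := hxy
    obtain ⟨hxI, c, rfl⟩ := Finset.mem_filter.1 hx
    obtain ⟨hyI, c', rfl⟩ := Finset.mem_filter.1 hy
    have h1 : p.1 = c := (hmem _ hxI).2.2
    have h2 : p.1 = c' := (hmem _ hyI).2.2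
    rw [← h1, ← h2]
  have hgraph : ∀ l ∈ L.filter (fun l => ¬ ∃ c, l = {y | y.1 = c}),
      ∃ d : ℝ × ℝ, l = {x | x.2 = d.1 * x.1 + d.2} := fun l hl =>
    (SzemerediTrotter.vertical_or_graph (hL l (Finset.mem_filter.1 hl).1)).resolve_left
      (Finset.mem_filter.1 hl).2
  choose! d hd using hgraph
  set D := (L.filter fun l => ¬ ∃ c, l = {y | y.1 = c}).image d with hD
  have hDc : D.card ≤ L.card := Finset.card_image_le.trans (Finset.card_filter_le _ _)
  have hg : (I.filter fun x => ¬ ∃ c, x.2 = {y | y.1 = c}).card ≤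
      ((P ×ˢ D).filter fun x => x.1.2 = x.2.1 * x.1.1 + x.2.2).card := by
    have hmem' : ∀ x ∈ I.filter (fun x => ¬ ∃ c, x.2 = {y | y.1 = c}),
        x.2 ∈ L.filter (fun l => ¬ ∃ c, l = {y | y.1 = c}) := fun x hx =>
      Finset.mem_filter.2 ⟨(hmem x (Finset.mem_filter.1 hx).1).2.1, (Finset.mem_filter.1 hx).2⟩
    refine Finset.card_le_card_of_injOn (fun x => (x.1, d x.2)) ?_ ?_
    · intro x hx
      obtain ⟨h1, h2, h3⟩ := hmem x (Finset.mem_filter.1 hx).1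
      refine Finset.mem_filter.2 ⟨Finset.mem_product.2
        ⟨h1, Finset.mem_image_of_mem d (hmem' x hx)⟩, ?_⟩
      rw [hd _ (hmem' x hx)] at h3
      exact h3
    · intro x hx y hy hxy
      obtain ⟨h1, h2⟩ := Prod.mk.inj hxy
      exact Prod.ext h1 (by rw [hd _ (hmem' x hx), hd _ (hmem' y hy), h2])
  have hsplit := Finset.card_filter_add_card_filter_not (s := I)
    (fun x => ∃ c, x.2 = {y | y.1 = c})
  have hST := SzemerediTrotter.card_incidences_nonvertical_le P D hDc
  have hcard : (I.card : ℝ) ≤ P.card +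
      ((P ×ˢ D).filter fun x => x.1.2 = x.2.1 * x.1.1 + x.2.2).card := by
    exact_mod_cast hsplit.symm.le.trans (Nat.add_le_add hv hg)
  have h0 : (0 : ℝ) ≤ (P.card : ℝ) ^ ((2 : ℝ) / 3) * (L.card : ℝ) ^ ((2 : ℝ) / 3) := by
    positivity
  have h1 : (0 : ℝ) ≤ L.card := Nat.cast_nonneg _
  linarith
end

section
/- Let P be a collection of m points in ℝ² and S a collection of n curves with k degrees of freedom, i.e., there is a constant C₀ such that any two curves meet in at most C₀ points and at most C₀ curves contain any given k points. Then the number of point-curve incidences is O(m^{k/(2k-1)} n^{(2k-2)/(2k-1)} + m + n), with implicit constant depending only on C₀ and k. -/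
/-- A nowhere vanishing continuous function on a simply connected space has a continuous
logarithm. -/
theorem exists_continuous_log {X : Type*} [TopologicalSpace X] [SimplyConnectedSpace X]
    [LocallyPathConnectedSpace X] {f : X → ℂ} (hf : Continuous f) (h0 : ∀ x, f x ≠ 0) :
    ∃ L : X → ℂ, Continuous L ∧ ∀ x, Complex.exp (L x) = f x := by
  obtain ⟨x₀⟩ : Nonempty X := inferInstance
  obtain ⟨F, ⟨-, hF⟩, -⟩ := Complex.isCoveringMapOn_exp.existsUnique_continuousMap_lifts
    (⟨f, hf⟩ : C(X, ℂ)) (a₀ := x₀) (e₀ := Complex.log (f x₀)) (Complex.exp_log (h0 x₀)) h0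
  exact ⟨F, F.continuous, fun x => congrFun hF x⟩

/-- Two continuous logarithms of proportional functions on the line have the same increments. -/
theorem log_increment_unique {L₁ L₂ : ℝ → ℂ} (h₁ : Continuous L₁) (h₂ : Continuous L₂) {c : ℂ}
    (h : ∀ t, Complex.exp (L₁ t) = c * Complex.exp (L₂ t)) (s t : ℝ) :
    L₁ t - L₁ s = L₂ t - L₂ s := by
  have hu := Complex.isCoveringMapOn_exp.existsUnique_continuousMap_lifts
    (⟨fun t => Complex.exp (L₁ t), by fun_prop⟩ : C(ℝ, ℂ)) (a₀ := s) (e₀ := L₁ s) rfl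
    (fun a => Complex.exp_ne_zero _)
  have := hu.unique (y₁ := ⟨L₁, h₁⟩) (y₂ := ⟨fun t => L₂ t + (L₁ s - L₂ s), by fun_prop⟩)
    ⟨rfl, rfl⟩ ⟨by simp, by
      funext x
      simp only [Function.comp_apply, ContinuousMap.coe_mk, Complex.exp_add, Complex.exp_sub, h]
      field_simp [Complex.exp_ne_zero]⟩
  have h3 := congrArg (fun F : C(ℝ, ℂ) => F t) this
  simp only [ContinuousMap.coe_mk] at h3
  rw [h3]; ring

open Classical in
/-- The total variation of a continuous logarithm of `f` over the unit interval. -/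
noncomputable def logVariation (f : ℝ → ℂ) : ℂ :=
  if h : ∃ L : ℝ → ℂ, Continuous L ∧ ∀ x, Complex.exp (L x) = f x then
    h.choose 1 - h.choose 0 else 0

theorem logVariation_eq {f L : ℝ → ℂ} (hL : Continuous L) {c : ℂ}
    (h : ∀ t, Complex.exp (L t) = c * f t) : logVariation f = L 1 - L 0 := by
  have hc : c ≠ 0 := by
    rintro rfl
    exact Complex.exp_ne_zero (L 0) (by simpa using h 0)
  have hex : ∃ L : ℝ → ℂ, Continuous L ∧ ∀ x, Complex.exp (L x) = f x := by
    refine ⟨fun t => L t - Complex.log c, by fun_prop, fun x => ?_⟩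
    rw [Complex.exp_sub, Complex.exp_log hc, h]
    field_simp
  rw [logVariation, dif_pos hex]
  refine (log_increment_unique hL hex.choose_spec.1 (c := c) (fun t => ?_) 0 1).symm
  rw [hex.choose_spec.2, h]

theorem exp_logVariation {f : ℝ → ℂ} (hf : Continuous f) (h0 : ∀ t, f t ≠ 0) :
    Complex.exp (logVariation f) = f 1 / f 0 := by
  obtain ⟨L, hL, h⟩ := exists_continuous_log hf h0
  rw [logVariation_eq hL (c := 1) (by simpa using h), Complex.exp_sub, h, h]

/-- The increments of the logarithm of `g s - h t` along the four sides of a square cancel. -/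
theorem logVariation_square {g h : ℝ → ℂ} (hg : Continuous g) (hh : Continuous h)
    (hne : ∀ s t, g s ≠ h t) :
    logVariation (fun t => h t - g 0) + logVariation (fun s => g s - h 1) =
      logVariation (fun s => g s - h 0) + logVariation (fun t => h t - g 1) := by
  obtain ⟨L, hL, hexp⟩ := exists_continuous_log (X := ℝ × ℝ) (f := fun x => g x.1 - h x.2)
    (by fun_prop) (fun x => sub_ne_zero.2 (hne _ _))
  rw [logVariation_eq (L := fun t => L (0, t)) (by fun_prop) (c := -1) (by simp [hexp]),
    logVariation_eq (L := fun s => L (s, 1)) (by fun_prop) (c := 1) (by simp [hexp]),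
    logVariation_eq (L := fun s => L (s, 0)) (by fun_prop) (c := 1) (by simp [hexp]),
    logVariation_eq (L := fun t => L (1, t)) (by fun_prop) (c := -1) (by simp [hexp])]
  ring

/-- The parity obstruction to the planarity of `K₅`. -/
theorem no_K5_cocycle (n : Fin 5 → Fin 5 → Fin 5 → ℤ) (σ : Fin 5 → Fin 5 → ℤ)
    (hσ : ∀ v w, σ v w = if w < v then 1 else 0)
    (h : ∀ a b c d : Fin 5, a < b → c < d → a ≠ c → a ≠ d → b ≠ c → b ≠ d →
      2 * (n a c d - n b c d + n d a b - n c a b) + (σ a d - σ d a) - (σ a c - σ c a)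
        - (σ b d - σ d b) + (σ b c - σ c b) = 0) : False := by
  have h' : ∀ a b c d : Fin 5, a < b ∧ c < d ∧ a ≠ c ∧ a ≠ d ∧ b ≠ c ∧ b ≠ d →
      2 * (n a c d - n b c d + n d a b - n c a b) +
       (((if d < a then 1 else 0) - (if a < d then 1 else 0))
        - ((if c < a then 1 else 0) - (if a < c then 1 else 0))
        - ((if d < b then 1 else 0) - (if b < d then 1 else 0))
        + ((if c < b then 1 else 0) - (if b < c then 1 else 0)) : ℤ) = 0 := by
    rintro a b c d ⟨h1, h2, h3, h4, h5, h6⟩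
    have := h a b c d h1 h2 h3 h4 h5 h6
    simp only [hσ] at this
    linarith
  have e1 := h' 0 1 2 3 (by decide)
  have e2 := h' 0 2 1 3 (by decide)
  have e3 := h' 0 3 1 2 (by decide)
  have e4 := h' 0 1 2 4 (by decide)
  have e5 := h' 0 2 1 4 (by decide)
  have e6 := h' 0 4 1 2 (by decide)
  have e7 := h' 0 1 3 4 (by decide)
  have e8 := h' 0 3 1 4 (by decide)
  have e9 := h' 0 4 1 3 (by decide)
  have e10 := h' 0 2 3 4 (by decide)
  have e11 := h' 0 3 2 4 (by decide)
  have e12 := h' 0 4 2 3 (by decide)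
  have e13 := h' 1 2 3 4 (by decide)
  have e14 := h' 1 3 2 4 (by decide)
  have e15 := h' 1 4 2 3 (by decide)
  simp (decide := true) only [if_true, if_false] at *
  omega

/-- In any drawing of `K₅` in the plane, two disjoint edges meet. -/
theorem K5_not_planar (z : Fin 5 → ℂ) (F : Fin 5 → Fin 5 → Set ℂ)
    (hF : ∀ i j, i < j → JoinedIn (F i j) (z i) (z j)) :
    ∃ a b c d : Fin 5, a < b ∧ c < d ∧ a ≠ c ∧ a ≠ d ∧ b ≠ c ∧ b ≠ d ∧
      (F a b ∩ F c d).Nonempty := by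
  by_contra hcon
  have hg : ∀ i j : Fin 5, ∃ g : ℝ → ℂ, i < j →
      Continuous g ∧ g 0 = z i ∧ g 1 = z j ∧ ∀ t, g t ∈ F i j := by
    intro i j
    by_cases hij : i < j
    · obtain ⟨γ, hγ⟩ := hF i j hij
      refine ⟨γ.extend, fun _ => ⟨γ.continuous_extend, by simp, by simp, fun t => ?_⟩⟩
      have : γ.extend t ∈ Set.range γ.extend := ⟨t, rfl⟩
      rw [Path.extend_range] at this
      obtain ⟨x, hx⟩ := this
      exact hx ▸ hγ x
    · exact ⟨fun _ => 0, fun h => absurd h hij⟩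
  choose g hg using hg
  have hdisj : ∀ a b c d : Fin 5, a < b → c < d → a ≠ c → a ≠ d → b ≠ c → b ≠ d →
      ∀ s t, g a b s ≠ g c d t := by
    intro a b c d h1 h2 h3 h4 h5 h6 s t heq
    exact hcon ⟨a, b, c, d, h1, h2, h3, h4, h5, h6, g a b s, (hg a b h1).2.2.2 s,
      heq ▸ (hg c d h2).2.2.2 t⟩
  have hoff : ∀ v c d : Fin 5, c < d → v ≠ c → v ≠ d → ∀ t, g c d t ≠ z v := by
    intro v c d hcd hvc hvd t
    obtain ⟨w, hw⟩ : ∃ w : Fin 5, w ≠ v ∧ w ≠ c ∧ w ≠ d := by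
      revert v c d; decide
    rcases lt_or_gt_of_ne hw.1 with h | h
    · have := hdisj c d w v hcd h hw.2.1.symm hvc.symm hw.2.2.symm hvd.symm t 1
      rwa [(hg w v h).2.2.1] at this
    · have := hdisj c d v w hcd h hvc.symm hw.2.1.symm hvd.symm hw.2.2.symm t 0
      rwa [(hg v w h).2.1] at this
  have hz : ∀ v w, v ≠ w → z v ≠ z w := by
    intro v w hvw
    obtain ⟨u, hu⟩ : ∃ u : Fin 5, u ≠ v ∧ u ≠ w := by
      revert v w; decide
    rcases lt_or_gt_of_ne hu.1 with h | h
    · have := hoff w u v h hu.2.symm hvw.symm 1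
      rwa [(hg u v h).2.2.1] at this
    · have := hoff w v u h hvw.symm hu.2.symm 0
      rwa [(hg v u h).2.1] at this
  set θ : Fin 5 → Fin 5 → ℂ := fun v w => Complex.log (z (max v w) - z (min v w)) with hθ
  have hθs : ∀ v w, θ v w = θ w v := by
    intro v w; simp only [hθ, max_comm, min_comm]
  set σ : Fin 5 → Fin 5 → ℤ := fun v w => if w < v then 1 else 0 with hσ
  have hexp : ∀ v w, v ≠ w → Complex.exp (θ v w + Real.pi * Complex.I * σ v w) = z w - z v := by
    intro v w hvw
    have hne := sub_ne_zero.2 (hz v w hvw)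
    have hne' := sub_ne_zero.2 (hz w v hvw.symm)
    rcases lt_or_gt_of_ne hvw with h | h
    · simp [hθ, hσ, max_eq_right h.le, min_eq_left h.le, Complex.exp_log hne', h.not_gt]
    · simp [hθ, hσ, max_eq_left h.le, min_eq_right h.le, Complex.exp_add, Complex.exp_log hne, h]
  set W : Fin 5 → Fin 5 → Fin 5 → ℂ := fun v c d => logVariation (fun t => g c d t - z v) with hW
  have hn : ∀ v c d : Fin 5, ∃ n : ℤ, c < d → v ≠ c → v ≠ d →
      W v c d = (θ v d + Real.pi * Complex.I * σ v d) - (θ v c + Real.pi * Complex.I * σ v c)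
        + n * (2 * Real.pi * Complex.I) := by
    intro v c d
    by_cases hh : c < d ∧ v ≠ c ∧ v ≠ d
    · obtain ⟨hcd, hvc, hvd⟩ := hh
      have h1 : Complex.exp (W v c d) = Complex.exp
          ((θ v d + Real.pi * Complex.I * σ v d) - (θ v c + Real.pi * Complex.I * σ v c)) := by
        rw [Complex.exp_sub, hexp v d hvd, hexp v c hvc]
        have hc := (hg c d hcd).1
        rw [hW, exp_logVariation (by fun_prop) (fun t => sub_ne_zero.2 (hoff v c d hcd hvc hvd t)),
          (hg c d hcd).2.1, (hg c d hcd).2.2.1]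
      obtain ⟨n, hn⟩ := Complex.exp_eq_exp_iff_exists_int.1 h1
      exact ⟨n, fun _ _ _ => hn⟩
    · exact ⟨0, fun h1 h2 h3 => absurd ⟨h1, h2, h3⟩ hh⟩
  choose n hn using hn
  refine no_K5_cocycle n σ (fun _ _ => rfl) ?_
  intro a b c d hab hcd hac had hbc hbd
  have hsq := logVariation_square (hg a b hab).1 (hg c d hcd).1
      (hdisj a b c d hab hcd hac had hbc hbd)
  rw [(hg a b hab).2.1, (hg a b hab).2.2.1, (hg c d hcd).2.1, (hg c d hcd).2.2.1] at hsq
  change W a c d + W d a b = W c a b + W b c d at hsq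
  rw [hn a c d hcd hac had, hn d a b hab had.symm hbd.symm, hn c a b hab hac.symm hbc.symm,
    hn b c d hcd hbc hbd, hθs d b, hθs d a, hθs c b, hθs c a] at hsq
  have hpi : (Real.pi * Complex.I : ℂ) ≠ 0 := by simp [Real.pi_ne_zero]
  have key : (Real.pi * Complex.I : ℂ) * ((2 * (n a c d - n b c d + n d a b - n c a b)
      + (σ a d - σ d a) - (σ a c - σ c a) - (σ b d - σ d b) + (σ b c - σ c b) : ℤ) : ℂ) = 0 := by
    push_cast
    linear_combination hsq
  have := (mul_eq_zero.1 key).resolve_left hpi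
  exact_mod_cast this

/-- Any two points of `U` are joined by an `R`-chain inside `U`. -/
def ChainConnected {V : Type*} (R : V → V → Prop) (U : Finset V) : Prop :=
  ∀ x ∈ U, ∀ y ∈ U, Relation.ReflTransGen (fun a b => R a b ∧ a ∈ U ∧ b ∈ U) x y

theorem chainConnected_insert {V : Type*} [DecidableEq V] {R : V → V → Prop}
    (hR : ∀ ⦃x y⦄, R x y → R y x)
    {U : Finset V} (hU : ChainConnected R U) {u w : V} (hu : u ∈ U) (huw : R u w) :
    ChainConnected R (insert w U) := by
  have hold : ∀ x ∈ U, ∀ y ∈ U,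
      Relation.ReflTransGen (fun a b => R a b ∧ a ∈ insert w U ∧ b ∈ insert w U) x y :=
    fun x hx y hy => Relation.ReflTransGen.mono (fun a b h =>
      ⟨h.1, Finset.mem_insert_of_mem h.2.1, Finset.mem_insert_of_mem h.2.2⟩) _ _ (hU x hx y hy)
  have h1 : Relation.ReflTransGen (fun a b => R a b ∧ a ∈ insert w U ∧ b ∈ insert w U) u w :=
    .single ⟨huw, Finset.mem_insert_of_mem hu, Finset.mem_insert_self _ _⟩
  have h2 : Relation.ReflTransGen (fun a b => R a b ∧ a ∈ insert w U ∧ b ∈ insert w U) w u :=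
    .single ⟨hR huw, Finset.mem_insert_self _ _, Finset.mem_insert_of_mem hu⟩
  intro x hx y hy
  rcases Finset.mem_insert.1 hx with hxw | hxU <;> rcases Finset.mem_insert.1 hy with hyw | hyU
  · rw [hxw, hyw]
  · rw [hxw]; exact h2.trans (hold _ hu _ hyU)
  · rw [hyw]; exact (hold _ hxU _ hu).trans h1
  · exact hold _ hxU _ hyU

/-- `B` is a family of branch sets inside `W` exhibiting a complete minor of the graph `R`. -/
structure IsCompleteMinor {V : Type*} (R : V → V → Prop) {r : ℕ} (B : Fin r → Finset V)
    (W : Finset V) : Prop where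
  nonempty : ∀ i, (B i).Nonempty
  subset : ∀ i, B i ⊆ W
  connected : ∀ i, ChainConnected R (B i)
  disjoint : ∀ i j, i ≠ j → Disjoint (B i) (B j)
  adj : ∀ i j, i ≠ j → ∃ x ∈ B i, ∃ y ∈ B j, R x y

open Classical in
/-- The number of ordered pairs of related elements of `W`. -/
noncomputable def adjCount {V : Type*} (R : V → V → Prop) (W : Finset V) : ℕ :=
  ∑ x ∈ W, (W.filter (R x)).card

open Classical in
theorem adjCount_erase {V : Type*} {R : V → V → Prop} (hR : ∀ ⦃x y⦄, R x y → R y x)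
    (hirr : ∀ x, ¬ R x x) {W : Finset V} {w : V} (hw : w ∈ W) :
    adjCount R W = adjCount R (W.erase w) + 2 * (W.filter (R w)).card := by
  unfold adjCount
  rw [← Finset.add_sum_erase W _ hw]
  have h1 : ∀ x ∈ W.erase w, (W.filter (R x)).card =
      ((W.erase w).filter (R x)).card + if R w x then 1 else 0 := by
    intro x _
    have : (W.erase w).filter (R x) = (W.filter (R x)).erase w := by
      ext y; simp only [Finset.mem_filter, Finset.mem_erase]; tauto
    rw [this]
    split_ifs with h
    · rw [Finset.card_erase_add_one (Finset.mem_filter.2 ⟨hw, hR h⟩)]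
    · rw [Finset.erase_eq_of_notMem, add_zero]
      simp only [Finset.mem_filter, not_and]
      exact fun _ h' => h (hR h')
  rw [Finset.sum_congr rfl h1, Finset.sum_add_distrib, ← Finset.card_filter]
  have h2 : (W.erase w).filter (R w) = W.filter (R w) := by
    ext y; simp only [Finset.mem_filter, Finset.mem_erase]
    refine ⟨fun h => ⟨h.1.2, h.2⟩, fun h => ⟨⟨?_, h.1⟩, h.2⟩⟩
    rintro rfl; exact hirr _ h.2
  rw [h2]; omega

open Classical in
/-- A dense graph contains a large complete minor. -/
theorem exists_isCompleteMinor {V : Type*} {R : V → V → Prop} (hR : ∀ ⦃x y⦄, R x y → R y x)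
    (hirr : ∀ x, ¬ R x x) (r : ℕ) :
    ∀ W : Finset V, W.Nonempty → 2 ^ (r + 1) * W.card ≤ adjCount R W →
      ∃ B : Fin r → Finset V, IsCompleteMinor R B W := by
  induction r with
  | zero =>
    intro W _ _
    exact ⟨fun i => i.elim0, fun i => i.elim0, fun i => i.elim0, fun i => i.elim0,
      fun i => i.elim0, fun i => i.elim0⟩
  | succ r ihr =>
    intro W
    induction hn : W.card using Nat.strong_induction_on generalizing W with
    | _ n ihW =>
    subst hn
    intro hWne hWA
    set c := 2 ^ (r + 1) with hc
    have hcpos : 0 < c := by positivity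
    replace hWA : 2 * c * W.card ≤ adjCount R W := by
      rw [pow_succ, ← hc] at hWA; linarith
    set N : Finset V → Finset V := fun U => (W \ U).filter (fun x => ∃ u ∈ U, R u x) with hN
    set good : Finset V → Prop := fun U => U.Nonempty ∧ ChainConnected R U ∧
      2 * c * (W.card + 1) ≤ adjCount R (W \ U) + 2 * (N U).card + 2 * c * U.card with hgood
    obtain ⟨w₀, hw₀⟩ := hWne
    have hg₀ : good {w₀} := by
      refine ⟨Finset.singleton_nonempty _, ?_, ?_⟩
      · intro x hx y hy
        rw [Finset.mem_singleton] at hx hy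
        subst hx; subst hy; exact .refl
      · have h1 := adjCount_erase hR hirr hw₀
        have h2 : N {w₀} = W.filter (R w₀) := by
          ext y
          simp only [hN, Finset.mem_filter, Finset.mem_sdiff, Finset.mem_singleton,
            exists_eq_left]
          refine ⟨fun h => ⟨h.1.1, h.2⟩, fun h => ⟨⟨h.1, ?_⟩, h.2⟩⟩
          rintro rfl; exact hirr _ h.2
        rw [h2, Finset.sdiff_singleton_eq_erase, Finset.card_singleton]
        linarith
    obtain ⟨U, hU, hmax⟩ := Finset.exists_max_image (W.powerset.filter good) Finset.card
      ⟨{w₀}, by simp [hg₀, hw₀]⟩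
    rw [Finset.mem_filter, Finset.mem_powerset] at hU
    obtain ⟨hUW, hUne, hUconn, hUcard⟩ := hU
    by_cases hNe : (N U).Nonempty
    · have hdeg : ∀ w ∈ N U, c ≤ ((N U).filter (R w)).card := by
        intro w hw
        have hw' := hw
        simp only [hN, Finset.mem_filter, Finset.mem_sdiff] at hw'
        obtain ⟨⟨hwW, hwU⟩, u, hu, huw⟩ := hw'
        have hnot : ¬ good (insert w U) := by
          intro hg
          have := hmax (insert w U) (by
            simp [hg, Finset.insert_subset_iff, hwW, hUW])
          rw [Finset.card_insert_of_notMem hwU] at this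
          omega
        have hlt : adjCount R (W \ insert w U) + 2 * (N (insert w U)).card +
            2 * c * (insert w U).card < 2 * c * (W.card + 1) := by
          by_contra hcon
          exact hnot ⟨Finset.insert_nonempty _ _,
            chainConnected_insert hR hUconn hu huw, not_lt.1 hcon⟩
        rw [Finset.card_insert_of_notMem hwU] at hlt
        have hA := adjCount_erase hR hirr (Finset.mem_sdiff.2 ⟨hwW, hwU⟩)
        rw [← Finset.sdiff_insert] at hA
        have hNsub : ((N U).erase w) ∪ ((W \ U).filter (R w) \ N U) ⊆ N (insert w U) := by
          intro y hy
          simp only [hN, Finset.mem_union, Finset.mem_erase, Finset.mem_filter, Finset.mem_sdiff,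
            Finset.mem_insert, not_or] at hy ⊢
          rcases hy with ⟨hyw, ⟨hyW, hyU⟩, v, hv, hvy⟩ | ⟨⟨⟨hyW, hyU⟩, hwy⟩, _⟩
          · exact ⟨⟨hyW, hyw, hyU⟩, v, Or.inr hv, hvy⟩
          · refine ⟨⟨hyW, ?_, hyU⟩, w, Or.inl rfl, hwy⟩
            rintro rfl; exact hirr _ hwy
        have hcard := Finset.card_le_card hNsub
        rw [Finset.card_union_of_disjoint (by
          rw [Finset.disjoint_left]
          intro y hy hy'
          exact (Finset.mem_sdiff.1 hy').2 (Finset.mem_of_mem_erase hy))] at hcard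
        have h1 := Finset.card_erase_add_one hw
        have h2 := Finset.card_sdiff_add_card_inter ((W \ U).filter (R w)) (N U)
        have h3 : (W \ U).filter (R w) ∩ N U = (N U).filter (R w) := by
          ext y; simp only [hN, Finset.mem_inter, Finset.mem_filter, Finset.mem_sdiff]; tauto
        rw [h3] at h2
        by_contra hlt'
        push Not at hlt'
        have : 2 * c * (U.card + 1) = 2 * c * U.card + 2 * c := by ring
        omega
      have hNA : c * (N U).card ≤ adjCount R (N U) := by
        unfold adjCount
        rw [mul_comm, ← smul_eq_mul]
        exact Finset.card_nsmul_le_sum _ _ _ hdeg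
      obtain ⟨B, hB⟩ := ihr (N U) hNe hNA
      have hNdisj : Disjoint U (N U) := by
        rw [Finset.disjoint_left]
        intro x hx hx'
        exact (Finset.mem_sdiff.1 (Finset.mem_filter.1 hx').1).2 hx
      have hadj : ∀ i, ∃ x ∈ U, ∃ y ∈ B i, R x y := by
        intro i
        obtain ⟨y, hy⟩ := hB.nonempty i
        obtain ⟨u, hu, huy⟩ := (Finset.mem_filter.1 (hB.subset i hy)).2
        exact ⟨u, hu, y, hy, huy⟩
      refine ⟨Fin.cons U B, ?_, ?_, ?_, ?_, ?_⟩
      · intro i; refine Fin.cases ?_ (fun i => ?_) i <;> simp [hUne, hB.nonempty]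
      · intro i; refine Fin.cases ?_ (fun i => ?_) i
        · simpa using hUW
        · simp only [Fin.cons_succ]
          exact (hB.subset i).trans ((Finset.filter_subset _ _).trans Finset.sdiff_subset)
      · intro i; refine Fin.cases ?_ (fun i => ?_) i
        · simpa using hUconn
        · simpa using hB.connected i
      · intro i j
        refine Fin.cases ?_ (fun i => ?_) i <;> refine Fin.cases ?_ (fun j => ?_) j
        · simp
        · intro _; simpa using hNdisj.mono_right (hB.subset j)
        · intro _; simpa using (hNdisj.mono_right (hB.subset i)).symm
        · intro hij; simpa using hB.disjoint i j (by rintro rfl; exact hij rfl)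
      · intro i j
        refine Fin.cases ?_ (fun i => ?_) i <;> refine Fin.cases ?_ (fun j => ?_) j
        · simp
        · intro _; simpa using hadj j
        · intro _
          obtain ⟨x, hx, y, hy, hxy⟩ := hadj i
          exact ⟨y, by simpa using hy, x, by simpa using hx, hR hxy⟩
        · intro hij; simpa using hB.adj i j (by rintro rfl; exact hij rfl)
    · rw [Finset.not_nonempty_iff_eq_empty] at hNe
      rw [hNe, Finset.card_empty] at hUcard
      have hsd := Finset.card_sdiff_add_card_eq_card hUW
      have hUpos := hUne.card_pos
      have hAle : 2 * c * (W \ U).card + 2 * c ≤ adjCount R (W \ U) := by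
        rw [← hsd] at hUcard; nlinarith
      have hWUne : (W \ U).Nonempty := by
        by_contra hempty
        rw [Finset.not_nonempty_iff_eq_empty] at hempty
        rw [hempty] at hAle
        simp only [adjCount, Finset.sum_empty, Finset.card_empty] at hAle
        omega
      obtain ⟨B, hB⟩ := ihW (W \ U).card (by omega) (W \ U) rfl hWUne (by
        rw [pow_succ, ← hc]; linarith)
      exact ⟨B, hB.nonempty, fun i => (hB.subset i).trans Finset.sdiff_subset, hB.connected,
        hB.disjoint, hB.adj⟩

/-- Two edges with endpoint functions `a`, `b` share no endpoint. -/
def EndpointDisjoint {V E : Type*} (a b : E → V) (e f : E) : Prop :=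
  a e ≠ a f ∧ a e ≠ b f ∧ b e ≠ a f ∧ b e ≠ b f

theorem joinedIn_of_reflTransGen {V X : Type*} [TopologicalSpace X] {r : V → V → Prop}
    {pos : V → X} {s : Set X} {x y : V} (hx : pos x ∈ s)
    (hr : ∀ u v, r u v → JoinedIn s (pos u) (pos v)) (h : Relation.ReflTransGen r x y) :
    JoinedIn s (pos x) (pos y) := by
  induction h with
  | refl => exact JoinedIn.refl hx
  | tail _ h2 ih => exact ih.trans (hr _ _ h2)

open Classical in
/-- In a drawing of a dense simple directed graph, two edges without common endpoints meet. -/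
theorem exists_crossing_of_dense {V E : Type*} {a b : E → V} (hab : ∀ e, a e ≠ b e)
    {pos : V → ℝ × ℝ} {K : E → Set (ℝ × ℝ)}
    (hK : ∀ e, JoinedIn (K e) (pos (a e)) (pos (b e)))
    {F : Finset E} {W : Finset V} (hFW : ∀ e ∈ F, a e ∈ W ∧ b e ∈ W)
    (hinj : Set.InjOn (fun e => (a e, b e)) (F : Set E)) (hcard : 64 * W.card < F.card) :
    ∃ e ∈ F, ∃ f ∈ F, EndpointDisjoint a b e f ∧ (K e ∩ K f).Nonempty := by
  set R : V → V → Prop := fun x y => ∃ e ∈ F, (a e = x ∧ b e = y) ∨ (a e = y ∧ b e = x) with hRdef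
  have hR : ∀ ⦃x y⦄, R x y → R y x := by
    rintro x y ⟨e, he, h⟩
    exact ⟨e, he, h.symm⟩
  have hirr : ∀ x, ¬ R x x := by
    rintro x ⟨e, -, h | h⟩ <;> exact hab e (h.1.trans h.2.symm)
  have hA : F.card ≤ adjCount R W := by
    unfold adjCount
    rw [← Finset.card_sigma]
    refine Finset.card_le_card_of_injOn (fun e => ⟨a e, b e⟩) ?_ ?_
    · intro e he
      simp only [Finset.coe_sigma, Set.mem_sigma_iff, Finset.mem_coe, Finset.mem_filter]
      exact ⟨(hFW e he).1, (hFW e he).2, e, he, Or.inl ⟨rfl, rfl⟩⟩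
    · intro e he f hf hef
      simp only [Sigma.mk.injEq, heq_eq_eq] at hef
      exact hinj he hf (Prod.ext hef.1 hef.2)
  have hW : W.Nonempty := by
    obtain ⟨e, he⟩ : F.Nonempty := Finset.card_pos.1 (by omega)
    exact ⟨_, (hFW e he).1⟩
  obtain ⟨B, hB⟩ := exists_isCompleteMinor hR hirr 5 W hW (by norm_num; omega)
  choose c hc using hB.nonempty
  set φ := Complex.equivRealProdCLM.symm with hφ
  set D : Fin 5 → Fin 5 → Set (ℝ × ℝ) := fun i j =>
    ⋃ e ∈ {e | e ∈ F ∧ a e ∈ B i ∪ B j ∧ b e ∈ B i ∪ B j}, K e with hD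
  have hmemD : ∀ i j e, e ∈ F → a e ∈ B i ∪ B j → b e ∈ B i ∪ B j → K e ⊆ D i j := by
    intro i j e he ha hb
    exact Set.subset_biUnion_of_mem (u := fun e => K e) (show e ∈ {e | e ∈ F ∧ _} from ⟨he, ha, hb⟩)
  have hstep : ∀ i j u v, R u v → u ∈ B i ∪ B j → v ∈ B i ∪ B j →
      JoinedIn (D i j) (pos u) (pos v) := by
    rintro i j u v ⟨e, he, ⟨rfl, rfl⟩ | ⟨rfl, rfl⟩⟩ hu hv
    · exact (hK e).mono (hmemD i j e he hu hv)
    · exact ((hK e).mono (hmemD i j e he hv hu)).symm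
  have hjoin : ∀ i j, i < j → JoinedIn (D i j) (pos (c i)) (pos (c j)) := by
    intro i j hij
    obtain ⟨x, hx, y, hy, hxy⟩ := hB.adj i j hij.ne
    have hxy' := hstep i j x y hxy (Finset.mem_union_left _ hx) (Finset.mem_union_right _ hy)
    have h1 : JoinedIn (D i j) (pos x) (pos (c i)) :=
      joinedIn_of_reflTransGen hxy'.source_mem (fun u v h => hstep i j u v h.1
        (Finset.mem_union_left _ h.2.1) (Finset.mem_union_left _ h.2.2))
        (hB.connected i x hx (c i) (hc i))
    have h2 : JoinedIn (D i j) (pos y) (pos (c j)) :=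
      joinedIn_of_reflTransGen hxy'.target_mem (fun u v h => hstep i j u v h.1
        (Finset.mem_union_right _ h.2.1) (Finset.mem_union_right _ h.2.2))
        (hB.connected j y hy (c j) (hc j))
    exact (h1.symm.trans hxy').trans h2
  obtain ⟨i, j, k, l, hij, hkl, hik, hil, hjk, hjl, p, hp1, hp2⟩ :=
    K5_not_planar (fun i => φ (pos (c i))) (fun i j => φ '' D i j)
      (fun i j hij => (hjoin i j hij).map φ.continuous)
  obtain ⟨p, hp1, rfl⟩ := hp1
  obtain ⟨p', hp2, hpp⟩ := hp2
  obtain rfl : p' = p := φ.injective hpp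
  simp only [hD, Set.mem_iUnion, Set.mem_ofPred_eq] at hp1 hp2
  obtain ⟨e, ⟨he, hea, heb⟩, hpe⟩ := hp1
  obtain ⟨f, ⟨hf, hfa, hfb⟩, hpf⟩ := hp2
  have hdisj : Disjoint (B i ∪ B j) (B k ∪ B l) := by
    simp only [Finset.disjoint_union_left, Finset.disjoint_union_right]
    exact ⟨⟨hB.disjoint _ _ hik, hB.disjoint _ _ hjk⟩, hB.disjoint _ _ hil, hB.disjoint _ _ hjl⟩
  exact ⟨e, he, f, hf, ⟨Finset.disjoint_iff_ne.1 hdisj _ hea _ hfa,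
    Finset.disjoint_iff_ne.1 hdisj _ hea _ hfb, Finset.disjoint_iff_ne.1 hdisj _ heb _ hfa,
    Finset.disjoint_iff_ne.1 hdisj _ heb _ hfb⟩, p', hpe, hpf⟩

theorem card_functions_agreeing {ι α : Type*} [Fintype ι] [DecidableEq ι] [Fintype α]
    (T : Finset ι) (h : ι → α) [DecidablePred fun f : ι → α => ∀ i ∈ T, f i = h i] :
    (Finset.univ.filter (fun f : ι → α => ∀ i ∈ T, f i = h i)).card * Fintype.card α ^ T.card =
      Fintype.card α ^ Fintype.card ι := by
  classical
  have : Finset.univ.filter (fun f : ι → α => ∀ i ∈ T, f i = h i) =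
      Fintype.piFinset (fun i => if i ∈ T then {h i} else Finset.univ) := by
    ext f
    simp only [Finset.mem_filter, Finset.mem_univ, true_and, Fintype.mem_piFinset]
    refine forall_congr' fun i => ?_
    split_ifs with hi <;> simp [hi]
  rw [this, Fintype.card_piFinset, ← Finset.prod_mul_prod_compl T]
  rw [Finset.prod_congr rfl (g := fun _ => 1) (fun i hi => by simp [hi]),
    Finset.prod_congr (s₁ := Tᶜ) rfl (g := fun _ => Fintype.card α)
      (fun i hi => by simp [Finset.mem_compl.1 hi])]
  rw [Finset.prod_const, Finset.prod_const, one_pow, one_mul, ← pow_add, Finset.card_compl,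
    Nat.sub_add_cancel (Finset.card_le_univ _)]

theorem card_le_of_exists_pair {E : Type*} {Y : E → E → Prop}
    [DecidablePred fun p : E × E => Y p.1 p.2] {t : ℕ} (F : Finset E)
    (h : ∀ F' ⊆ F, t < F'.card → ∃ e ∈ F', ∃ f ∈ F', Y e f) :
    F.card ≤ t + ((F ×ˢ F).filter (fun p => Y p.1 p.2)).card := by
  classical
  induction hn : F.card generalizing F with
  | zero => omega
  | succ n ih =>
    by_cases hlt : t < F.card
    · obtain ⟨e, he, f, hf, hef⟩ := h F subset_rfl hlt
      have h1 := ih (F.erase e) (fun F' hF' => h F' (hF'.trans (Finset.erase_subset _ _)))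
        (by rw [Finset.card_erase_of_mem he]; omega)
      have h2 : ((F.erase e ×ˢ F.erase e).filter (fun p => Y p.1 p.2)).card <
          ((F ×ˢ F).filter (fun p => Y p.1 p.2)).card := by
        refine Finset.card_lt_card ⟨?_, fun hsub => ?_⟩
        · intro p hp
          simp only [Finset.mem_filter, Finset.mem_product, Finset.mem_erase] at hp ⊢
          exact ⟨⟨hp.1.1.2, hp.1.2.2⟩, hp.2⟩
        · have := hsub (Finset.mem_filter.2 ⟨Finset.mk_mem_product he hf, hef⟩)
          simp at this
      omega
    · omega

open Classical in
/-- The crossing inequality for directed multigraphs: if every simple subgraph with more than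
`c` edges per vertex has two crossing edges without common endpoints, then a multigraph with
edge multiplicity at most `M` has many such pairs. -/
theorem crossing_inequality {V E : Type*} [Fintype V] [Fintype E] {a b : E → V}
    (hab : ∀ e, a e ≠ b e) {M : ℕ} (hM : 0 < M)
    (hmult : ∀ u v, (Finset.univ.filter (fun e => a e = u ∧ b e = v)).card ≤ M)
    {X : E → E → Prop} {c : ℕ}
    (hX : ∀ (F : Finset E) (W : Finset V), (∀ e ∈ F, a e ∈ W ∧ b e ∈ W) →
      Set.InjOn (fun e => (a e, b e)) (F : Set E) → c * W.card < F.card →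
      ∃ e ∈ F, ∃ f ∈ F, EndpointDisjoint a b e f ∧ X e f) {q : ℕ} (hq : 0 < q) :
    Fintype.card E * (q ^ 2 * M) ≤ c * Fintype.card V * (q ^ 3 * M ^ 2) +
      (Finset.univ.filter (fun p : E × E => EndpointDisjoint a b p.1 p.2 ∧ X p.1 p.2)).card := by
  have : NeZero q := ⟨hq.ne'⟩
  have hl : ∀ u v, ∃ g : E → Fin M, Set.InjOn g {e | a e = u ∧ b e = v} := by
    intro u v
    obtain ⟨g⟩ := Function.Embedding.nonempty_of_card_le
      (α := {e // e ∈ Finset.univ.filter (fun e => a e = u ∧ b e = v)}) (β := Fin M)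
      (by rw [Fintype.card_coe, Fintype.card_fin]; exact hmult u v)
    refine ⟨fun e => if h : e ∈ Finset.univ.filter (fun e => a e = u ∧ b e = v) then g ⟨e, h⟩
      else ⟨0, hM⟩, ?_⟩
    intro e he f hf hef
    have he' : e ∈ Finset.univ.filter (fun e => a e = u ∧ b e = v) := by simpa using he
    have hf' : f ∈ Finset.univ.filter (fun e => a e = u ∧ b e = v) := by simpa using hf
    simp only [he', hf', dite_true] at hef
    exact congrArg Subtype.val (g.injective hef)
  choose g hg using hl
  set l : E → Fin M := fun e => g (a e) (b e) e with hldef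
  let Ω := (V → Fin q) × (V × V → Fin M)
  let W : Ω → Finset V := fun ω => Finset.univ.filter (fun v => ω.1 v = 0)
  let F : Ω → Finset E := fun ω => Finset.univ.filter
    (fun e => ω.1 (a e) = 0 ∧ ω.1 (b e) = 0 ∧ ω.2 (a e, b e) = l e)
  let Y : E → E → Prop := fun e f => EndpointDisjoint a b e f ∧ X e f
  have hpoint : ∀ ω : Ω, (F ω).card ≤
      c * (W ω).card + ((F ω ×ˢ F ω).filter (fun p => Y p.1 p.2)).card := by
    intro ω
    refine card_le_of_exists_pair (Y := Y) (F ω) fun F' hF' hlt => hX F' (W ω) ?_ ?_ hlt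
    · intro e he
      have := (Finset.mem_filter.1 (hF' he)).2
      simp [W, this.1, this.2.1]
    · intro e he f hf hef
      have h1 := (Finset.mem_filter.1 (hF' he)).2.2.2
      have h2 := (Finset.mem_filter.1 (hF' hf)).2.2.2
      simp only [Prod.mk.injEq] at hef
      refine hg (a e) (b e) ⟨rfl, rfl⟩ ⟨hef.1.symm, hef.2.symm⟩ ?_
      rw [hef.1, hef.2] at h1 ⊢
      have h3 := h1.symm.trans h2
      simpa only [hldef, hef.1, hef.2] using h3
  have hsum := Finset.sum_le_sum (s := Finset.univ) fun ω _ => hpoint ω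
  rw [Finset.sum_add_distrib, ← Finset.mul_sum] at hsum
  set T := Fintype.card Ω with hT
  have hTpos : 0 < T := by
    have : Nonempty (Fin M) := ⟨⟨0, hM⟩⟩
    exact Fintype.card_pos
  have hTval : T = q ^ Fintype.card V * M ^ Fintype.card (V × V) := by
    simp [hT, Ω]
  have hcount : ∀ (S₁ : Finset V) (S₂ : Finset (V × V)) (h : V × V → Fin M) (P : Ω → Prop)
      [DecidablePred P],
      (∀ ω, P ω ↔ (∀ v ∈ S₁, ω.1 v = 0) ∧ ∀ v ∈ S₂, ω.2 v = h v) →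
      (Finset.univ.filter P).card * (q ^ S₁.card * M ^ S₂.card) = T := by
    intro S₁ S₂ h P _ hP
    have h1 : Finset.univ.filter P =
        (Finset.univ.filter (fun f : V → Fin q => ∀ i ∈ S₁, f i = 0)) ×ˢ
        (Finset.univ.filter (fun f : V × V → Fin M => ∀ i ∈ S₂, f i = h i)) := by
      ext ω; rw [Finset.mem_product]; simp only [Finset.mem_filter, Finset.mem_univ, true_and, hP]
    have h2 := card_functions_agreeing S₁ (fun _ : V => (0 : Fin q))
    have h3 := card_functions_agreeing S₂ h
    rw [Fintype.card_fin] at h2 h3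
    rw [h1, Finset.card_product, hTval, ← h2, ← h3, mul_mul_mul_comm]
  have hE : (∑ ω, (F ω).card) * (q ^ 2 * M) = Fintype.card E * T := by
    have hconst : Fintype.card E * T = ∑ _e : E, T := by simp
    simp only [F, Finset.card_filter]
    rw [Finset.sum_comm, Finset.sum_mul, hconst]
    refine Finset.sum_congr rfl fun e _ => ?_
    rw [← Finset.card_filter, ← hcount {a e, b e} {(a e, b e)} (fun _ => l e)
      (fun ω => ω.1 (a e) = 0 ∧ ω.1 (b e) = 0 ∧ ω.2 (a e, b e) = l e) (fun ω => by
      simp [and_assoc]), Finset.card_pair (hab e)]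
    simp
  have hW : (∑ ω, (W ω).card) * q = Fintype.card V * T := by
    have hconst : Fintype.card V * T = ∑ _v : V, T := by simp
    simp only [W, Finset.card_filter]
    rw [Finset.sum_comm, Finset.sum_mul, hconst]
    refine Finset.sum_congr rfl fun v _ => ?_
    rw [← Finset.card_filter, ← hcount {v} ∅ (fun _ => ⟨0, hM⟩) (fun ω => ω.1 v = 0)
      (fun ω => by simp)]
    simp
  have hP : (∑ ω, ((F ω ×ˢ F ω).filter (fun p => Y p.1 p.2)).card) * (q ^ 4 * M ^ 2) =
      (Finset.univ.filter (fun p : E × E => Y p.1 p.2)).card * T := by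
    have h1 : ∀ ω, (F ω ×ˢ F ω).filter (fun p => Y p.1 p.2) =
        (Finset.univ.filter (fun p : E × E => Y p.1 p.2)).filter
          (fun p => p.1 ∈ F ω ∧ p.2 ∈ F ω) := by
      intro ω; ext p; simp only [Finset.mem_filter, Finset.mem_product, Finset.mem_univ, true_and]
      tauto
    simp only [h1]
    simp only [Finset.card_filter (fun p : E × E => p.1 ∈ F _ ∧ p.2 ∈ F _)]
    rw [Finset.sum_comm, Finset.sum_mul, ← smul_eq_mul (Finset.card _) T, ← Finset.sum_const]
    refine Finset.sum_congr rfl fun p hp => ?_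
    obtain ⟨⟨h1, h2, h3, h4⟩, -⟩ := (Finset.mem_filter.1 hp).2
    have hne : (a p.1, b p.1) ≠ (a p.2, b p.2) := fun h => h1 (Prod.mk.inj h).1
    change ¬ a p.1 = a p.2 at h1
    change ¬ a p.1 = b p.2 at h2
    change ¬ b p.1 = a p.2 at h3
    change ¬ b p.1 = b p.2 at h4
    rw [← Finset.card_filter, ← hcount {a p.1, b p.1, a p.2, b p.2}
      {(a p.1, b p.1), (a p.2, b p.2)}
      (fun x => if x = (a p.1, b p.1) then l p.1 else l p.2)
      (fun ω => p.1 ∈ F ω ∧ p.2 ∈ F ω) (fun ω => by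
        simp only [F, Finset.mem_filter, Finset.mem_univ, true_and, Finset.mem_insert,
          Finset.mem_singleton, forall_eq_or_imp, forall_eq, if_true, if_neg hne.symm]
        tauto), Finset.card_pair hne]
    rw [Finset.card_insert_of_notMem, Finset.card_insert_of_notMem, Finset.card_pair (hab _)]
    · simp [h3, h4]
    · simp [h1, h2, hab]
  have hfin := Nat.mul_le_mul_right (q ^ 4 * M ^ 2) hsum
  have e1 : (∑ ω, (F ω).card) * (q ^ 4 * M ^ 2) = Fintype.card E * (q ^ 2 * M) * T := by
    calc _ = (∑ ω, (F ω).card) * (q ^ 2 * M) * (q ^ 2 * M) := by ring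
      _ = _ := by rw [hE]; ring
  have e2 : (c * ∑ ω, (W ω).card) * (q ^ 4 * M ^ 2) =
      c * Fintype.card V * (q ^ 3 * M ^ 2) * T := by
    calc _ = c * ((∑ ω, (W ω).card) * q) * (q ^ 3 * M ^ 2) := by ring
      _ = _ := by rw [hW]; ring
  rw [add_mul, e1, e2, hP, ← add_mul] at hfin
  exact Nat.le_of_mul_le_mul_right hfin hTpos

/-- Finitely many points of a simple curve cut it into consecutive arcs. -/
theorem exists_consecutive_arcs {X : Type*} [TopologicalSpace X] {f : ℝ → X}
    (hf : ContinuousOn f (Set.Icc 0 1)) (hinj : Set.InjOn f (Set.Icc 0 1)) (Q : Finset X)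
    (hQ : (Q : Set X) ⊆ f '' Set.Icc 0 1) :
    ∃ (p : ℕ → X) (K : ℕ → Set X), (∀ i < Q.card, p i ∈ Q) ∧
      Set.InjOn p (Set.Iio Q.card) ∧
      (∀ i, i + 1 < Q.card → JoinedIn (K i) (p i) (p (i + 1))) ∧
      (∀ i, K i ⊆ f '' Set.Icc 0 1) ∧
      ∀ i j, i + 1 < j → j + 1 < Q.card → Disjoint (K i) (K j) := by
  classical
  obtain ⟨T, hTsub, hTQ⟩ := Finset.subset_set_image_iff.1 hQ
  have hTcard : T.card = Q.card := by
    rw [← hTQ, Finset.card_image_of_injOn (hinj.mono hTsub)]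
  let e := T.orderEmbOfFin hTcard
  let τ : ℕ → ℝ := fun i => if h : i < Q.card then e ⟨i, h⟩ else 0
  have hτ : ∀ i, i < Q.card → τ i ∈ T := fun i hi => by
    simp only [τ, hi, dite_true]; exact Finset.orderEmbOfFin_mem _ _ _
  have hlt : ∀ i j, i < j → j < Q.card → τ i < τ j := fun i j hij hj => by
    simp only [τ, hj, hij.trans hj, dite_true]
    exact e.strictMono hij
  refine ⟨fun i => f (τ i), fun i => f '' (Set.Icc (τ i) (τ (i + 1)) ∩ Set.Icc 0 1),
    fun i hi => ?_, fun i hi j hj hij => ?_, fun i hi => ?_, fun i =>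
      Set.image_mono Set.inter_subset_right, fun i j hij hj => ?_⟩
  · rw [← hTQ]; exact Finset.mem_image_of_mem _ (hτ i hi)
  · have := hinj (hTsub (hτ i hi)) (hTsub (hτ j hj)) hij
    rcases lt_trichotomy i j with h | h | h
    · exact absurd this (hlt i j h hj).ne
    · exact h
    · exact absurd this (hlt j i h hi).ne'
  · have h01 : Set.Icc (τ i) (τ (i + 1)) ⊆ Set.Icc 0 1 :=
      Set.Icc_subset_Icc (hTsub (hτ i (by omega))).1 (hTsub (hτ (i + 1) hi)).2
    beta_reduce
    rw [Set.inter_eq_left.2 h01]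
    have hle := (hlt i (i + 1) (by omega) hi).le
    exact (((convex_Icc _ _).isPathConnected ⟨_, Set.left_mem_Icc.2 hle⟩).image'
      (hf.mono h01)).joinedIn _ (Set.mem_image_of_mem _ (Set.left_mem_Icc.2 hle)) _
      (Set.mem_image_of_mem _ (Set.right_mem_Icc.2 hle))
  · refine Set.disjoint_left.2 ?_
    rintro _ ⟨s, ⟨hs, hs'⟩, rfl⟩ ⟨t, ⟨ht, ht'⟩, hst⟩
    have := hinj ht' hs' hst
    subst this
    exact absurd ((ht.1.trans hs.2)) (not_le.2 (hlt (i + 1) j hij (by omega)))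

/-- A finite set can be split into parts of size at most `D`. -/
theorem exists_grouping {Γ : Type*} [DecidableEq Γ] (A : Finset Γ) {D : ℕ} (hD : 0 < D) :
    ∃ g : Γ → ℕ, (∀ c ∈ A, g c < A.card / D + 1) ∧
      ∀ j, (A.filter (fun c => g c = j)).card ≤ D := by
  let g : Γ → ℕ := fun c => if h : c ∈ A then (A.equivFin ⟨c, h⟩ : ℕ) else 0
  have hg : ∀ c ∈ A, g c < A.card := fun c hc => by
    simp only [g, hc, dite_true]; exact (A.equivFin ⟨c, hc⟩).2
  refine ⟨fun c => g c / D, fun c hc =>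
    Nat.lt_succ_of_le (Nat.div_le_div_right (hg c hc).le), fun j => ?_⟩
  calc _ ≤ (Finset.Ico (j * D) (j * D + D)).card := by
        refine Finset.card_le_card_of_injOn g (fun c hc => ?_) ?_
        · have := (Finset.mem_filter.1 hc).2
          rw [Finset.coe_Ico, Set.mem_Ico]
          dsimp only at this
          subst this
          have h1 := Nat.div_add_mod (g c) D
          have h2 := Nat.mod_lt (g c) hD
          rw [mul_comm] at h1
          omega
        · intro c hc c' hc' h
          have hc := (Finset.mem_filter.1 hc).1
          have hc' := (Finset.mem_filter.1 hc').1
          simp only [g, hc, hc', dite_true] at h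
          exact congrArg Subtype.val (A.equivFin.injective (Fin.ext h))
    _ = D := by simp

/-- Counting walks of length `j` in a digraph of out-degree at most `h`. -/
theorem card_walks_le {V : Type*} [DecidableEq V] (W : Finset V) (H : V → V → Prop) {h : ℕ}
    [DecidableRel H] (hH : ∀ v, (W.filter (H v)).card ≤ h) (j : ℕ) :
    ((Fintype.piFinset fun _ : Fin (j + 1) => W).filter
      (fun w => ∀ i : Fin j, H (w i.castSucc) (w i.succ))).card ≤ W.card * h ^ j := by
  induction j with
  | zero =>
    refine (Finset.card_filter_le _ _).trans ?_
    simp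
  | succ j ih =>
    have hmaps : Set.MapsTo (fun w : Fin (j + 2) → V => (Fin.init w : Fin (j + 1) → V))
        ((Fintype.piFinset fun _ : Fin (j + 2) => W).filter
          (fun w => ∀ i : Fin (j + 1), H (w i.castSucc) (w i.succ)))
        ((Fintype.piFinset fun _ : Fin (j + 1) => W).filter
          (fun w => ∀ i : Fin j, H (w i.castSucc) (w i.succ))) := by
      intro w hw
      simp only [Finset.coe_filter, Fintype.mem_piFinset, Set.mem_ofPred_eq] at hw ⊢
      exact ⟨fun i => hw.1 _, fun i => hw.2 i.castSucc⟩
    have := Finset.card_le_mul_card_image_of_maps_to hmaps h (fun v hv => ?_)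
    · calc _ ≤ _ := this
        _ ≤ h * (W.card * h ^ j) := Nat.mul_le_mul_left _ ih
        _ = _ := by ring
    · refine le_trans (Finset.card_le_card_of_injOn
        (fun w : Fin (j + 2) → V => w (Fin.last (j + 1))) ?_ ?_)
        (hH (v (Fin.last j)))
      · intro w hw
        simp only [Finset.coe_filter, Finset.mem_filter, Fintype.mem_piFinset,
          Set.mem_ofPred_eq] at hw ⊢
        refine ⟨hw.1.1 _, ?_⟩
        rw [← hw.2]
        exact hw.1.2 (Fin.last j)
      · intro w hw w' hw' hww
        dsimp only at hww
        simp only [Finset.coe_filter, Finset.mem_filter, Set.mem_ofPred_eq] at hw hw'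
        rw [← Fin.snoc_init_self w, ← Fin.snoc_init_self w', hw.2, hw'.2, hww]

theorem crossing_arithmetic {I e q M m n h D K C₀ : ℕ} (hh : 0 < h)
    (hIe : I ≤ 2 * K * e) (hcr : e * (q ^ 2 * M) ≤ 128 * m * (q ^ 3 * M ^ 2) + 4 * C₀ * n ^ 2)
    (hMh : M * h ≤ 2 * D) (hDm : D * m ≤ 2 * I) (hID : I ≤ D * m) (hDM : D ≤ M * h)
    (hq : q * (2048 * K) ≤ h) (hhq : h ≤ 4096 * K * q) :
    I ^ 2 * h ≤ (16 * K * C₀ * (4096 * K) ^ 2) * m * n ^ 2 := by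
  have h1 : 256 * m * q * M ≤ e := by
    refine Nat.le_of_mul_le_mul_right ?_ hh
    calc 256 * m * q * M * h = 256 * m * q * (M * h) := by ring
      _ ≤ 256 * m * q * (2 * D) := by gcongr
      _ = 512 * q * (D * m) := by ring
      _ ≤ 512 * q * (2 * (2 * K * e)) := 
        Nat.mul_le_mul_left _ (hDm.trans (Nat.mul_le_mul_left 2 hIe))
      _ = e * (q * (2048 * K)) := by ring
      _ ≤ e * h := by gcongr
  have h2 : 2 * (128 * m * (q ^ 3 * M ^ 2)) ≤ e * (q ^ 2 * M) := by
    calc 2 * (128 * m * (q ^ 3 * M ^ 2)) = (256 * m * q * M) * (q ^ 2 * M) := by ring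
      _ ≤ _ := by gcongr
  have h3 : e * (q ^ 2 * M) ≤ 8 * C₀ * n ^ 2 := by nlinarith
  calc I ^ 2 * h = I * I * h := by ring
    _ ≤ (2 * K * e) * (M * h * m) * h := by gcongr; exact hID.trans (by gcongr)
    _ = 2 * K * e * M * m * h ^ 2 := by ring
    _ ≤ 2 * K * e * M * m * (4096 * K * q) ^ 2 := by gcongr
    _ = 2 * K * (4096 * K) ^ 2 * m * (e * (q ^ 2 * M)) := by ring
    _ ≤ 2 * K * (4096 * K) ^ 2 * m * (8 * C₀ * n ^ 2) := by gcongr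
    _ = _ := by ring

theorem power_arithmetic {I m n h B c K : ℕ} (hh : 0 < h) (h1 : I ^ 2 * h ≤ c * m * n ^ 2)
    (h2 : I ≤ B * m * (h + 1) ^ K) :
    I ^ (2 * K + 1) ≤ B * (2 * c) ^ K * m ^ (K + 1) * n ^ (2 * K) := by
  calc I ^ (2 * K + 1) = (I ^ 2) ^ K * I := by rw [pow_succ, pow_mul]
    _ ≤ (I ^ 2) ^ K * (B * m * (2 * h) ^ K) := by gcongr; exact h2.trans (by gcongr; omega)
    _ = B * m * 2 ^ K * (I ^ 2 * h) ^ K := by rw [mul_pow, mul_pow]; ring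
    _ ≤ B * m * 2 ^ K * (c * m * n ^ 2) ^ K := by gcongr
    _ = _ := by rw [mul_pow, mul_pow, mul_pow, ← pow_mul]; ring

/-- In a digraph of out-degree at most `D`, few out-neighbours are joined by many edges. -/
theorem card_heavy_le {V E : Type*} [DecidableEq V] (F : Finset E) (a b : E → V) {D : ℕ}
    (hD : ∀ u, (F.filter (fun e => a e = u)).card ≤ D) (h : ℕ) (W : Finset V) (u : V) :
    (W.filter (fun w => D < (F.filter (fun e => a e = u ∧ b e = w)).card * h)).card ≤ h := by
  set N := W.filter (fun w => D < (F.filter (fun e => a e = u ∧ b e = w)).card * h) with hN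
  have h1 : ∑ w ∈ N, (F.filter (fun e => a e = u ∧ b e = w)).card ≤ D := by
    refine le_trans ?_ (hD u)
    simp only [← Finset.filter_filter]
    rw [Finset.sum_card_fiberwise_eq_card_filter]
    exact Finset.card_filter_le _ _
  have h2 : N.card * (D + 1) ≤ D * h := by
    calc N.card * (D + 1) = ∑ _w ∈ N, (D + 1) := by rw [Finset.sum_const, smul_eq_mul]
      _ ≤ ∑ w ∈ N, (F.filter (fun e => a e = u ∧ b e = w)).card * h :=
        Finset.sum_le_sum fun w hw => (Finset.mem_filter.1 hw).2
      _ ≤ D * h := by rw [← Finset.sum_mul]; gcongr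
  nlinarith

/-- Curves cut into consecutive arcs by the points of `P` they pass through, such that any two
curves meet in at most `C₀` points and at most `C₀` curves pass through `k` given points. -/
structure ArcSystem (Γ : Type*) [Fintype Γ] (P : Finset (ℝ × ℝ)) (k C₀ : ℕ) where
  carrier : Γ → Set (ℝ × ℝ)
  d : Γ → ℕ
  p : Γ → ℕ → ℝ × ℝ
  arc : Γ → ℕ → Set (ℝ × ℝ)
  p_mem : ∀ c, ∀ i < d c, p c i ∈ P
  p_mem_carrier : ∀ c, ∀ i < d c, p c i ∈ carrier c
  p_injOn : ∀ c, Set.InjOn (p c) (Set.Iio (d c))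
  joined : ∀ c i, i + 1 < d c → JoinedIn (arc c i) (p c i) (p c (i + 1))
  arc_subset : ∀ c i, arc c i ⊆ carrier c
  arc_disjoint : ∀ c i j, i + 1 < j → j + 1 < d c → Disjoint (arc c i) (arc c j)
  few_meets : ∀ c c', c ≠ c' →
    (carrier c ∩ carrier c').Finite ∧ (carrier c ∩ carrier c').ncard ≤ C₀
  few_through : ∀ T ⊆ P, T.card = k → Set.ncard {c | ∀ x ∈ T, x ∈ carrier c} ≤ C₀

namespace ArcSystem

variable {Γ : Type*} [Fintype Γ] {P : Finset (ℝ × ℝ)} {k C₀ : ℕ}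

/-- The arcs of the system, as pairs of a curve and an index. -/
def edges (A : ArcSystem Γ P k C₀) : Finset ((_ : Γ) × ℕ) :=
  Finset.univ.sigma fun c => Finset.range (A.d c - 1)

theorem mem_edges (A : ArcSystem Γ P k C₀) {e : (_ : Γ) × ℕ} :
    e ∈ A.edges ↔ e.2 + 1 < A.d e.1 := by
  simp only [edges, Finset.mem_sigma, Finset.mem_univ, true_and, Finset.mem_range]
  omega

open Classical in
theorem card_arcs_through (A : ArcSystem Γ P k C₀) (c : Γ) (x : ℝ × ℝ) :
    (A.edges.filter (fun e => e.1 = c ∧ x ∈ A.arc e.1 e.2)).card ≤ 2 := by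
  by_contra! h
  set s := A.edges.filter (fun e => e.1 = c ∧ x ∈ A.arc e.1 e.2) with hs
  set t := s.image (fun e => e.2) with ht
  have hst : s.card = t.card := by
    rw [ht, Finset.card_image_of_injOn]
    rintro ⟨c1, i1⟩ h1 ⟨c2, i2⟩ h2 h12
    have e1 := (Finset.mem_filter.1 h1).2.1
    have e2 := (Finset.mem_filter.1 h2).2.1
    dsimp only at e1 e2 h12
    subst e1 e2 h12
    rfl
  have hmem : ∀ i ∈ t, i + 1 < A.d c ∧ x ∈ A.arc c i := by
    intro i hi
    obtain ⟨⟨c', i'⟩, he, rfl⟩ := Finset.mem_image.1 hi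
    obtain ⟨h1, h2, h3⟩ := Finset.mem_filter.1 he
    dsimp only at h2
    subst h2
    exact ⟨A.mem_edges.1 h1, h3⟩
  have hne : t.Nonempty := Finset.card_pos.1 (by omega)
  obtain ⟨j, hj, hj'⟩ : ∃ j ∈ t, t.min' hne + 1 < j := by
    by_contra! hcon
    have : t ⊆ Finset.Icc (t.min' hne) (t.min' hne + 1) := fun j hj =>
      Finset.mem_Icc.2 ⟨Finset.min'_le _ _ hj, hcon j hj⟩
    have := Finset.card_le_card this
    rw [Nat.card_Icc] at this
    omega
  exact Set.disjoint_left.1 (A.arc_disjoint c _ j hj' (hmem j hj).1)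
    (hmem _ (Finset.min'_mem _ _)).2 (hmem j hj).2

open Classical in
theorem card_crossing_pairs (A : ArcSystem Γ P k C₀) :
    ((A.edges ×ˢ A.edges).filter (fun z => z.1.1 ≠ z.2.1 ∧
      (A.arc z.1.1 z.1.2 ∩ A.arc z.2.1 z.2.2).Nonempty)).card ≤
      4 * C₀ * Fintype.card Γ ^ 2 := by
  let X : Γ × Γ → Finset (ℝ × ℝ) := fun c => if h : c.1 ≠ c.2 then
    (A.few_meets c.1 c.2 h).1.toFinset else ∅
  have hX : ∀ c, (X c).card ≤ C₀ := by
    intro c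
    by_cases h : c.1 ≠ c.2
    · simp only [X, h, dite_true, ne_eq, not_false_eq_true]
      rw [← Set.ncard_eq_toFinset_card _ (A.few_meets c.1 c.2 h).1]
      exact (A.few_meets c.1 c.2 h).2
    · simp only [X, h, dite_false, Finset.card_empty, Nat.zero_le]
  let N : Γ → ℝ × ℝ → Finset ((_ : Γ) × ℕ) := fun c x =>
    A.edges.filter (fun e => e.1 = c ∧ x ∈ A.arc e.1 e.2)
  have hsub : (A.edges ×ˢ A.edges).filter (fun z => z.1.1 ≠ z.2.1 ∧
      (A.arc z.1.1 z.1.2 ∩ A.arc z.2.1 z.2.2).Nonempty) ⊆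
      Finset.univ.biUnion fun c : Γ × Γ => (X c).biUnion fun x => N c.1 x ×ˢ N c.2 x := by
    intro z hz
    obtain ⟨hz, hne, x, hx1, hx2⟩ := Finset.mem_filter.1 hz
    obtain ⟨hz1, hz2⟩ := Finset.mem_product.1 hz
    refine Finset.mem_biUnion.2 ⟨(z.1.1, z.2.1), Finset.mem_univ _, Finset.mem_biUnion.2
      ⟨x, ?_, Finset.mem_product.2 ⟨?_, ?_⟩⟩⟩
    · simp only [X, hne, dite_true, ne_eq, not_false_eq_true, Set.Finite.mem_toFinset]
      exact ⟨A.arc_subset _ _ hx1, A.arc_subset _ _ hx2⟩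
    · exact Finset.mem_filter.2 ⟨hz1, rfl, hx1⟩
    · exact Finset.mem_filter.2 ⟨hz2, rfl, hx2⟩
  refine (Finset.card_le_card hsub).trans ?_
  refine (Finset.card_biUnion_le_card_mul _ _ (C₀ * 4) fun c _ => ?_).trans (le_of_eq ?_)
  · refine (Finset.card_biUnion_le_card_mul _ _ 4 fun x _ => ?_).trans
      (Nat.mul_le_mul_right _ (hX c))
    rw [Finset.card_product]
    exact Nat.mul_le_mul (A.card_arcs_through c.1 x) (A.card_arcs_through c.2 x)
  · rw [Finset.card_univ, Fintype.card_prod]; ring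

open Classical in
/-- Splitting the points of `P` into vertices of degree at most `D`. -/
theorem exists_vertex_splitting (A : ArcSystem Γ P k C₀) {D : ℕ} (hD : 0 < D)
    (hID : ∑ c, A.d c ≤ D * P.card) :
    ∃ (v : Γ → ℕ → (ℝ × ℝ) × ℕ) (W : Finset ((ℝ × ℝ) × ℕ)), (∀ c i, (v c i).1 = A.p c i) ∧
      (∀ c, ∀ i < A.d c, v c i ∈ W) ∧ W.card ≤ 2 * P.card ∧
      ∀ w, (A.edges.filter (fun e => v e.1 e.2 = w)).card ≤ D := by
  let N : ℝ × ℝ → Finset Γ := fun x => Finset.univ.filter (fun c => ∃ i < A.d c, A.p c i = x)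
  choose g hg hg' using fun x => exists_grouping (N x) hD
  refine ⟨fun c i => (A.p c i, g (A.p c i) c),
    P.biUnion fun x => {x} ×ˢ Finset.range ((N x).card / D + 1), fun c i => rfl,
    fun c i hi => ?_, ?_, fun w => ?_⟩
  · refine Finset.mem_biUnion.2 ⟨A.p c i, A.p_mem c i hi, Finset.mem_product.2
      ⟨Finset.mem_singleton_self _, Finset.mem_range.2 (hg _ _ ?_)⟩⟩
    exact Finset.mem_filter.2 ⟨Finset.mem_univ _, i, hi, rfl⟩
  · have hsum : ∑ x ∈ P, (N x).card = ∑ c, A.d c := by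
      simp only [N, Finset.card_filter]
      rw [Finset.sum_comm]
      refine Finset.sum_congr rfl fun c _ => ?_
      have himage := Finset.card_image_of_injOn (s := Finset.range (A.d c)) (f := A.p c)
        (by rw [Finset.coe_range]; exact A.p_injOn c)
      rw [Finset.card_range] at himage
      rw [← Finset.card_filter]
      refine Eq.trans (congrArg Finset.card ?_) himage
      ext x
      simp only [Finset.mem_filter, Finset.mem_image, Finset.mem_range]
      exact ⟨fun h => h.2, fun ⟨i, hi, h⟩ => ⟨h ▸ A.p_mem c i hi, i, hi, h⟩⟩
    refine Finset.card_biUnion_le.trans ?_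
    simp only [Finset.card_product, Finset.card_singleton, one_mul, Finset.card_range]
    rw [Finset.sum_add_distrib, Finset.sum_const, smul_eq_mul, mul_one]
    have : ∑ x ∈ P, (N x).card / D ≤ P.card := by
      refine Nat.le_of_mul_le_mul_left ?_ hD
      rw [Finset.mul_sum]
      calc _ ≤ ∑ x ∈ P, (N x).card := Finset.sum_le_sum fun x _ => Nat.mul_div_le _ _
        _ ≤ _ := hsum.trans_le hID
    omega
  · refine le_trans (Finset.card_le_card_of_injOn (fun e => e.1) ?_ ?_) (hg' w.1 w.2)
    · intro e he
      obtain ⟨hee, rfl⟩ := Finset.mem_filter.1 he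
      have hi := (Nat.lt_succ_self _).trans (A.mem_edges.1 hee)
      exact Finset.mem_filter.2 ⟨Finset.mem_filter.2 ⟨Finset.mem_univ _, e.2, hi, rfl⟩, rfl⟩
    · rintro ⟨c, i⟩ he ⟨c', i'⟩ he' h
      dsimp only at h
      subst h
      obtain ⟨h1, rfl⟩ := Finset.mem_filter.1 he
      obtain ⟨h2, h'⟩ := Finset.mem_filter.1 he'
      rw [A.mem_edges] at h1 h2
      dsimp only at h1 h2 h'
      have := A.p_injOn c (show i' < A.d c by omega) (show i < A.d c by omega)
        (congrArg Prod.fst h')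
      rw [this]

open Classical in
/-- Few stretches of `K + 1` consecutive points are walks of a digraph of out-degree at
most `h`. -/
theorem card_walk_windows_le {K : ℕ} (A : ArcSystem Γ P (K + 1) C₀)
    {v : Γ → ℕ → (ℝ × ℝ) × ℕ} {W : Finset ((ℝ × ℝ) × ℕ)} (hv : ∀ c i, (v c i).1 = A.p c i)
    (hW : ∀ c, ∀ i < A.d c, v c i ∈ W) {H : (ℝ × ℝ) × ℕ → (ℝ × ℝ) × ℕ → Prop} {h : ℕ}
    (hH : ∀ u, (W.filter (H u)).card ≤ h) :
    ((Finset.univ.sigma fun c => Finset.range (A.d c - K)).filter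
      (fun e : (_ : Γ) × ℕ => ∀ j < K, H (v e.1 (e.2 + j)) (v e.1 (e.2 + j + 1)))).card ≤
      C₀ * (W.card * h ^ K) := by
  refine le_trans ?_ (Nat.mul_le_mul_left C₀ (card_walks_le W H hH K))
  refine Finset.card_le_mul_card_image_of_maps_to
    (f := fun e (j : Fin (K + 1)) => v e.1 (e.2 + j)) ?_ _ ?_
  · intro e he
    simp only [Finset.mem_filter, Finset.mem_sigma, Finset.mem_univ, true_and, Finset.mem_range,
      Fintype.mem_piFinset] at he ⊢
    exact ⟨fun j => hW _ _ (by omega), fun j => he.2 j j.2⟩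
  · intro w _
    set F := ((Finset.univ.sigma fun c => Finset.range (A.d c - K)).filter
      (fun e : (_ : Γ) × ℕ => ∀ j < K, H (v e.1 (e.2 + j)) (v e.1 (e.2 + j + 1)))).filter
      (fun e => (fun j : Fin (K + 1) => v e.1 (e.2 + j)) = w) with hF
    have hmem : ∀ e ∈ F, e.2 + K < A.d e.1 ∧ ∀ j : Fin (K + 1), A.p e.1 (e.2 + j) = (w j).1 := by
      intro e he
      obtain ⟨he, hew⟩ := Finset.mem_filter.1 he
      have := (Finset.mem_filter.1 he).1
      simp only [Finset.mem_sigma, Finset.mem_univ, true_and, Finset.mem_range] at this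
      refine ⟨by omega, fun j => ?_⟩
      rw [← hew, hv]
    rcases F.eq_empty_or_nonempty with hemp | ⟨e₀, he₀⟩
    · rw [hemp]; simp
    · obtain ⟨h0, h0'⟩ := hmem e₀ he₀
      set T : Finset (ℝ × ℝ) := Finset.univ.image (fun j => (w j).1) with hT
      have hTP : T ⊆ P := by
        intro x hx
        obtain ⟨j, -, rfl⟩ := Finset.mem_image.1 hx
        rw [← h0']
        exact A.p_mem _ _ (by omega)
      have hTc : T.card = K + 1 := by
        rw [hT, Finset.card_image_of_injective, Finset.card_univ, Fintype.card_fin]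
        intro i j hij
        simp only [← h0'] at hij
        have := A.p_injOn e₀.1 (show e₀.2 + i < A.d e₀.1 by omega)
          (show e₀.2 + j < A.d e₀.1 by omega) hij
        exact Fin.ext (by omega)
      refine le_trans ?_ (A.few_through T hTP hTc)
      rw [← Set.ncard_coe_finset]
      refine Set.ncard_le_ncard_of_injOn (fun e => e.1) ?_ ?_ (Set.toFinite _)
      · intro e he x hx
        obtain ⟨j, -, rfl⟩ := Finset.mem_image.1 hx
        obtain ⟨h1, h2⟩ := hmem e he
        rw [← h2]
        exact A.p_mem_carrier _ _ (by omega)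
      · rintro ⟨c, i⟩ he ⟨c', i'⟩ he' hcc
        dsimp only at hcc
        subst hcc
        obtain ⟨h1, h2⟩ := hmem _ he
        obtain ⟨h3, h4⟩ := hmem _ he'
        dsimp only at h1 h2 h3 h4
        have := A.p_injOn c (show i < A.d c by omega) (show i' < A.d c by omega)
          ((h2 0).trans (h4 0).symm)
        rw [this]

open Classical in
theorem crossing_bound (A : ArcSystem Γ P k C₀) {v : Γ → ℕ → (ℝ × ℝ) × ℕ}
    {W : Finset ((ℝ × ℝ) × ℕ)} (hv : ∀ c i, (v c i).1 = A.p c i)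
    (hW : ∀ c, ∀ i < A.d c, v c i ∈ W) {L : Finset ((_ : Γ) × ℕ)} (hL : L ⊆ A.edges) {M : ℕ}
    (hM : 0 < M)
    (hmult : ∀ u w, (L.filter (fun e => v e.1 e.2 = u ∧ v e.1 (e.2 + 1) = w)).card ≤ M)
    {q : ℕ} (hq : 0 < q) :
    L.card * (q ^ 2 * M) ≤ 64 * W.card * (q ^ 3 * M ^ 2) + 4 * C₀ * Fintype.card Γ ^ 2 := by
  have hd : ∀ e ∈ L, e.2 + 1 < A.d e.1 := fun e he => A.mem_edges.1 (hL he)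
  let a : L → W := fun e => ⟨v e.1.1 e.1.2, hW _ _ ((Nat.lt_succ_self _).trans (hd e e.2))⟩
  let b : L → W := fun e => ⟨v e.1.1 (e.1.2 + 1), hW _ _ (hd e e.2)⟩
  have hab : ∀ e, a e ≠ b e := fun e he => by
    have h1 := congrArg (fun w : W => w.1.1) he
    simp only [a, b, hv] at h1
    have h2 := A.p_injOn e.1.1 (show e.1.2 < A.d e.1.1 from (Nat.lt_succ_self _).trans (hd e e.2))
      (show e.1.2 + 1 < A.d e.1.1 from hd e e.2) h1
    omega
  have hK : ∀ e : L, JoinedIn (A.arc e.1.1 e.1.2) (a e).1.1 (b e).1.1 := fun e => by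
    simp only [a, b, hv]; exact A.joined _ _ (hd e e.2)
  have hcr := crossing_inequality hab hM (fun u w => ?_)
    (X := fun e f : L => (A.arc e.1.1 e.1.2 ∩ A.arc f.1.1 f.1.2).Nonempty)
    (fun F W' hF hinj hlt => exists_crossing_of_dense hab (pos := fun w : W => w.1.1) hK hF hinj
      hlt) hq
  · rw [Fintype.card_coe, Fintype.card_coe] at hcr
    refine hcr.trans (Nat.add_le_add_left (le_trans ?_ A.card_crossing_pairs) _)
    refine Finset.card_le_card_of_injOn (fun z => (z.1.1, z.2.1)) ?_ ?_
    · rintro ⟨⟨⟨c, i⟩, he⟩, ⟨⟨c', i'⟩, he'⟩⟩ hz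
      obtain ⟨⟨h1, h2, h3, h4⟩, hX⟩ := (Finset.mem_filter.1 hz).2
      refine Finset.mem_filter.2 ⟨Finset.mem_product.2 ⟨hL he, hL he'⟩, ?_, hX⟩
      intro hcc
      dsimp only at hcc hX
      subst hcc
      have hi := hd _ he
      have hi' := hd _ he'
      dsimp only at hi hi'
      rcases lt_trichotomy i i' with h | rfl | h
      · rcases (Nat.succ_le_of_lt h).lt_or_eq with h | h
        · exact Set.not_nonempty_iff_eq_empty.2
            (Set.disjoint_iff_inter_eq_empty.1 (A.arc_disjoint c i i' h hi')) hX
        · refine h3 (Subtype.ext ?_)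
          subst h
          rfl
      · exact h1 rfl
      · rcases (Nat.succ_le_of_lt h).lt_or_eq with h | h
        · rw [Set.inter_comm] at hX
          exact Set.not_nonempty_iff_eq_empty.2
            (Set.disjoint_iff_inter_eq_empty.1 (A.arc_disjoint c i' i h hi)) hX
        · refine h2 (Subtype.ext ?_)
          subst h
          rfl
    · intro z _ z' _ h
      have h := Prod.mk.inj h
      exact Prod.ext (Subtype.ext h.1) (Subtype.ext h.2)
  · refine le_trans (Finset.card_le_card_of_injOn (fun e => e.1) ?_
      (Subtype.val_injective.injOn)) (hmult u w)
    intro e he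
    simp only [Finset.coe_filter, Finset.mem_univ, true_and, Set.mem_ofPred_eq] at he
    obtain ⟨h1, h2⟩ := he
    exact Finset.mem_filter.2 ⟨e.2, congrArg Subtype.val h1, congrArg Subtype.val h2⟩

open Classical in
theorem sum_d_le {K : ℕ} (A : ArcSystem Γ P (K + 1) C₀) (hK : 1 ≤ K) (hC₀ : 1 ≤ C₀) :
    ∑ c, A.d c ≤ 4 * K * Fintype.card Γ ∨ ∑ c, A.d c ≤ 8 * C₀ * (2048 * K) ^ K * P.card ∨
    (∑ c, A.d c) ^ (2 * K + 1) ≤ 8 * C₀ * (2 * (16 * K * C₀ * (4096 * K) ^ 2)) ^ K *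
      P.card ^ (K + 1) * Fintype.card Γ ^ (2 * K) := by
  set I := ∑ c, A.d c with hI
  set m := P.card with hm
  set n := Fintype.card Γ with hn
  by_contra! hcon
  obtain ⟨hIn, hIm, hIp⟩ := hcon
  refine absurd hIp (not_lt.2 ?_)
  have hI0 : 0 < I := by omega
  have hm0 : 0 < m := by
    obtain ⟨c, -, hc⟩ := Finset.exists_ne_zero_of_sum_ne_zero hI0.ne'
    exact Finset.card_pos.2 ⟨_, A.p_mem c 0 (Nat.pos_of_ne_zero hc)⟩
  set B := 8 * C₀ with hB
  have hBm : 0 < B * m := by positivity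
  obtain ⟨h, hhI, hhI'⟩ : ∃ h, B * m * h ^ K ≤ I ∧ I < B * m * (h + 1) ^ K := by
    have hex : ∃ h, I < B * m * (h + 1) ^ K := ⟨I, by
      calc I < I + 1 := Nat.lt_succ_self _
        _ ≤ (I + 1) ^ K := Nat.le_self_pow (by omega) _
        _ ≤ _ := Nat.le_mul_of_pos_left _ hBm⟩
    refine ⟨Nat.find hex, ?_, Nat.find_spec hex⟩
    rcases hf : Nat.find hex with _ | j
    · rw [zero_pow (by omega)]; omega
    · exact not_lt.1 (Nat.find_min hex (m := j) (by omega))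
  have hh : 2048 * K ≤ h := by
    by_contra! hlt
    have : B * m * (h + 1) ^ K ≤ B * m * (2048 * K) ^ K := by gcongr; omega
    have e : B * m * (2048 * K) ^ K = B * (2048 * K) ^ K * m := by ring
    omega
  have hh0 : 0 < h := by omega
  set D := I / m + 1 with hD
  have hID : I ≤ D * m := by
    rw [mul_comm]; exact (Nat.lt_mul_div_succ I hm0).le
  have hmI : m ≤ I := by
    calc m ≤ B * m := Nat.le_mul_of_pos_left _ (by omega)
      _ ≤ B * m * h ^ K := Nat.le_mul_of_pos_right _ (by positivity)
      _ ≤ I := hhI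
  have hDm : D * m ≤ 2 * I := by
    have := Nat.div_mul_le_self I m
    rw [hD, add_mul, one_mul]; omega
  have hhD : h ≤ D := by
    have : h ≤ I / m := by
      rw [Nat.le_div_iff_mul_le hm0]
      calc h * m ≤ h ^ K * m := by gcongr; exact Nat.le_self_pow (by omega) _
        _ ≤ B * (h ^ K * m) := Nat.le_mul_of_pos_left _ (by omega)
        _ = B * m * h ^ K := by ring
        _ ≤ I := hhI
    omega
  obtain ⟨v, W, hv, hW, hWcard, hout⟩ := A.exists_vertex_splitting (D := D) (by omega) hID
  set mult : (ℝ × ℝ) × ℕ → (ℝ × ℝ) × ℕ → ℕ := fun u w =>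
    (A.edges.filter (fun e => v e.1 e.2 = u ∧ v e.1 (e.2 + 1) = w)).card with hmultdef
  set H : (ℝ × ℝ) × ℕ → (ℝ × ℝ) × ℕ → Prop := fun u w => D < mult u w * h with hH
  set L := A.edges.filter (fun e => ¬ H (v e.1 e.2) (v e.1 (e.2 + 1))) with hLdef
  set win := Finset.univ.sigma fun c => Finset.range (A.d c - K) with hwin
  have hheavy : (win.filter (fun e : (_ : Γ) × ℕ =>
      ∀ j < K, H (v e.1 (e.2 + j)) (v e.1 (e.2 + j + 1)))).card ≤ C₀ * (W.card * h ^ K) := by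
    convert A.card_walk_windows_le hv hW (H := H) (h := h) fun u => by
      convert card_heavy_le A.edges (fun e => v e.1 e.2) (fun e => v e.1 (e.2 + 1)) hout h W u
  have hwincard : I ≤ win.card + K * n := by
    rw [hwin, Finset.card_sigma]
    simp only [Finset.card_range]
    calc I ≤ ∑ c, ((A.d c - K) + K) := Finset.sum_le_sum fun c _ => by omega
      _ = _ := by rw [Finset.sum_add_distrib, Finset.sum_const, Finset.card_univ, smul_eq_mul,
        mul_comm K]
  have hlight : (win.filter (fun e : (_ : Γ) × ℕ =>
      ¬ ∀ j < K, H (v e.1 (e.2 + j)) (v e.1 (e.2 + j + 1)))).card ≤ L.card * K := by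
    have hsub : win.filter (fun e : (_ : Γ) × ℕ =>
        ¬ ∀ j < K, H (v e.1 (e.2 + j)) (v e.1 (e.2 + j + 1))) ⊆
        (L ×ˢ Finset.range K).image (fun z => ⟨z.1.1, z.1.2 - z.2⟩) := by
      rintro ⟨c, i⟩ he
      obtain ⟨h1, h2⟩ := Finset.mem_filter.1 he
      simp only [hwin, Finset.mem_sigma, Finset.mem_univ, true_and, Finset.mem_range] at h1
      push Not at h2
      obtain ⟨j, hj, hjH⟩ := h2
      refine Finset.mem_image.2 ⟨(⟨c, i + j⟩, j), Finset.mem_product.2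
        ⟨Finset.mem_filter.2 ⟨A.mem_edges.2 ?_, hjH⟩, Finset.mem_range.2 hj⟩, ?_⟩
      · dsimp only; omega
      · simp
    refine (Finset.card_le_card hsub).trans (Finset.card_image_le.trans ?_)
    rw [Finset.card_product, Finset.card_range]
  have hsplit := Finset.card_filter_add_card_filter_not (s := win) (fun e : (_ : Γ) × ℕ =>
      ∀ j < K, H (v e.1 (e.2 + j)) (v e.1 (e.2 + j + 1)))
  have hheavy' : 4 * (C₀ * (W.card * h ^ K)) ≤ I := by
    calc 4 * (C₀ * (W.card * h ^ K)) ≤ 4 * (C₀ * (2 * m * h ^ K)) := by gcongr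
      _ = B * m * h ^ K := by rw [hB]; ring
      _ ≤ I := hhI
  have hIe : I ≤ 2 * K * L.card := by
    have e1 : 4 * K * n = 4 * (K * n) := by ring
    have e2 : 2 * K * L.card = 2 * (L.card * K) := by ring
    omega
  set M := D / h + 1 with hM
  have hMmult : ∀ u w, (L.filter (fun e => v e.1 e.2 = u ∧ v e.1 (e.2 + 1) = w)).card ≤ M := by
    intro u w
    rcases (L.filter (fun e => v e.1 e.2 = u ∧ v e.1 (e.2 + 1) = w)).eq_empty_or_nonempty with
      hemp | ⟨e, he⟩
    · rw [hemp]; simp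
    · obtain ⟨heL, rfl, rfl⟩ := Finset.mem_filter.1 he
      have h1 := (Finset.mem_filter.1 heL).2
      rw [hH, not_lt, ← Nat.le_div_iff_mul_le hh0] at h1
      refine le_trans (Finset.card_le_card ?_) (h1.trans (Nat.le_succ _))
      exact Finset.filter_subset_filter _ (Finset.filter_subset _ _)
  set q := h / (2048 * K) with hq
  have hK0 : 0 < 2048 * K := by omega
  have hq0 : 0 < q := Nat.div_pos hh hK0
  have hcr := A.crossing_bound hv hW (Finset.filter_subset _ _) (Nat.succ_pos _) hMmult hq0
  have hcr' : L.card * (q ^ 2 * M) ≤ 128 * m * (q ^ 3 * M ^ 2) + 4 * C₀ * n ^ 2 := by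
    refine hcr.trans (Nat.add_le_add_right (Nat.mul_le_mul_right _ ?_) _)
    omega
  have hfin := crossing_arithmetic hh0 hIe hcr' (D := D)
    (by
      have := Nat.div_mul_le_self D h
      rw [hM, add_mul, one_mul]; omega)
    hDm hID (by rw [hM, mul_comm]; exact (Nat.lt_mul_div_succ D hh0).le)
    (Nat.div_mul_le_self _ _) (by
      have := Nat.lt_mul_div_succ h hK0
      rw [← hq] at this
      calc h ≤ 2048 * K * (q + 1) := this.le
        _ ≤ 2048 * K * (2 * q) := by gcongr; omega
        _ = _ := by ring)
  exact power_arithmetic hh0 hfin hhI'.le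

end ArcSystem

open Classical in
/-- A family of simple curves with `k` degrees of freedom gives an arc system. -/
theorem exists_arcSystem {k C₀ : ℕ} {P : Finset (ℝ × ℝ)} {S : Finset (Set (ℝ × ℝ))}
    (hS : ∀ s ∈ S, ∃ f : ℝ → ℝ × ℝ, ContinuousOn f (Set.Icc 0 1) ∧
      Set.InjOn f (Set.Icc 0 1) ∧ s = f '' Set.Icc 0 1)
    (hmeet : ∀ s ∈ S, ∀ s' ∈ S, s ≠ s' → (s ∩ s').Finite ∧ (s ∩ s').ncard ≤ C₀)
    (hthrough : ∀ T : Finset (ℝ × ℝ), ↑T ⊆ (P : Set (ℝ × ℝ)) → T.card = k →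
      Set.ncard {s | s ∈ S ∧ ∀ p ∈ T, p ∈ s} ≤ C₀) :
    ∃ A : ArcSystem S P k C₀, ∀ s, A.d s = (P.filter (fun p => p ∈ s.1)).card := by
  have hex : ∀ s : S, ∃ (p : ℕ → ℝ × ℝ) (K : ℕ → Set (ℝ × ℝ)),
      (∀ i < (P.filter (fun x => x ∈ s.1)).card, p i ∈ P.filter (fun x => x ∈ s.1)) ∧
      Set.InjOn p (Set.Iio (P.filter (fun x => x ∈ s.1)).card) ∧
      (∀ i, i + 1 < (P.filter (fun x => x ∈ s.1)).card → JoinedIn (K i) (p i) (p (i + 1))) ∧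
      (∀ i, K i ⊆ s.1) ∧
      ∀ i j, i + 1 < j → j + 1 < (P.filter (fun x => x ∈ s.1)).card →
        Disjoint (K i) (K j) := by
    intro s
    obtain ⟨f, hf, hinj, hsf⟩ := hS s s.2
    have := exists_consecutive_arcs hf hinj (P.filter (fun x => x ∈ s.1)) (fun x hx => by
      rw [← hsf]; exact (Finset.mem_filter.1 hx).2)
    rwa [← hsf] at this
  choose p K h1 h2 h3 h4 h5 using hex
  refine ⟨{ carrier := fun s => s.1
            d := fun s => (P.filter (fun x => x ∈ s.1)).card
            p := p
            arc := K
            p_mem := fun c i hi => (Finset.mem_filter.1 (h1 c i hi)).1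
            p_mem_carrier := fun c i hi => (Finset.mem_filter.1 (h1 c i hi)).2
            p_injOn := h2
            joined := h3
            arc_subset := h4
            arc_disjoint := h5
            few_meets := fun c c' hcc => hmeet c c.2 c' c'.2 fun h => hcc (Subtype.ext h)
            few_through := fun T hT hTk => ?_ }, fun s => rfl⟩
  refine le_trans ?_ (hthrough T (by exact_mod_cast hT) hTk)
  exact Set.ncard_le_ncard_of_injOn Subtype.val (fun c hc => ⟨c.2, hc⟩)
    Subtype.val_injective.injOn (S.finite_toSet.subset fun s hs => hs.1)

open Classical in
theorem ncard_incidences {α : Type*} (P : Finset α) (S : Finset (Set α)) :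
    Set.ncard {ps : α × Set α | ps.1 ∈ P ∧ ps.2 ∈ S ∧ ps.1 ∈ ps.2} =
      ∑ s : S, (P.filter (fun p => p ∈ s.1)).card := by
  have h : {ps : α × Set α | ps.1 ∈ P ∧ ps.2 ∈ S ∧ ps.1 ∈ ps.2} =
      ((P ×ˢ S).filter (fun ps => ps.1 ∈ ps.2) : Finset _) := by
    ext ps
    simp [and_assoc]
  rw [h, Set.ncard_coe_finset, Finset.card_filter, Finset.sum_product_right,
    ← Finset.sum_coe_sort S]
  simp only [Finset.card_filter]

theorem le_of_pow_le_mul_rpow {k I m n c : ℕ} (hk : 2 ≤ k) (hc : 1 ≤ c)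
    (h : I ^ (2 * k - 1) ≤ c * m ^ k * n ^ (2 * k - 2)) :
    (I : ℝ) ≤ c * ((m : ℝ) ^ ((k : ℝ) / (2 * (k : ℝ) - 1)) *
      (n : ℝ) ^ ((2 * (k : ℝ) - 2) / (2 * (k : ℝ) - 1))) := by
  have hN : ((2 * k - 1 : ℕ) : ℝ) = 2 * (k : ℝ) - 1 := by
    rw [Nat.cast_sub (by omega)]; push_cast; ring
  have hN' : ((2 * k - 2 : ℕ) : ℝ) = 2 * (k : ℝ) - 2 := by
    rw [Nat.cast_sub (by omega)]; push_cast; ring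
  have hpow : ∀ a b : ℕ, ((a : ℝ) ^ ((b : ℝ) / (2 * (k : ℝ) - 1))) ^ (2 * k - 1) = (a : ℝ) ^ b := by
    intro a b
    have hne : (2 * (k : ℝ) - 1) ≠ 0 := by rw [← hN]; exact_mod_cast (by omega)
    rw [← Real.rpow_natCast, ← Real.rpow_mul (Nat.cast_nonneg a), hN, div_mul_cancel₀ _ hne,
      Real.rpow_natCast]
  rw [← hN', ← pow_le_pow_iff_left₀ (n := 2 * k - 1) (by positivity) (by positivity) (by omega),
    mul_pow, mul_pow, hpow, hpow, ← mul_assoc]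
  calc (I : ℝ) ^ (2 * k - 1) ≤ c * (m : ℝ) ^ k * (n : ℝ) ^ (2 * k - 2) := by exact_mod_cast h
    _ ≤ _ := by
      gcongr
      exact le_self_pow₀ (by exact_mod_cast hc) (by omega)

/-- The Pach–Sharir theorem: `m` points and `n` simple curves in the plane with
`k` degrees of freedom (any two curves meet in at most `C₀` points, and at most
`C₀` curves pass through any `k` given points) determine at most
`O(m^(k/(2k-1)) n^((2k-2)/(2k-1)) + m + n)` incidences, with the implicit
constant depending only on `C₀` and `k`. -/
theorem stmt_3 (k C₀ : ℕ) (hk : 2 ≤ k) (hC₀ : 1 ≤ C₀) :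
    ∃ C : ℝ, 0 < C ∧ ∀ (m n : ℕ) (P : Finset (ℝ × ℝ)) (S : Finset (Set (ℝ × ℝ))),
      P.card = m → S.card = n →
      -- each member of `S` is a simple curve
      (∀ s ∈ S, ∃ f : ℝ → ℝ × ℝ, ContinuousOn f (Set.Icc 0 1) ∧
        Set.InjOn f (Set.Icc 0 1) ∧ s = f '' Set.Icc 0 1) →
      -- any two curves meet in at most `C₀` points
      (∀ s ∈ S, ∀ s' ∈ S, s ≠ s' → (s ∩ s').Finite ∧ (s ∩ s').ncard ≤ C₀) →
      -- at most `C₀` curves contain any given `k` points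
      (∀ T : Finset (ℝ × ℝ), ↑T ⊆ (P : Set (ℝ × ℝ)) → T.card = k →
        Set.ncard {s | s ∈ S ∧ ∀ p ∈ T, p ∈ s} ≤ C₀) →
      (Set.ncard {ps : (ℝ × ℝ) × Set (ℝ × ℝ) | ps.1 ∈ P ∧ ps.2 ∈ S ∧ ps.1 ∈ ps.2} : ℝ) ≤
        C * ((m : ℝ) ^ ((k : ℝ) / (2 * (k : ℝ) - 1)) *
              (n : ℝ) ^ ((2 * (k : ℝ) - 2) / (2 * (k : ℝ) - 1)) + (m : ℝ) + (n : ℝ)) := by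

  obtain ⟨K, rfl⟩ : ∃ K, k = K + 1 := ⟨k - 1, by omega⟩
  have hK : 1 ≤ K := by omega
  obtain ⟨c, hc, hbound⟩ : ∃ c : ℕ, 1 ≤ c ∧ ∀ {P : Finset (ℝ × ℝ)} {S : Finset (Set (ℝ × ℝ))}
      (A : ArcSystem S P (K + 1) C₀), ∑ s, A.d s ≤ c * S.card ∨ ∑ s, A.d s ≤ c * P.card ∨
      (∑ s, A.d s) ^ (2 * (K + 1) - 1) ≤
        c * P.card ^ (K + 1) * S.card ^ (2 * (K + 1) - 2) := by
    refine ⟨4 * K + 8 * C₀ * (2048 * K) ^ K +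
      8 * C₀ * (2 * (16 * K * C₀ * (4096 * K) ^ 2)) ^ K, by omega, fun {P S} A => ?_⟩
    rw [show 2 * (K + 1) - 1 = 2 * K + 1 by omega, show 2 * (K + 1) - 2 = 2 * K by omega]
    have h := A.sum_d_le hK hC₀
    rw [Fintype.card_coe] at h
    rcases h with h | h | h
    · exact Or.inl (h.trans (Nat.mul_le_mul_right _ (by omega)))
    · exact Or.inr (Or.inl (h.trans (Nat.mul_le_mul_right _ (by omega))))
    · exact Or.inr (Or.inr (h.trans (Nat.mul_le_mul_right _ (Nat.mul_le_mul_right _ (by omega)))))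
  refine ⟨c, by exact_mod_cast hc, ?_⟩
  rintro m n P S rfl rfl hS hmeet hthrough
  obtain ⟨A, hA⟩ := exists_arcSystem hS hmeet hthrough
  rw [ncard_incidences, ← Finset.sum_congr rfl fun s _ => hA s, mul_add, mul_add]
  have h1 : (0 : ℝ) ≤ c * ((P.card : ℝ) ^ (((K + 1 : ℕ) : ℝ) / (2 * ((K + 1 : ℕ) : ℝ) - 1)) *
      (S.card : ℝ) ^ ((2 * ((K + 1 : ℕ) : ℝ) - 2) / (2 * ((K + 1 : ℕ) : ℝ) - 1))) := by
    positivity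
  have h2 : (0 : ℝ) ≤ c * (P.card : ℝ) := by positivity
  have h3 : (0 : ℝ) ≤ c * (S.card : ℝ) := by positivity
  rcases hbound A with h | h | h
  · have h : ((∑ s, A.d s : ℕ) : ℝ) ≤ c * (S.card : ℝ) := by exact_mod_cast h
    linarith
  · have h : ((∑ s, A.d s : ℕ) : ℝ) ≤ c * (P.card : ℝ) := by exact_mod_cast h
    linarith
  · have h := le_of_pow_le_mul_rpow hk hc h
    linarith
end

section
/- Let (P) ⊆ ℝ[x₁,…,x_d] be a principal prime ideal, P irreducible. Then (P) is real if and only if P changes sign somewhere on ℝ^d, i.e., there exist points x, y ∈ ℝ^d with P(x) > 0 and P(y) < 0. -/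
/-- An ideal `I ⊆ ℝ[x₁,…,x_d]` is *real* if whenever a finite sum of squares
`a₁² + ⋯ + a_ℓ²` belongs to `I`, each `a_j` belongs to `I`. -/
def IsRealIdeal {d : ℕ} (I : Ideal (MvPolynomial (Fin d) ℝ)) : Prop :=
  ∀ (ℓ : ℕ) (a : Fin ℓ → MvPolynomial (Fin d) ℝ),
    (∑ j, a j ^ 2) ∈ I → ∀ j, a j ∈ I

section

set_option linter.unusedSectionVars false

open Polynomial SignType

/-- The intermediate value property for polynomials over an ordered field. -/
def PolynomialIVT (S : Type*) [Field S] [LinearOrder S] : Prop :=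
  ∀ (p : S[X]) (a b : S), a < b → p.eval a * p.eval b < 0 → ∃ c, a < c ∧ c < b ∧ p.eval c = 0

namespace PolynomialIVT

variable {S : Type*} [Field S] [LinearOrder S] [IsStrictOrderedRing S]

theorem mul_pos_of_ne_zero (hS : PolynomialIVT S) {p : S[X]} {a b : S} (hab : a ≤ b)
    (h : ∀ z, a ≤ z → z ≤ b → p.eval z ≠ 0) : 0 < p.eval a * p.eval b := by
  rcases hab.eq_or_lt with rfl | hlt
  · exact mul_self_pos.2 (h a le_rfl le_rfl)
  · by_contra hn
    have hne : p.eval a * p.eval b ≠ 0 := mul_ne_zero (h a le_rfl hab) (h b hab le_rfl)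
    obtain ⟨c, hac, hcb, hc⟩ := hS p a b hlt (lt_of_le_of_ne (not_lt.1 hn) hne)
    exact h c hac.le hcb.le hc

theorem sign_eq_of_mul_pos {a b : S} (h : 0 < a * b) : sign a = sign b := by
  rcases pos_and_pos_or_neg_and_neg_of_mul_pos h with ⟨h1, h2⟩ | ⟨h1, h2⟩
  · rw [sign_pos h1, sign_pos h2]
  · rw [sign_neg h1, sign_neg h2]

theorem sign_eq_of_ne_zero (hS : PolynomialIVT S) {p : S[X]} {a b : S}
    (h : ∀ z, min a b ≤ z → z ≤ max a b → p.eval z ≠ 0) : sign (p.eval a) = sign (p.eval b) := by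
  rcases le_total a b with hab | hab
  · simp only [min_eq_left hab, max_eq_right hab] at h
    exact sign_eq_of_mul_pos (hS.mul_pos_of_ne_zero hab h)
  · simp only [min_eq_right hab, max_eq_left hab] at h
    exact (sign_eq_of_mul_pos (hS.mul_pos_of_ne_zero hab h)).symm

/-- Rolle's theorem between two consecutive roots. -/
theorem exists_derivative_root_of_consecutive (hS : PolynomialIVT S) {p : S[X]} (hp : p ≠ 0)
    {a b : S} (hab : a < b) (ha : p.eval a = 0) (hb : p.eval b = 0)
    (h : ∀ z, a < z → z < b → p.eval z ≠ 0) :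
    ∃ c, a < c ∧ c < b ∧ p.derivative.eval c = 0 := by
  obtain ⟨q, hpq, hq⟩ := exists_eq_pow_rootMultiplicity_mul_and_not_dvd p hp a
  have hq0 : q ≠ 0 := by rintro rfl; simp at hq
  obtain ⟨r, hqr, hr⟩ := exists_eq_pow_rootMultiplicity_mul_and_not_dvd q hq0 b
  have hqb : q.eval b = 0 := by
    have : p.eval b = (b - a) ^ (p.rootMultiplicity a) * q.eval b := by
      conv_lhs => rw [hpq]
      simp
    rw [hb] at this
    exact (mul_eq_zero.1 this.symm).resolve_left (pow_ne_zero _ (sub_ne_zero.2 hab.ne'))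
  obtain ⟨m, hm⟩ : ∃ m, p.rootMultiplicity a = m + 1 :=
    Nat.exists_eq_succ_of_ne_zero ((rootMultiplicity_pos hp).2 ha).ne'
  obtain ⟨k, hk⟩ : ∃ k, q.rootMultiplicity b = k + 1 :=
    Nat.exists_eq_succ_of_ne_zero ((rootMultiplicity_pos hq0).2 hqb).ne'
  rw [hm] at hpq
  rw [hk] at hqr
  have hrz : ∀ z, a ≤ z → z ≤ b → r.eval z ≠ 0 := by
    intro z hz1 hz2 hz
    rcases hz1.eq_or_lt with rfl | hz1
    · refine hq (dvd_iff_isRoot.2 ?_)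
      rw [hqr, IsRoot.def, eval_mul, hz, mul_zero]
    rcases hz2.eq_or_lt with rfl | hz2
    · exact hr (dvd_iff_isRoot.2 hz)
    · refine h z hz1 hz2 ?_
      rw [hpq, hqr]
      simp [hz]
  set t : S[X] := (m + 1 : S[X]) * (X - C b) * r + (k + 1 : S[X]) * (X - C a) * r
    + (X - C a) * (X - C b) * derivative r with ht
  have hpt : derivative p = (X - C a) ^ m * (X - C b) ^ k * t := by
    rw [hpq, hqr, ht]
    simp only [derivative_mul, derivative_X_sub_C_pow]
    simp
    ring
  have hta : t.eval a * t.eval b < 0 := by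
    have h1 : 0 < r.eval a * r.eval b := hS.mul_pos_of_ne_zero hab.le hrz
    have h2 : t.eval a * t.eval b
        = -((m + 1 : S) * (k + 1) * (b - a) ^ 2 * (r.eval a * r.eval b)) := by
      simp [ht]
      ring
    have h3 : 0 < b - a := sub_pos.2 hab
    rw [h2, neg_lt_zero]
    positivity
  obtain ⟨c, hc1, hc2, hc⟩ := hS t a b hab hta
  exact ⟨c, hc1, hc2, by rw [hpt, eval_mul, hc, mul_zero]⟩

/-- Rolle's theorem. -/
theorem exists_derivative_root (hS : PolynomialIVT S) {p : S[X]} (hp : p ≠ 0)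
    {a b : S} (hab : a < b) (ha : p.eval a = 0) (hb : p.eval b = 0) :
    ∃ c, a < c ∧ c < b ∧ p.derivative.eval c = 0 := by
  classical
  set Z := p.roots.toFinset.filter (fun z => a < z ∧ z ≤ b) with hZ
  have hmem : ∀ z, z ∈ Z ↔ p.eval z = 0 ∧ a < z ∧ z ≤ b := by
    intro z; simp [hZ, hp]
  have hne : Z.Nonempty := ⟨b, (hmem b).2 ⟨hb, hab, le_rfl⟩⟩
  obtain ⟨h0, h1, h2⟩ := (hmem _).1 (Z.min'_mem hne)
  obtain ⟨c, hc1, hc2, hc⟩ := hS.exists_derivative_root_of_consecutive hp h1 ha h0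
    (fun z hz1 hz2 hz => absurd (Z.min'_le z ((hmem z).2 ⟨hz, hz1, (hz2.trans_le h2).le⟩))
      (not_le.2 hz2))
  exact ⟨c, hc1, hc2.trans_le h2, hc⟩

end PolynomialIVT

/-- Two embeddings of a field into ordered fields which induce the same signs, and which cannot
be prolonged to a larger field. -/
structure MaximalSignPair {F S T : Type*} [Field F] [Field S] [LinearOrder S] [Field T]
    [LinearOrder T] (φ : F →+* S) (ψ : F →+* T) : Prop where
  sign_eq : ∀ x, sign (φ x) = sign (ψ x)
  maximal : ∀ α β, (∀ g : F[X], sign (g.eval₂ φ α) = sign (g.eval₂ ψ β)) →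
    ∃ e, φ e = α ∧ ψ e = β

namespace MaximalSignPair

variable {F S T : Type*} [Field F] [Field S] [LinearOrder S] [IsStrictOrderedRing S]
  [Field T] [LinearOrder T] [IsStrictOrderedRing T] {φ : F →+* S} {ψ : F →+* T}

theorem symm (h : MaximalSignPair φ ψ) : MaximalSignPair ψ φ where
  sign_eq x := (h.sign_eq x).symm
  maximal α β hg := by
    obtain ⟨e, h1, h2⟩ := h.maximal β α (fun g => (hg g).symm)
    exact ⟨e, h2, h1⟩

theorem lt_iff (h : MaximalSignPair φ ψ) (x y : F) : φ x < φ y ↔ ψ x < ψ y := by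
  rw [← sub_pos, ← sub_pos (a := ψ y), ← map_sub, ← map_sub, ← sign_eq_one_iff,
    ← sign_eq_one_iff, h.sign_eq]

theorem exists_bound (φ : F →+* S) {g : F[X]} (hg : g ≠ 0) {α : S} (hα : g.eval₂ φ α = 0) :
    ∃ M : F, |α| < φ M := by
  set n := g.natDegree with hn
  set c : ℕ → F := fun i => g.coeff i / g.coeff n with hc
  have hlc : g.coeff n ≠ 0 := by simpa [hn] using hg
  refine ⟨1 + ∑ i ∈ Finset.range n, (1 + c i ^ 2), ?_⟩
  by_contra! hM
  have habs : ∀ x : S, |x| ≤ 1 + x ^ 2 := fun x => by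
    rw [← sq_abs]; nlinarith [sq_nonneg (|x| - 1), abs_nonneg x]
  have hle : ∑ i ∈ Finset.range n, |φ (c i)| ≤ |α| - 1 := by
    refine le_trans (Finset.sum_le_sum fun i _ => habs (φ (c i))) ?_
    simp only [map_add, map_one, map_sum, map_pow] at hM
    linarith
  have h1 : 1 ≤ |α| := by
    have : 0 ≤ ∑ i ∈ Finset.range n, |φ (c i)| := Finset.sum_nonneg fun i _ => abs_nonneg _
    linarith
  have heq : α ^ n = -∑ i ∈ Finset.range n, φ (c i) * α ^ i := by
    rw [eval₂_eq_sum_range, Finset.sum_range_succ, ← hn] at hα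
    have hlc' : φ (g.coeff n) ≠ 0 := (map_ne_zero φ).2 hlc
    apply mul_left_cancel₀ hlc'
    rw [eq_neg_of_add_eq_zero_right hα, mul_neg, Finset.mul_sum]
    congr 1
    refine Finset.sum_congr rfl fun i _ => ?_
    simp only [hc, map_div₀]
    field_simp
  rcases Nat.eq_zero_or_pos n with h0 | hpos
  · rw [h0] at heq; simp at heq
  obtain ⟨k, hk⟩ := Nat.exists_eq_succ_of_ne_zero hpos.ne'
  have hlt : |α| ^ n ≤ (|α| - 1) * |α| ^ k := by
    rw [← abs_pow, heq, abs_neg]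
    refine (Finset.abs_sum_le_sum_abs _ _).trans ?_
    refine le_trans (Finset.sum_le_sum (g := fun i => |φ (c i)| * |α| ^ k) fun i hi => ?_) ?_
    · rw [abs_mul, abs_pow]
      have := Finset.mem_range.1 hi
      exact mul_le_mul_of_nonneg_left (pow_le_pow_right₀ h1 (by omega)) (abs_nonneg _)
    · rw [← Finset.sum_mul]
      exact mul_le_mul_of_nonneg_right hle (by positivity)
  have hp : 0 < |α| ^ k := by positivity
  rw [hk, pow_succ] at hlt
  nlinarith

/-- A point outside the range of `φ` lies in a gap of any finite set of points of this range. -/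
theorem exists_gap (φ : F →+* S) {α : S} (hα : ∀ e, φ e ≠ α) {c₀ d₀ : F} (hc₀ : φ c₀ < α)
    (hd₀ : α < φ d₀) (Z : Finset S) (hZ : ∀ z ∈ Z, ∃ e, φ e = z) :
    ∃ c d : F, φ c₀ ≤ φ c ∧ φ d ≤ φ d₀ ∧ φ c < α ∧ α < φ d ∧
      ∀ z ∈ Z, ¬ (φ c < z ∧ z < φ d) := by
  classical
  induction Z using Finset.induction_on with
  | empty => exact ⟨c₀, d₀, le_rfl, le_rfl, hc₀, hd₀, by simp⟩
  | insert z Z _ ih =>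
    obtain ⟨c, d, h1, h2, hc, hd, h⟩ := ih fun z hz => hZ z (Finset.mem_insert_of_mem hz)
    obtain ⟨e, rfl⟩ := hZ z (Finset.mem_insert_self _ _)
    by_cases hin : φ c < φ e ∧ φ e < φ d
    · rcases lt_or_gt_of_ne (hα e) with he | he
      · refine ⟨e, d, h1.trans hin.1.le, h2, he, hd, fun z hz => ?_⟩
        rcases Finset.mem_insert.1 hz with rfl | hz
        · exact fun h => lt_irrefl _ h.1
        · exact fun h' => h z hz ⟨hin.1.trans h'.1, h'.2⟩
      · refine ⟨c, e, h1, hin.2.le.trans h2, hc, he, fun z hz => ?_⟩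
        rcases Finset.mem_insert.1 hz with rfl | hz
        · exact fun h => lt_irrefl _ h.2
        · exact fun h' => h z hz ⟨h'.1, h'.2.trans hin.2⟩
    · refine ⟨c, d, h1, h2, hc, hd, fun z hz => ?_⟩
      rcases Finset.mem_insert.1 hz with rfl | hz
      · exact hin
      · exact h z hz

/-- If `p` has a simple root `α` in an interval without critical points, then its signs at the
endpoints differ. -/
theorem mul_neg_of_root (hS : PolynomialIVT S) {p : S[X]} {α c d : S} (hc : c < α) (hd : α < d)
    (hα : p.eval α = 0) (hα' : p.derivative.eval α ≠ 0)
    (h : ∀ z, c < z → z < d → p.derivative.eval z ≠ 0) : p.eval c * p.eval d < 0 := by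
  have hp : p ≠ 0 := by rintro rfl; simp at hα'
  obtain ⟨q, rfl⟩ := dvd_iff_isRoot.2 hα
  have hq : ∀ z, c ≤ z → z ≤ d → q.eval z ≠ 0 := by
    intro z hz1 hz2 hz
    have hz0 : ((X - C α) * q).eval z = 0 := by rw [eval_mul, hz, mul_zero]
    rcases lt_trichotomy z α with hlt | rfl | hlt
    · obtain ⟨w, hw1, hw2, hw⟩ := hS.exists_derivative_root hp hlt hz0 hα
      exact h w (hz1.trans_lt hw1) (hw2.trans hd) hw
    · apply hα'
      simp [derivative_mul, hz]
    · obtain ⟨w, hw1, hw2, hw⟩ := hS.exists_derivative_root hp hlt hα hz0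
      exact h w (hc.trans hw1) (hw2.trans_le hz2) hw
  have := hS.mul_pos_of_ne_zero (hc.trans hd).le hq
  have h3 : ((X - C α) * q).eval c * ((X - C α) * q).eval d
      = -((α - c) * (d - α) * (q.eval c * q.eval d)) := by
    simp; ring
  rw [h3, neg_lt_zero]
  exact mul_pos (mul_pos (sub_pos.2 hc) (sub_pos.2 hd)) this

theorem mem_range_of_root_of_lt (h : MaximalSignPair φ ψ) (hS : PolynomialIVT S)
    (hT : PolynomialIVT T) {g : F[X]} (hg : g ≠ 0)
    (ihS : ∀ f : F[X], f ≠ 0 → f.natDegree < g.natDegree → ∀ α, f.eval₂ φ α = 0 → ∃ e, φ e = α)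
    (ihT : ∀ f : F[X], f ≠ 0 → f.natDegree < g.natDegree → ∀ β, f.eval₂ ψ β = 0 → ∃ e, ψ e = β)
    {α : S} (hα : g.eval₂ φ α = 0) : ∃ e, φ e = α := by
  classical
  by_contra! hne
  have : CharZero F := (RingHom.charZero_iff φ.injective).2 inferInstance
  have hdeg : 0 < g.natDegree := by
    by_contra h0
    rw [eq_C_of_natDegree_eq_zero (Nat.eq_zero_of_not_pos h0), eval₂_C, map_eq_zero] at hα
    rw [eq_C_of_natDegree_eq_zero (Nat.eq_zero_of_not_pos h0), hα, C_0] at hg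
    exact hg rfl
  have hg' : derivative g ≠ 0 := fun h0 => hdeg.ne' (derivative_eq_zero.1 h0)
  have hdlt : (derivative g).natDegree < g.natDegree := natDegree_derivative_lt hdeg.ne'
  have hmS : ∀ z, (derivative g).eval₂ φ z = (derivative (g.map φ)).eval z := by
    intro z; rw [derivative_map, eval_map]
  have hmT : ∀ z, (derivative g).eval₂ ψ z = (derivative (g.map ψ)).eval z := by
    intro z; rw [derivative_map, eval_map]
  have hgap : ∀ (f : F[X]) (c₀ d₀ : F), f ≠ 0 → f.natDegree < g.natDegree → φ c₀ < α →
      α < φ d₀ → ∃ c d : F, φ c₀ ≤ φ c ∧ φ d ≤ φ d₀ ∧ φ c < α ∧ α < φ d ∧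
        (∀ z, φ c < z → z < φ d → f.eval₂ φ z ≠ 0) ∧
        (∀ z, ψ c < z → z < ψ d → f.eval₂ ψ z ≠ 0) := by
    intro f c₀ d₀ hf hfd hc₀ hd₀
    have hroots : ∀ z, z ∈ (f.map φ).roots.toFinset ↔ f.eval₂ φ z = 0 := by
      intro z
      simp [hf, eval_map]
    obtain ⟨c, d, h1, h2, hc, hd, hcd⟩ := exists_gap φ hne hc₀ hd₀ (f.map φ).roots.toFinset
      (fun z hz => ihS f hf hfd z ((hroots z).1 hz))
    have hnoS : ∀ z, φ c < z → z < φ d → f.eval₂ φ z ≠ 0 :=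
      fun z hz1 hz2 hz => hcd z ((hroots z).2 hz) ⟨hz1, hz2⟩
    refine ⟨c, d, h1, h2, hc, hd, hnoS, fun z hz1 hz2 hz => ?_⟩
    obtain ⟨e, rfl⟩ := ihT f hf hfd z hz
    exact hnoS (φ e) ((h.lt_iff _ _).2 hz1) ((h.lt_iff _ _).2 hz2)
      (by simpa using hz)
  have hα' : (derivative (g.map φ)).eval α ≠ 0 := fun h0 => by
    obtain ⟨e, he⟩ := ihS _ hg' hdlt α ((hmS α).trans h0)
    exact hne e he
  obtain ⟨M, hM⟩ := exists_bound φ hg hα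
  obtain ⟨c₁, d₁, -, -, hc₁, hd₁, hS₁, hT₁⟩ := hgap (derivative g) (-M) M hg' hdlt
    (by rw [map_neg]; exact (abs_lt.1 hM).1) (abs_lt.1 hM).2
  have hroot : ∀ c d : F, φ c₁ ≤ φ c → φ d ≤ φ d₁ → φ c < α → α < φ d →
      ∃ β, ψ c < β ∧ β < ψ d ∧ g.eval₂ ψ β = 0 := by
    intro c d h1 h2 hc hd
    have hneg := mul_neg_of_root hS hc hd ((eval_map φ α).trans hα) hα'
      (fun z hz1 hz2 => hmS z ▸ hS₁ z (h1.trans_lt hz1) (hz2.trans_le h2))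
    rw [eval_map, eval_map, eval₂_at_apply, eval₂_at_apply, ← map_mul, ← sign_eq_neg_one_iff,
      h.sign_eq, sign_eq_neg_one_iff, map_mul, ← eval₂_at_apply, ← eval₂_at_apply, ← eval_map,
      ← eval_map] at hneg
    obtain ⟨β, hβ1, hβ2, hβ⟩ := hT _ _ _ ((h.lt_iff _ _).1 (hc.trans hd)) hneg
    exact ⟨β, hβ1, hβ2, by rwa [eval_map] at hβ⟩
  obtain ⟨β, hβ1, hβ2, hβ⟩ := hroot c₁ d₁ le_rfl le_rfl hc₁ hd₁
  have hgT : g.map ψ ≠ 0 := by simpa using hg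
  have huniq : ∀ γ γ', ψ c₁ < γ → γ' < ψ d₁ → γ < γ' → g.eval₂ ψ γ = 0 → g.eval₂ ψ γ' = 0 →
      False := by
    intro γ γ' h1 h2 hlt h0 h0'
    obtain ⟨w, hw1, hw2, hw⟩ := hT.exists_derivative_root hgT hlt ((eval_map ψ γ).trans h0)
      ((eval_map ψ γ').trans h0')
    exact hT₁ w (h1.trans hw1) (hw2.trans h2) ((hmT w).trans hw)
  have hle : ∀ x y, φ x ≤ φ y → ψ x ≤ ψ y := fun x y hxy =>
    not_lt.1 fun hlt => not_lt.2 hxy ((h.lt_iff _ _).2 hlt)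
  obtain ⟨e, he, -⟩ := h.maximal α β (fun f => by
    have hmodS : f.eval₂ φ α = (f % g).eval₂ φ α := by
      conv_lhs => rw [← EuclideanDomain.mod_add_div f g]
      rw [eval₂_add, eval₂_mul, hα, zero_mul, add_zero]
    have hmodT : f.eval₂ ψ β = (f % g).eval₂ ψ β := by
      conv_lhs => rw [← EuclideanDomain.mod_add_div f g]
      rw [eval₂_add, eval₂_mul, hβ, zero_mul, add_zero]
    rw [hmodS, hmodT]
    rcases eq_or_ne (f % g) 0 with h0 | h0
    · simp [h0]
    have hlt : (f % g).natDegree < g.natDegree :=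
      natDegree_lt_natDegree h0 (EuclideanDomain.mod_lt f hg)
    obtain ⟨c, d, h1, h2, hc, hd, hnS, hnT⟩ := hgap (f % g) c₁ d₁ h0 hlt hc₁ hd₁
    obtain ⟨γ, hγ1, hγ2, hγ⟩ := hroot c d h1 h2 hc hd
    have hγβ : γ = β := by
      have h3 := (hle _ _ h1).trans_lt hγ1
      have h4 := hγ2.trans_le (hle _ _ h2)
      rcases lt_trichotomy γ β with hlt | heq | hlt
      · exact (huniq γ β h3 hβ2 hlt hγ hβ).elim
      · exact heq
      · exact (huniq β γ hβ1 h4 hlt hβ hγ).elim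
    subst hγβ
    have hcd : φ c < φ d := hc.trans hd
    have hcdT : ψ c < ψ d := hγ1.trans hγ2
    have hmid1 : φ c < φ ((c + d) / 2) ∧ φ ((c + d) / 2) < φ d := by
      simp only [map_div₀, map_add, map_ofNat]
      constructor <;> linarith
    have hmid2 : ψ c < ψ ((c + d) / 2) ∧ ψ ((c + d) / 2) < ψ d :=
      ⟨(h.lt_iff _ _).1 hmid1.1, (h.lt_iff _ _).1 hmid1.2⟩
    have e1 : sign ((f % g).eval₂ φ α) = sign ((f % g).eval₂ φ (φ ((c + d) / 2))) := by
      rw [← eval_map, ← eval_map]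
      refine hS.sign_eq_of_ne_zero fun z hz1 hz2 => ?_
      rw [eval_map]
      exact hnS z ((lt_min hc hmid1.1).trans_le hz1) (hz2.trans_lt (max_lt hd hmid1.2))
    have e2 : sign ((f % g).eval₂ ψ γ) = sign ((f % g).eval₂ ψ (ψ ((c + d) / 2))) := by
      rw [← eval_map, ← eval_map]
      refine hT.sign_eq_of_ne_zero fun z hz1 hz2 => ?_
      rw [eval_map]
      exact hnT z ((lt_min hγ1 hmid2.1).trans_le hz1) (hz2.trans_lt (max_lt hγ2 hmid2.2))
    rw [e1, e2, eval₂_at_apply, eval₂_at_apply, h.sign_eq])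
  exact hne e he

/-- The range of a maximal sign pair is algebraically closed in the two real closed fields. -/
theorem mem_range_of_root (h : MaximalSignPair φ ψ) (hS : PolynomialIVT S)
    (hT : PolynomialIVT T) {g : F[X]} (hg : g ≠ 0) {α : S} (hα : g.eval₂ φ α = 0) :
    ∃ e, φ e = α := by
  have key : ∀ n, ∀ g : F[X], g ≠ 0 → g.natDegree = n →
      (∀ α, g.eval₂ φ α = 0 → ∃ e, φ e = α) ∧ (∀ β, g.eval₂ ψ β = 0 → ∃ e, ψ e = β) := by
    intro n
    induction n using Nat.strong_induction_on with
    | _ n ih =>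
      rintro g hg rfl
      exact ⟨fun α hα => h.mem_range_of_root_of_lt hS hT hg
          (fun f hf hlt => (ih _ hlt f hf rfl).1) (fun f hf hlt => (ih _ hlt f hf rfl).2) hα,
        fun β hβ => h.symm.mem_range_of_root_of_lt hT hS hg
          (fun f hf hlt => (ih _ hlt f hf rfl).2) (fun f hf hlt => (ih _ hlt f hf rfl).1) hβ⟩
  exact (key _ g hg rfl).1 α hα

theorem exists_sign_eq (h : MaximalSignPair φ ψ) (hS : PolynomialIVT S)
    (hT : PolynomialIVT T) (H : Finset F[X]) (y : S) :
    ∃ m : F, ∀ f ∈ H, sign (f.eval₂ φ y) = sign (φ (f.eval m)) := by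
  classical
  by_cases hy : ∃ e, φ e = y
  · obtain ⟨e, rfl⟩ := hy
    exact ⟨e, fun f _ => by rw [eval₂_at_apply]⟩
  push Not at hy
  set Z : Finset S := H.biUnion fun f => (f.map φ).roots.toFinset with hZdef
  have hZ : ∀ z ∈ Z, ∃ e, φ e = z := by
    intro z hz
    obtain ⟨f, -, hz⟩ := Finset.mem_biUnion.1 hz
    rw [Multiset.mem_toFinset, mem_roots', IsRoot.def, eval_map] at hz
    exact h.mem_range_of_root hS hT (fun h0 => hz.1 (by rw [h0, Polynomial.map_zero])) hz.2
  suffices hm : ∃ m : F, ∀ z ∈ Z, ¬ (min y (φ m) ≤ z ∧ z ≤ max y (φ m)) by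
    obtain ⟨m, hm⟩ := hm
    refine ⟨m, fun f hf => ?_⟩
    rcases eq_or_ne f 0 with rfl | hf0
    · simp
    rw [← eval₂_at_apply, ← eval_map, ← eval_map]
    refine hS.sign_eq_of_ne_zero fun z hz1 hz2 hz => hm z ?_ ⟨hz1, hz2⟩
    refine Finset.mem_biUnion.2 ⟨f, hf, ?_⟩
    rw [Multiset.mem_toFinset, mem_roots']
    exact ⟨by simpa using hf0, hz⟩
  have hyZ : ∀ z ∈ Z, z ≠ y := by
    rintro z hz rfl
    obtain ⟨e, he⟩ := hZ z hz
    exact hy e he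
  by_cases hlo : ∃ z ∈ Z, z < y
  · have hne : (Z.filter (· < y)).Nonempty := by
      obtain ⟨z, hz⟩ := hlo
      exact ⟨z, Finset.mem_filter.2 hz⟩
    obtain ⟨a, ha, hamax⟩ := (Z.filter (· < y)).exists_max_image id hne
    rw [Finset.mem_filter] at ha
    obtain ⟨a, rfl⟩ := hZ a ha.1
    by_cases hhi : ∃ z ∈ Z, y < z
    · have hne : (Z.filter (y < ·)).Nonempty := by
        obtain ⟨z, hz⟩ := hhi
        exact ⟨z, Finset.mem_filter.2 hz⟩
      obtain ⟨b, hb, hbmin⟩ := (Z.filter (y < ·)).exists_min_image id hne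
      rw [Finset.mem_filter] at hb
      obtain ⟨b, rfl⟩ := hZ b hb.1
      refine ⟨(a + b) / 2, fun z hz ⟨h1, h2⟩ => ?_⟩
      have hmid : φ a < φ ((a + b) / 2) ∧ φ ((a + b) / 2) < φ b := by
        simp only [map_div₀, map_add, map_ofNat]
        constructor <;> linarith [ha.2, hb.2]
      rcases lt_or_gt_of_ne (hyZ z hz) with hlt | hlt
      · have h3 := hamax z (Finset.mem_filter.2 ⟨hz, hlt⟩)
        exact absurd ((lt_min ha.2 hmid.1).trans_le h1) (not_lt.2 h3)
      · have h3 := hbmin z (Finset.mem_filter.2 ⟨hz, hlt⟩)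
        exact absurd (h2.trans_lt (max_lt hb.2 hmid.2)) (not_lt.2 h3)
    · push Not at hhi
      refine ⟨a + 1, fun z hz ⟨h1, h2⟩ => ?_⟩
      have h3 := hamax z (Finset.mem_filter.2 ⟨hz, lt_of_le_of_ne (hhi z hz) (hyZ z hz)⟩)
      have h4 : φ a < φ (a + 1) := by simp
      exact absurd ((lt_min ha.2 h4).trans_le h1) (not_lt.2 h3)
  · push Not at hlo
    by_cases hZe : Z.Nonempty
    · obtain ⟨b, hb, hbmin⟩ := Z.exists_min_image id hZe
      obtain ⟨b, rfl⟩ := hZ b hb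
      refine ⟨b - 1, fun z hz ⟨h1, h2⟩ => ?_⟩
      have h4 : φ (b - 1) < φ b := by simp
      have h5 : y < φ b := lt_of_le_of_ne (hlo _ hb) (hyZ _ hb).symm
      exact absurd (h2.trans_lt (max_lt h5 h4)) (not_lt.2 (hbmin z hz))
    · exact ⟨0, fun z hz => absurd ⟨z, hz⟩ hZe⟩

end MaximalSignPair

theorem map_sum_coeff_mul_pow {R S : Type*} [CommRing R] [Field S] (g : R[X]) (p : R)
    (f : R →+* S) (hf : f p ≠ 0) :
    f (∑ i ∈ Finset.range (g.natDegree + 1), g.coeff i * p ^ (2 * g.natDegree - i))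
      = (f p ^ g.natDegree) ^ 2 * g.eval₂ f (f p)⁻¹ := by
  rw [map_sum, eval₂_eq_sum_range, Finset.mul_sum]
  refine Finset.sum_congr rfl fun i hi => ?_
  have hi : i ≤ 2 * g.natDegree := by have := Finset.mem_range.1 hi; omega
  rw [map_mul, map_pow, pow_sub₀ _ hf hi, inv_pow, ← pow_mul, mul_comm g.natDegree 2]
  ring

theorem sign_pow_sq_mul {S : Type*} [Field S] [LinearOrder S] [IsStrictOrderedRing S] {x : S}
    (n : ℕ) (hx : x ≠ 0) (y : S) : sign ((x ^ n) ^ 2 * y) = sign y := by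
  have h : 0 < (x ^ n) ^ 2 := by positivity
  rw [sign_mul, sign_pos h, one_mul]

section SignCoherent

variable {S T : Type*} [Field S] [LinearOrder S] [IsStrictOrderedRing S]
  [Field T] [LinearOrder T] [IsStrictOrderedRing T]

/-- A subring of a product of ordered fields whose elements have components of equal signs. -/
def SignCoherent (Γ : Subring (S × T)) : Prop := ∀ p ∈ Γ, sign p.1 = sign p.2

theorem SignCoherent.exists_maximal {Γ₀ : Subring (S × T)} (h : SignCoherent Γ₀) :
    ∃ Γ, Γ₀ ≤ Γ ∧ SignCoherent Γ ∧ ∀ Γ', SignCoherent Γ' → Γ ≤ Γ' → Γ' ≤ Γ := by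
  obtain ⟨Γ, hle, hmax⟩ := zorn_le_nonempty₀ {Γ : Subring (S × T) | SignCoherent Γ}
    (fun c hc hchain y hy => by
      refine ⟨sSup c, fun p hp => ?_, fun z hz => le_sSup hz⟩
      obtain ⟨Γ, hΓ, hp⟩ := (Subring.mem_sSup_of_directedOn ⟨y, hy⟩ hchain.directedOn).1 hp
      exact hc hΓ p hp) Γ₀ h
  exact ⟨Γ, hle, hmax.1, fun Γ' h1 h2 => hmax.2 h1 h2⟩

theorem SignCoherent.mem_of_maximal {Γ : Subring (S × T)}
    (hmax : ∀ Γ', SignCoherent Γ' → Γ ≤ Γ' → Γ' ≤ Γ) {α : S} {β : T}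
    (h : ∀ g : Γ[X], sign (g.eval₂ ((RingHom.fst S T).comp Γ.subtype) α)
      = sign (g.eval₂ ((RingHom.snd S T).comp Γ.subtype) β)) : (α, β) ∈ Γ := by
  refine hmax (eval₂RingHom Γ.subtype (α, β)).range ?_ ?_ ⟨X, by simp⟩
  · rintro _ ⟨g, rfl⟩
    have h1 := hom_eval₂ g Γ.subtype (RingHom.fst S T) (α, β)
    have h2 := hom_eval₂ g Γ.subtype (RingHom.snd S T) (α, β)
    have h3 := h g
    rw [RingHom.coe_fst] at h1
    rw [RingHom.coe_snd] at h2
    dsimp only at h1 h2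
    rw [coe_eval₂RingHom, h1, h2, h3]
  · exact fun p hp => ⟨C ⟨p, hp⟩, by simp⟩

theorem SignCoherent.inv_mem_of_maximal {Γ : Subring (S × T)} (hΓ : SignCoherent Γ)
    (hmax : ∀ Γ', SignCoherent Γ' → Γ ≤ Γ' → Γ' ≤ Γ) {p : S × T} (hp : p ∈ Γ) (h1 : p.1 ≠ 0) :
    (p.1⁻¹, p.2⁻¹) ∈ Γ := by
  have h2 : p.2 ≠ 0 := by
    have := hΓ p hp
    rwa [← sign_ne_zero, ← this, sign_ne_zero]
  refine mem_of_maximal hmax fun g => ?_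
  have e1 := map_sum_coeff_mul_pow g ⟨p, hp⟩ ((RingHom.fst S T).comp Γ.subtype) h1
  have e2 := map_sum_coeff_mul_pow g ⟨p, hp⟩ ((RingHom.snd S T).comp Γ.subtype) h2
  set q : Γ := ∑ i ∈ Finset.range (g.natDegree + 1),
    g.coeff i * ⟨p, hp⟩ ^ (2 * g.natDegree - i)
  have hs := hΓ q.1 q.2
  change (q : S × T).1 = _ at e1
  change (q : S × T).2 = _ at e2
  rw [e1, e2] at hs
  exact ((sign_pow_sq_mul _ h1 _).symm.trans hs).trans (sign_pow_sq_mul _ h2 _)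

end SignCoherent

theorem exists_maximalSignPair.{u, v, w} {R : Type u} {S : Type v} {T : Type w} [CommRing R]
    [Field S] [LinearOrder S] [IsStrictOrderedRing S]
    [Field T] [LinearOrder T] [IsStrictOrderedRing T] (f₁ : R →+* S) (f₂ : R →+* T)
    (h : ∀ r, sign (f₁ r) = sign (f₂ r)) :
    ∃ (F : Type (max v w)) (_ : Field F) (i : R →+* F) (φ : F →+* S) (ψ : F →+* T),
      φ.comp i = f₁ ∧ ψ.comp i = f₂ ∧ MaximalSignPair φ ψ := by
  have h₀ : SignCoherent (f₁.prod f₂).range := by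
    rintro _ ⟨r, rfl⟩
    exact h r
  obtain ⟨Γ, hle, hΓ, hmax⟩ := h₀.exists_maximal
  have hfield : IsField Γ :=
    { exists_pair_ne := ⟨0, 1, zero_ne_one⟩
      mul_comm := mul_comm
      mul_inv_cancel := by
        rintro ⟨p, hp⟩ hne
        have h1 : p.1 ≠ 0 := fun h1 => hne (Subtype.ext (Prod.ext h1 (by
          have := hΓ p hp
          rw [h1, sign_zero] at this
          exact sign_eq_zero_iff.1 this.symm)))
        have h2 : p.2 ≠ 0 := by
          rwa [← sign_ne_zero, ← hΓ p hp, sign_ne_zero]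
        exact ⟨⟨_, hΓ.inv_mem_of_maximal hmax hp h1⟩, Subtype.ext (Prod.ext
          (mul_inv_cancel₀ h1) (mul_inv_cancel₀ h2))⟩ }
  let _ := hfield.toField
  refine ⟨Γ, hfield.toField, (f₁.prod f₂).codRestrict Γ (fun r => hle ⟨r, rfl⟩),
    (RingHom.fst S T).comp Γ.subtype, (RingHom.snd S T).comp Γ.subtype, rfl, rfl, ?_, ?_⟩
  · exact fun x => hΓ x.1 x.2
  · exact fun α β hg => ⟨⟨(α, β), SignCoherent.mem_of_maximal hmax hg⟩, rfl, rfl⟩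

section Ultrapower

variable {α : Type*} {U : Ultrafilter α}

theorem Filter.Germ.sign_coe_eq_iff {f : α → ℝ} {S : Type*} [Field S] [LinearOrder S]
    {x : S} : sign (f : Germ (U : Filter α) ℝ) = sign x ↔
      ∀ᶠ a in (U : Filter α), sign (f a) = sign x := by
  have h0 : (0 : Germ (U : Filter α) ℝ) = ((fun _ => 0 : α → ℝ) : Germ (U : Filter α) ℝ) := rfl
  rcases lt_trichotomy x 0 with hx | rfl | hx
  · simp only [sign_neg hx, sign_eq_neg_one_iff, h0, Filter.Germ.coe_lt]
  · simp only [sign_zero, sign_eq_zero_iff, h0, Filter.Germ.coe_eq, Filter.EventuallyEq]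
  · simp only [sign_pos hx, sign_eq_one_iff, h0, Filter.Germ.coe_lt]

theorem Filter.Germ.exists_polynomial_lift (p : (Germ (U : Filter α) ℝ)[X]) :
    ∃ q : α → ℝ[X], ∀ c : α → ℝ, p.eval (c : Germ (U : Filter α) ℝ)
      = ((fun a => (q a).eval (c a) : α → ℝ) : Germ (U : Filter α) ℝ) := by
  induction p using Polynomial.induction_on' with
  | add p₁ p₂ h₁ h₂ =>
    obtain ⟨q₁, h₁⟩ := h₁
    obtain ⟨q₂, h₂⟩ := h₂
    refine ⟨q₁ + q₂, fun c => ?_⟩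
    rw [eval_add, h₁, h₂, ← Filter.Germ.coe_add]
    congr 1
    ext a
    simp
  | monomial n r =>
    induction r using Filter.Germ.inductionOn with
    | _ r =>
    refine ⟨fun a => monomial n (r a), fun c => ?_⟩
    rw [eval_monomial, ← Filter.Germ.coe_pow, ← Filter.Germ.coe_mul]
    congr 1
    ext a
    simp

theorem polynomialIVT_real : PolynomialIVT ℝ := by
  intro p a b hab h
  have hc : ContinuousOn (fun x => p.eval x) (Set.Icc a b) := p.continuous.continuousOn
  rcases mul_neg_iff.1 h with ⟨h1, h2⟩ | ⟨h1, h2⟩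
  · obtain ⟨c, hc, h0⟩ := intermediate_value_Ioo' hab.le hc ⟨h2, h1⟩
    exact ⟨c, hc.1, hc.2, h0⟩
  · obtain ⟨c, hc, h0⟩ := intermediate_value_Ioo hab.le hc ⟨h1, h2⟩
    exact ⟨c, hc.1, hc.2, h0⟩

theorem polynomialIVT_germ : PolynomialIVT (Filter.Germ (U : Filter α) ℝ) := by
  intro p a b hab h
  induction a using Filter.Germ.inductionOn with
  | _ a =>
  induction b using Filter.Germ.inductionOn with
  | _ b =>
  obtain ⟨q, hq⟩ := Filter.Germ.exists_polynomial_lift p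
  have h0 : (0 : Filter.Germ (U : Filter α) ℝ)
    = ((fun _ => 0 : α → ℝ) : Filter.Germ (U : Filter α) ℝ) := rfl
  rw [hq, hq, ← Filter.Germ.coe_mul, h0, Filter.Germ.coe_lt] at h
  rw [Filter.Germ.coe_lt] at hab
  have hex : ∀ᶠ x in (U : Filter α), ∃ c, a x < c ∧ c < b x ∧ (q x).eval c = 0 := by
    filter_upwards [h, hab] with x hx1 hx2 using polynomialIVT_real _ _ _ hx2 hx1
  obtain ⟨c, hc⟩ := hex.choice
  refine ⟨c, Filter.Germ.coe_lt.2 (hc.mono fun x hx => hx.1),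
    Filter.Germ.coe_lt.2 (hc.mono fun x hx => hx.2.1), ?_⟩
  rw [hq, h0, Filter.Germ.coe_eq]
  exact hc.mono fun x hx => hx.2.2

end Ultrapower

theorem sign_map_real {S : Type*} [Field S] [LinearOrder S] [IsStrictOrderedRing S]
    (ι : ℝ →+* S) (r : ℝ) : sign (ι r) = sign r := by
  have hpos : ∀ r : ℝ, 0 < r → 0 < ι r := fun r hr => by
    rw [← Real.mul_self_sqrt hr.le, map_mul]
    exact mul_self_pos.2 ((map_ne_zero ι).2 (Real.sqrt_ne_zero'.2 hr))
  rcases lt_trichotomy r 0 with h | rfl | h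
  · have := hpos (-r) (neg_pos.2 h)
    rw [map_neg, neg_pos] at this
    rw [sign_neg h, sign_neg this]
  · simp
  · rw [sign_pos h, sign_pos (hpos r h)]

theorem MvPolynomial.eval₂_finSuccEquiv {S : Type*} [CommRing S] (ι : ℝ →+* S) {k : ℕ}
    (x : Fin (k + 1) → S) (f : MvPolynomial (Fin (k + 1)) ℝ) :
    (finSuccEquiv ℝ k f).eval₂ (eval₂Hom ι (x ∘ Fin.succ)) (x 0) = eval₂ ι x f := by
  induction f using MvPolynomial.induction_on with
  | C a => simp [finSuccEquiv_apply]
  | add p q hp hq => rw [map_add, Polynomial.eval₂_add, hp, hq, eval₂_add]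
  | mul_X p i hp =>
    rw [map_mul, Polynomial.eval₂_mul, hp, eval₂_mul, eval₂_X]
    congr 1
    refine Fin.cases ?_ (fun j => ?_) i
    · simp [finSuccEquiv_X_zero]
    · simp [finSuccEquiv_X_succ]

/-- Real points realise all the sign conditions realised in a real closed extension of `ℝ`. -/
theorem exists_real_point_sign_eq {S : Type*} [Field S] [LinearOrder S] [IsStrictOrderedRing S]
    (hS : PolynomialIVT S) (ι : ℝ →+* S) (k : ℕ) (x : Fin k → S)
    (H : Finset (MvPolynomial (Fin k) ℝ)) :
    ∃ a : Fin k → ℝ, ∀ f ∈ H, sign (MvPolynomial.eval a f) = sign (MvPolynomial.eval₂ ι x f) := by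
  classical
  induction k with
  | zero =>
    refine ⟨Fin.elim0, fun f _ => ?_⟩
    obtain ⟨r, rfl⟩ := MvPolynomial.C_surjective (Fin 0) f
    rw [MvPolynomial.eval_C, MvPolynomial.eval₂_C, sign_map_real]
  | succ k ih =>
    set f₁ : MvPolynomial (Fin k) ℝ →+* S := MvPolynomial.eval₂Hom ι (x ∘ Fin.succ) with hf₁
    set A : MvPolynomial (Fin k) ℝ → Set (Fin k → ℝ) :=
      fun f => {a | sign (MvPolynomial.eval a f) = sign (f₁ f)} with hA
    obtain ⟨U, hU⟩ := Ultrafilter.exists_ultrafilter_of_finite_inter_nonempty (Set.range A) (by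
      intro T hT
      choose! g hg using fun s (hs : s ∈ T) => hT hs
      obtain ⟨a, ha⟩ := ih (x ∘ Fin.succ) (T.image g)
      refine ⟨a, fun s hs => ?_⟩
      rw [← hg s hs]
      exact ha (g s) (Finset.mem_image_of_mem g hs))
    set f₂ : MvPolynomial (Fin k) ℝ →+* Filter.Germ (U : Filter (Fin k → ℝ)) ℝ :=
      (Filter.Germ.coeRingHom (U : Filter (Fin k → ℝ))).comp
        (RingHom.pi fun a => MvPolynomial.eval a) with hf₂
    have hf₂' : ∀ f, f₂ f = ((fun a => MvPolynomial.eval a f : (Fin k → ℝ) → ℝ) :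
      Filter.Germ (U : Filter (Fin k → ℝ)) ℝ) := fun f => rfl
    obtain ⟨F, _, i, φ, ψ, hφ, hψ, hmax⟩ := exists_maximalSignPair f₁ f₂ (fun f => by
      rw [eq_comm, hf₂', Filter.Germ.sign_coe_eq_iff]
      exact hU ⟨f, rfl⟩)
    obtain ⟨m, hm⟩ := hmax.exists_sign_eq hS polynomialIVT_germ
      (H.image fun f => (MvPolynomial.finSuccEquiv ℝ k f).map i) (x 0)
    obtain ⟨c, hc⟩ : ∃ c : (Fin k → ℝ) → ℝ, (c : Filter.Germ (U : Filter (Fin k → ℝ)) ℝ) = ψ m :=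
      Quotient.exists_rep (ψ m)
    have hev : ∀ f ∈ H, ∀ᶠ a in (U : Filter (Fin k → ℝ)),
        sign (MvPolynomial.eval (Fin.cons (c a) a : Fin (k + 1) → ℝ) f)
          = sign (MvPolynomial.eval₂ ι x f) := by
      intro f hf
      rw [← Filter.Germ.sign_coe_eq_iff, ← MvPolynomial.eval₂_finSuccEquiv, ← hf₁, ← hφ,
        ← Polynomial.eval₂_map, hm _ (Finset.mem_image_of_mem _ hf), hmax.sign_eq,
        ← Polynomial.eval₂_at_apply, Polynomial.eval₂_map, hψ, ← hc]
      congr 1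
      generalize hp : MvPolynomial.finSuccEquiv ℝ k f = p
      have : ∀ a, MvPolynomial.eval (Fin.cons (c a) a : Fin (k + 1) → ℝ) f
          = p.eval₂ (MvPolynomial.eval a) (c a) := by
        intro a
        rw [MvPolynomial.eval_eq_eval_mv_eval', hp, Polynomial.eval_map]
      simp only [this]
      clear this hp
      induction p using Polynomial.induction_on' with
      | add p q hp hq =>
        rw [Polynomial.eval₂_add, ← hp, ← hq, ← Filter.Germ.coe_add]
        congr 1
        ext a
        simp [Polynomial.eval₂_add]
      | monomial n r =>
        rw [Polynomial.eval₂_monomial, hf₂']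
        simp only [Polynomial.eval₂_monomial]
        rfl
    have hall := (Filter.eventually_all_finset H).2 hev
    obtain ⟨a, ha⟩ := hall.exists
    exact ⟨_, ha⟩

theorem IsSumSq.exists_lift_of_surjective {R S : Type*} [CommRing R] [CommRing S] (f : R →+* S)
    (hf : Function.Surjective f) {s : S} (hs : IsSumSq s) : ∃ r, IsSumSq r ∧ f r = s := by
  induction hs with
  | zero => exact ⟨0, .zero, map_zero f⟩
  | sq_add a _ ih =>
    obtain ⟨r, hr, rfl⟩ := ih
    obtain ⟨b, rfl⟩ := hf a
    exact ⟨b * b + r, .sq_add b hr, by simp⟩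

theorem IsSumSq.map_ringHom {R S : Type*} [CommRing R] [CommRing S] (f : R →+* S) {r : R}
    (hr : IsSumSq r) : IsSumSq (f r) := by
  induction hr with
  | zero => rw [map_zero]; exact .zero
  | sq_add a _ ih => rw [map_add, map_mul]; exact .sq_add _ ih

theorem Subfield.exists_isSumSq_of_mem_sSup {Ω : Type*} [Field Ω] {c : Set (Subfield Ω)}
    (hne : c.Nonempty) (hc : DirectedOn (· ≤ ·) c) {s : ↥(sSup c)} (hs : IsSumSq s) :
    ∃ E ∈ c, ∃ t : E, IsSumSq t ∧ (t : Ω) = s := by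
  induction hs with
  | zero =>
    obtain ⟨E, hE⟩ := hne
    exact ⟨E, hE, 0, .zero, rfl⟩
  | sq_add a _ ih =>
    obtain ⟨E, hE, t, ht, hts⟩ := ih
    obtain ⟨E', hE', ha⟩ := (Subfield.mem_sSup_of_directedOn hne hc).1 a.2
    obtain ⟨E'', hE'', h1, h2⟩ := hc E hE E' hE'
    refine ⟨E'', hE'', ⟨a, h2 ha⟩ * ⟨a, h2 ha⟩ + Subfield.inclusion h1 t,
      .sq_add _ (ht.map_ringHom _), ?_⟩
    simp [← hts, Subfield.inclusion]

/-- Every semireal field embeds in a semireal field without semireal simple algebraic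
extensions. -/
theorem exists_maximal_semireal_extension.{u} (K : Type u) [Field K] (hK : IsSemireal K) :
    ∃ (E : Type u) (_ : Field E) (_ : K →+* E), IsSemireal E ∧
      ∀ f : E[X], Irreducible f → (∃ x, f.eval x = 0) ∨ ∃ s, IsSumSq s ∧ f ∣ 1 + s := by
  set Ω := AlgebraicClosure K
  have h₀ : IsSemireal (algebraMap K Ω).fieldRange := ⟨fun {s} hs h => by
    obtain ⟨r, hr, rfl⟩ := hs.exists_lift_of_surjective (algebraMap K Ω).rangeRestrictField
      (algebraMap K Ω).rangeRestrictField_bijective.2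
    refine hK.one_add_ne_zero hr ((algebraMap K Ω).rangeRestrictField.injective ?_)
    rw [map_add, map_one, h, map_zero]⟩
  obtain ⟨E, hle, hmax⟩ := zorn_le_nonempty₀ {E : Subfield Ω | IsSemireal E}
    (fun c hc hchain y hy => by
      refine ⟨sSup c, ⟨fun {s} hs h => ?_⟩, fun z hz => le_sSup hz⟩
      obtain ⟨E, hE, t, ht, hts⟩ :=
        Subfield.exists_isSumSq_of_mem_sSup ⟨y, hy⟩ hchain.directedOn hs
      refine (hc hE).one_add_ne_zero ht (Subtype.ext ?_)
      have := congrArg Subtype.val h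
      simpa [hts] using this) _ h₀
  refine ⟨E, inferInstance, (Subfield.inclusion hle).comp (algebraMap K Ω).rangeRestrictField,
    hmax.1, fun f hf => ?_⟩
  obtain ⟨α, hα⟩ := IsAlgClosed.exists_aeval_eq_zero Ω f (degree_pos_of_irreducible hf).ne'
  have halg : IsAlgebraic E α := ⟨f, hf.ne_zero, hα⟩
  by_cases hs : IsSemireal (IntermediateField.adjoin E {α}).toSubfield
  · left
    have hmem : α ∈ E := hmax.2 hs (fun x hx =>
      (IntermediateField.adjoin E {α}).algebraMap_mem ⟨x, hx⟩)
      (IntermediateField.mem_adjoin_simple_self E α)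
    refine ⟨⟨α, hmem⟩, Subtype.ext ?_⟩
    have : aeval (algebraMap E Ω ⟨α, hmem⟩) f = 0 := hα
    rw [aeval_algebraMap_apply] at this
    exact this
  · right
    have : ∃ s : (IntermediateField.adjoin E {α}).toSubfield, IsSumSq s ∧ 1 + s = 0 := by
      by_contra! h
      exact hs ⟨fun {s} hs => h s hs⟩
    obtain ⟨s, hs, h1⟩ := this
    have key : ∀ s : (IntermediateField.adjoin E {α}).toSubfield, ∃ q : E[X], aeval α q = s := by
      rintro ⟨s, hs⟩
      have : s ∈ (IntermediateField.adjoin E {α}).toSubalgebra := hs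
      rw [IntermediateField.adjoin_simple_toSubalgebra_of_isAlgebraic halg,
        Algebra.adjoin_singleton_eq_range_aeval] at this
      exact this
    have key2 : ∃ q : E[X], IsSumSq q ∧ aeval α q = s := by
      clear h1
      induction hs with
      | zero => exact ⟨0, .zero, by simp⟩
      | sq_add a _ ih =>
        obtain ⟨q, hq, hqs⟩ := ih
        obtain ⟨b, hb⟩ := key a
        exact ⟨b * b + q, .sq_add b hq, by
          rw [map_add, map_mul, hb, hqs]
          rfl⟩
    obtain ⟨q, hq, hqs⟩ := key2
    refine ⟨q, hq, ?_⟩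
    have h2 : aeval α (1 + q) = 0 := by
      rw [map_add, map_one, hqs]
      exact congrArg Subtype.val h1
    exact (((minpoly.irreducible halg.isIntegral).dvd_symm hf (minpoly.dvd E α hα))).trans
      (minpoly.dvd E α h2)

section

variable {E : Type*} [Field E]

theorem IsSumSq.exists_sub_dvd_of_sq_sub {s : E[X]} (hs : IsSumSq s) (x : E) :
    ∃ b c d : E, IsSumSq b ∧ IsSumSq c ∧ X ^ 2 - C x ∣ s - (C (b + x * c) + C d * X) := by
  induction hs with
  | zero => exact ⟨0, 0, 0, .zero, .zero, by simp⟩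
  | @sq_add a s _ ih =>
    obtain ⟨b, c, d, hb, hc, q, hq⟩ := ih
    have hmon : (X ^ 2 - C x).Monic := monic_X_pow_sub_C x two_ne_zero
    have hdeg : (a %ₘ (X ^ 2 - C x)).natDegree ≤ 1 := by
      have := natDegree_modByMonic_lt a hmon (fun h => by
        have := congrArg natDegree h
        rw [natDegree_X_pow_sub_C] at this
        simp at this)
      rw [natDegree_X_pow_sub_C] at this
      omega
    obtain ⟨u, v, huv⟩ := exists_eq_X_add_C_of_natDegree_le_one hdeg
    have ha := modByMonic_add_div a (X ^ 2 - C x)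
    set r := a /ₘ (X ^ 2 - C x)
    rw [huv] at ha
    refine ⟨v * v + b, u * u + c, 2 * u * v + d, .sq_add v hb, .sq_add u hc,
      C u * C u + (2 * (C u * X + C v) + (X ^ 2 - C x) * r) * r + q, ?_⟩
    have hq' : s = (X ^ 2 - C x) * q + (C (b + x * c) + C d * X) := by rw [← hq]; ring
    rw [hq', ← ha]
    simp only [map_add, map_mul, map_ofNat]
    ring

theorem isSumSq_or_isSumSq_neg (hE : IsSemireal E)
    (hf : ∀ f : E[X], Irreducible f → (∃ x, f.eval x = 0) ∨ ∃ s, IsSumSq s ∧ f ∣ 1 + s) (x : E) :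
    IsSumSq x ∨ IsSumSq (-x) := by
  by_cases hx : ∃ y, y * y = x
  · obtain ⟨y, rfl⟩ := hx
    exact .inl (.mul_self y)
  have hdeg : (X ^ 2 - C x).natDegree = 2 := natDegree_X_pow_sub_C
  have hroot : ∀ y, (X ^ 2 - C x).eval y ≠ 0 := fun y hy => hx ⟨y, by
    simpa [sub_eq_zero, sq] using hy⟩
  have hirr : Irreducible (X ^ 2 - C x) := by
    refine (irreducible_iff_roots_eq_zero_of_degree_le_three hdeg.ge (by omega)).2 ?_
    exact Multiset.eq_zero_of_forall_notMem fun y hy => hroot y (mem_roots'.1 hy).2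
  obtain ⟨y, hy⟩ | ⟨s, hs, hdvd⟩ := hf _ hirr
  · exact absurd hy (hroot y)
  right
  obtain ⟨b, c, d, hb, hc, h⟩ := hs.exists_sub_dvd_of_sq_sub x
  have h1 : X ^ 2 - C x ∣ C d * X + C (1 + (b + x * c)) := by
    have := dvd_sub hdvd h
    convert this using 1
    rw [map_add C 1, map_one]
    ring
  have h2 : C d * X + C (1 + (b + x * c)) = 0 := by
    by_contra h0
    have := natDegree_le_of_dvd h1 h0
    have := natDegree_linear_le (a := d) (b := 1 + (b + x * c))
    omega
  have h3 : 1 + (b + x * c) = 0 := by simpa using congrArg (coeff · 0) h2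
  have hc0 : c ≠ 0 := by
    rintro rfl
    exact hE.one_add_ne_zero hb (by simpa using h3)
  have : -x = (1 + b) * c * (c⁻¹ * c⁻¹) := by
    field_simp
    linear_combination -h3
  rw [this]
  exact (((IsSquare.one).isSumSq.add hb).mul hc).mul (.mul_self _)

theorem IsSumSq.exists_natDegree_le {p : E[X]} (hp : p.natDegree ≠ 0) {s : E[X]}
    (hs : IsSumSq s) : ∃ t, IsSumSq t ∧ p ∣ s - t ∧ t.natDegree + 2 ≤ 2 * p.natDegree := by
  induction hs with
  | zero => exact ⟨0, .zero, by simp, by simp; omega⟩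
  | sq_add a _ ih =>
    obtain ⟨t, ht, hdvd, hdeg⟩ := ih
    refine ⟨(a % p) * (a % p) + t, .sq_add _ ht, ?_, ?_⟩
    · have : p ∣ a - a % p := ⟨a / p, by linear_combination -EuclideanDomain.mod_add_div a p⟩
      convert dvd_add (this.mul_right (a + a % p)) hdvd using 1
      ring
    · have h1 := natDegree_mod_lt a hp
      have h2 : ((a % p) * (a % p)).natDegree ≤ _ := natDegree_mul_le
      have h3 := natDegree_add_le ((a % p) * (a % p)) t
      have h5 := le_max_iff.1 h3
      omega

end

section

variable {E : Type*} [Field E] [LinearOrder E] [IsStrictOrderedRing E]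

theorem eval_pos_of_isSumSq {s : E[X]} (hs : IsSumSq s) (a : E) : 0 < (1 + s).eval a := by
  have h : 0 ≤ s.eval a := (hs.map_ringHom (evalRingHom a)).nonneg
  rw [eval_add, eval_one]
  linarith

/-- A polynomial which changes sign does not divide a sum of squares containing `1`. -/
theorem not_dvd_one_add_of_eval_mul_eval_neg {p s : E[X]} {a b : E}
    (hp : p.eval a * p.eval b < 0) (hs : IsSumSq s) : ¬ p ∣ 1 + s := by
  induction hn : p.natDegree using Nat.strong_induction_on generalizing p s with
  | _ n ih =>
    intro hdvd
    have h0 : p.natDegree ≠ 0 := fun h0 => by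
      rw [eq_C_of_natDegree_eq_zero h0, eval_C, eval_C] at hp
      exact absurd hp (not_lt.2 (mul_self_nonneg _))
    obtain ⟨t, ht, hst, hdeg⟩ := hs.exists_natDegree_le h0
    obtain ⟨q, hq⟩ : p ∣ 1 + t := by
      convert dvd_sub hdvd hst using 1
      ring
    have hqab : q.eval a * q.eval b < 0 := by
      have h1 := mul_pos (eval_pos_of_isSumSq ht a) (eval_pos_of_isSumSq ht b)
      rw [hq, eval_mul, eval_mul, mul_mul_mul_comm] at h1
      by_contra h
      exact absurd h1 (not_lt.2 (mul_nonpos_of_nonpos_of_nonneg hp.le (not_lt.1 h)))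
    refine ih q.natDegree ?_ hqab ht rfl ⟨p, hq.trans (mul_comm _ _)⟩
    have hq0 : q ≠ 0 := by rintro rfl; simp at hqab
    have hp0 : p ≠ 0 := by rintro rfl; simp at hp
    have h1 := natDegree_mul hp0 hq0
    have h2 := natDegree_add_le (1 : E[X]) t
    rw [hq, h1, natDegree_one, zero_max] at h2
    omega

theorem polynomialIVT_of_irreducible
    (hf : ∀ f : E[X], Irreducible f → (∃ x, f.eval x = 0) ∨ ∃ s, IsSumSq s ∧ f ∣ 1 + s) :
    PolynomialIVT E := by
  intro p a b hab hp
  induction p using WfDvdMonoid.induction_on_irreducible with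
  | zero => simp at hp
  | unit u hu =>
    obtain ⟨c, -, rfl⟩ := Polynomial.isUnit_iff.1 hu
    rw [eval_C, eval_C] at hp
    exact absurd hp (not_lt.2 (mul_self_nonneg _))
  | mul q i _ hi ih =>
    by_cases hq : q.eval a * q.eval b < 0
    · obtain ⟨c, h1, h2, h3⟩ := ih hq
      exact ⟨c, h1, h2, by rw [eval_mul, h3, mul_zero]⟩
    have hiab : i.eval a * i.eval b < 0 := by
      rw [eval_mul, eval_mul, mul_mul_mul_comm] at hp
      by_contra h
      exact absurd hp (not_lt.2 (mul_nonneg (not_lt.1 h) (not_lt.1 hq)))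
    obtain ⟨x, hx⟩ | ⟨s, hs, hdvd⟩ := hf i hi
    · have hdeg := degree_eq_one_of_irreducible_of_root hi hx
      obtain ⟨r, hr⟩ := dvd_iff_isRoot.2 hx
      have hr0 : r.natDegree = 0 := by
        have hr0 : r ≠ 0 := by rintro rfl; exact hi.ne_zero (by simpa using hr)
        have := natDegree_mul (X_sub_C_ne_zero x) hr0
        have h1 : i.natDegree = 1 := natDegree_eq_of_degree_eq_some hdeg
        rw [← hr, h1, natDegree_X_sub_C] at this
        omega
      rw [eq_C_of_natDegree_eq_zero hr0] at hr
      have h1 : i.eval a * i.eval b = (a - x) * (b - x) * (r.coeff 0) ^ 2 := by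
        rw [hr]; simp; ring
      have h2 : (a - x) * (b - x) < 0 := by
        by_contra h
        exact absurd hiab (not_lt.2 (h1 ▸ mul_nonneg (not_lt.1 h) (sq_nonneg _)))
      refine ⟨x, ?_, ?_, by rw [eval_mul, hx, zero_mul]⟩
      · by_contra h
        nlinarith
      · by_contra h
        nlinarith
    · exact absurd hdvd (not_dvd_one_add_of_eval_mul_eval_neg hiab hs)

end

/-- Every semireal field embeds in an ordered field with the intermediate value property. -/
theorem exists_polynomialIVT_extension.{u} (K : Type u) [Field K] (hK : IsSemireal K) :
    ∃ (S : Type u) (_ : Field S) (_ : LinearOrder S) (_ : IsStrictOrderedRing S) (_ : K →+* S),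
      PolynomialIVT S := by
  classical
  obtain ⟨E, _, j, hE, hf⟩ := exists_maximal_semireal_extension K hK
  let C : RingCone E :=
    { Subsemiring.sumSq E with
      eq_zero_of_mem_of_neg_mem' := by
        intro x h1 h2
        by_contra hx
        have h1' : IsSumSq x := Subsemiring.mem_sumSq.1 h1
        have h2' : IsSumSq (-x) := Subsemiring.mem_sumSq.1 h2
        refine hE.one_add_ne_zero ((h1'.mul h2').mul (.mul_self x⁻¹)) ?_
        field_simp
        ring }
  have hC : ∀ x, x ∈ C ↔ IsSumSq x := fun x => Subsemiring.mem_sumSq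
  have : HasMemOrNegMem C := ⟨fun x => by
    rw [hC, hC]
    exact isSumSq_or_isSumSq_neg hE hf x⟩
  let _ : LinearOrder E := LinearOrder.mkOfAddGroupCone C
  have : IsOrderedRing E := .mkOfCone C
  exact ⟨E, inferInstance, inferInstance, IsOrderedRing.toIsStrictOrderedRing E, j,
    @polynomialIVT_of_irreducible E _ _ (IsOrderedRing.toIsStrictOrderedRing E) hf⟩

theorem IsSumSq.exists_sum_sq_eq {R : Type*} [CommRing R] {s : R} (hs : IsSumSq s) :
    ∃ (n : ℕ) (a : Fin n → R), ∑ j, a j ^ 2 = s := by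
  induction hs with
  | zero => exact ⟨0, Fin.elim0, by simp⟩
  | sq_add b _ ih =>
    obtain ⟨n, a, rfl⟩ := ih
    exact ⟨n + 1, Fin.cons b a, by simp [Fin.sum_univ_succ, sq]⟩

theorem IsRealIdeal.mem_of_mul_self_add_mem {d : ℕ} {I : Ideal (MvPolynomial (Fin d) ℝ)}
    (hI : IsRealIdeal I) {b s : MvPolynomial (Fin d) ℝ} (hs : IsSumSq s) (h : b * b + s ∈ I) :
    b ∈ I := by
  obtain ⟨n, a, rfl⟩ := hs.exists_sum_sq_eq
  exact hI (n + 1) (Fin.cons b a) (by simpa [Fin.sum_univ_succ, sq] using h) 0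

theorem IsFractionRing.exists_mul_isSumSq {A K : Type*} [CommRing A] [IsDomain A] [Field K]
    [Algebra A K] [IsFractionRing A K] {s : K} (hs : IsSumSq s) :
    ∃ b : A, b ≠ 0 ∧ ∃ t : A, IsSumSq t ∧ algebraMap A K (b * b) * s = algebraMap A K t := by
  induction hs with
  | zero => exact ⟨1, one_ne_zero, 0, .zero, by simp⟩
  | sq_add a _ ih =>
    obtain ⟨b, hb, t, ht, h⟩ := ih
    obtain ⟨c, e, he, rfl⟩ := IsFractionRing.div_surjective (A := A) a
    have he0 : e ≠ 0 := nonZeroDivisors.ne_zero he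
    have he' : algebraMap A K e ≠ 0 := by simpa using he0
    refine ⟨b * e, mul_ne_zero hb he0, (b * c) * (b * c) + (e * e) * t,
      .sq_add _ ((IsSumSq.mul_self e).mul ht), ?_⟩
    simp only [map_mul, map_add] at h ⊢
    rw [← h]
    field_simp

theorem IsRealIdeal.isSemireal_fractionRing {d : ℕ} {I : Ideal (MvPolynomial (Fin d) ℝ)}
    [I.IsPrime] (hI : IsRealIdeal I) :
    IsSemireal (FractionRing (MvPolynomial (Fin d) ℝ ⧸ I)) := by
  refine ⟨fun {s} hs h => ?_⟩
  obtain ⟨b, hb, t, ht, hbt⟩ := IsFractionRing.exists_mul_isSumSq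
    (A := MvPolynomial (Fin d) ℝ ⧸ I) hs
  obtain ⟨b, rfl⟩ := Ideal.Quotient.mk_surjective b
  obtain ⟨t, ht', rfl⟩ := ht.exists_lift_of_surjective _ Ideal.Quotient.mk_surjective
  refine hb (Ideal.Quotient.eq_zero_iff_mem.2 (hI.mem_of_mul_self_add_mem ht' ?_))
  rw [← Ideal.Quotient.eq_zero_iff_mem]
  apply IsFractionRing.injective (MvPolynomial (Fin d) ℝ ⧸ I)
    (FractionRing (MvPolynomial (Fin d) ℝ ⧸ I))
  rw [map_add, map_add, ← hbt, map_zero, map_mul]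
  linear_combination (algebraMap (MvPolynomial (Fin d) ℝ ⧸ I)
    (FractionRing (MvPolynomial (Fin d) ℝ ⧸ I))
    (Ideal.Quotient.mk I b * Ideal.Quotient.mk I b)) * h

theorem MvPolynomial.exists_not_dvd_pderiv {d : ℕ} {P : MvPolynomial (Fin d) ℝ}
    (hP : 0 < P.totalDegree) : ∃ i, ¬ P ∣ pderiv i P := by
  have hP0 : P ≠ 0 := by rintro rfl; simp at hP
  obtain ⟨m, hm, hmax⟩ := P.support.exists_mem_eq_sup (support_nonempty.2 hP0)
    fun s => s.sum fun _ e => e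
  change P.totalDegree = _ at hmax
  obtain ⟨i, hi⟩ : ∃ i, m i ≠ 0 := by
    by_contra! h
    have : m = 0 := Finsupp.ext h
    rw [hmax, this, Finsupp.sum_zero_index] at hP
    exact hP.false
  have hne : pderiv i P ≠ 0 := fun h => by
    have h1 := coeff_pderiv (i := i) P (m - Finsupp.single i 1)
    rw [h, coeff_zero, tsub_add_cancel_of_le
      (Finsupp.single_le_iff.2 (Nat.one_le_iff_ne_zero.2 hi))] at h1
    rcases mul_eq_zero.1 h1.symm with h2 | h2
    · exact mem_support_iff.1 hm h2
    · exact absurd h2 (by positivity)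
  refine ⟨i, fun ⟨q, hq⟩ => ?_⟩
  have hq0 : q ≠ 0 := by rintro rfl; exact hne (by simpa using hq)
  have hlt : (pderiv i P).totalDegree < P.totalDegree := by
    refine (Finset.sup_lt_iff hP).2 fun k hk => ?_
    rw [mem_support_iff, coeff_pderiv] at hk
    have h1 := le_totalDegree (mem_support_iff.2 (left_ne_zero_of_mul hk))
    rw [Finsupp.sum_add_index' (fun _ => rfl) (fun _ _ _ => rfl),
      Finsupp.sum_single_index rfl] at h1
    omega
  rw [hq, totalDegree_mul_of_isDomain hP0 hq0] at hlt
  omega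

/-- The restriction of `P` to the line through `x` in the direction of the `i`-th axis. -/
noncomputable def MvPolynomial.restrictLine {S : Type*} [CommRing S] {d : ℕ} (ι : ℝ →+* S)
    (x : Fin d → S) (i : Fin d) : MvPolynomial (Fin d) ℝ →+* S[X] :=
  eval₂Hom (Polynomial.C.comp ι) fun k => Polynomial.C (x k) + if k = i then Polynomial.X else 0

theorem MvPolynomial.eval_restrictLine {S : Type*} [CommRing S] {d : ℕ} (ι : ℝ →+* S)
    (x : Fin d → S) (i : Fin d) (t : S) (P : MvPolynomial (Fin d) ℝ) :
    (restrictLine ι x i P).eval t = eval₂ ι (fun k => x k + if k = i then t else 0) P := by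
  change Polynomial.evalRingHom t _ = _
  rw [restrictLine, coe_eval₂Hom, hom_eval₂]
  congr 1
  · ext; simp
  · ext k
    split_ifs with h <;> simp [h]

theorem MvPolynomial.eval_derivative_restrictLine {S : Type*} [CommRing S] {d : ℕ} (ι : ℝ →+* S)
    (x : Fin d → S) (i : Fin d) (P : MvPolynomial (Fin d) ℝ) :
    (derivative (restrictLine ι x i P)).eval 0 = eval₂ ι x (pderiv i P) := by
  have h0 : ∀ Q, (restrictLine ι x i Q).eval 0 = eval₂ ι x Q := fun Q => by
    rw [eval_restrictLine]
    simp
  induction P using MvPolynomial.induction_on with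
  | C a => simp [restrictLine]
  | add p q hp hq => simp [hp, hq, eval₂_add]
  | mul_X p k hp =>
    have h1 : restrictLine ι x i (X k)
      = Polynomial.C (x k) + if k = i then Polynomial.X else 0 := by simp [restrictLine]
    rw [map_mul, derivative_mul, Polynomial.eval_add, Polynomial.eval_mul, Polynomial.eval_mul,
      hp, h0, h0, h1, pderiv_mul, eval₂_add, eval₂_mul, eval₂_mul, pderiv_X]
    split_ifs with h
    · subst h; simp
    · simp [h]

theorem PolynomialIVT.exists_eval_mul_eval_neg {S : Type*} [Field S] [LinearOrder S]
    [IsStrictOrderedRing S] (hS : PolynomialIVT S) {p : S[X]} (h0 : p.eval 0 = 0)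
    (h1 : p.derivative.eval 0 ≠ 0) : ∃ t : S, p.eval t * p.eval (-t) < 0 := by
  classical
  obtain ⟨q, rfl⟩ := X_dvd_iff.2 ((coeff_zero_eq_eval_zero p).trans h0)
  have hq : q.eval 0 ≠ 0 := by simpa [derivative_mul] using h1
  have hq0 : q ≠ 0 := by rintro rfl; simp at hq
  have key : ∀ Z : Finset S, (∀ z ∈ Z, z ≠ 0) → ∃ t, 0 < t ∧ ∀ z ∈ Z, t < |z| := by
    intro Z hZ
    induction Z using Finset.induction_on with
    | empty => exact ⟨1, one_pos, by simp⟩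
    | insert z Z _ ih =>
      obtain ⟨t, ht, h⟩ := ih fun w hw => hZ w (Finset.mem_insert_of_mem hw)
      have hz : 0 < |z| := abs_pos.2 (hZ z (Finset.mem_insert_self _ _))
      refine ⟨min t (|z| / 2), lt_min ht (half_pos hz), fun w hw => ?_⟩
      rcases Finset.mem_insert.1 hw with rfl | hw
      · exact (min_le_right _ _).trans_lt (half_lt_self hz)
      · exact (min_le_left _ _).trans_lt (h w hw)
  obtain ⟨t, ht, h⟩ := key q.roots.toFinset (fun z hz => by
    rintro rfl
    exact hq (mem_roots'.1 (Multiset.mem_toFinset.1 hz)).2)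
  have hpos : 0 < q.eval (-t) * q.eval t := by
    refine hS.mul_pos_of_ne_zero (by linarith) fun z hz1 hz2 hz => ?_
    exact absurd (abs_le.2 ⟨hz1, hz2⟩) (not_le.2 (h z (Multiset.mem_toFinset.2
      (mem_roots'.2 ⟨hq0, hz⟩))))
  refine ⟨t, ?_⟩
  have : (X * q).eval t * (X * q).eval (-t) = -(t ^ 2 * (q.eval (-t) * q.eval t)) := by
    simp; ring
  rw [this, neg_lt_zero]
  positivity

theorem exists_pos_neg_of_isRealIdeal {d : ℕ} {P : MvPolynomial (Fin d) ℝ} (hP : Irreducible P)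
    (hI : IsRealIdeal (Ideal.span {P})) :
    ∃ x y : Fin d → ℝ, 0 < MvPolynomial.eval x P ∧ MvPolynomial.eval y P < 0 := by
  have hprime : (Ideal.span {P}).IsPrime :=
    (Ideal.span_singleton_prime hP.ne_zero).2 hP.prime
  obtain ⟨S, _, _, _, j, hS⟩ := exists_polynomialIVT_extension _ hI.isSemireal_fractionRing
  set θ : MvPolynomial (Fin d) ℝ →+* S := (j.comp (algebraMap
    (MvPolynomial (Fin d) ℝ ⧸ Ideal.span {P}) _)).comp (Ideal.Quotient.mk _) with hθ
  have hker : ∀ Q, θ Q = 0 → P ∣ Q := fun Q hQ => by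
    rw [← Ideal.mem_span_singleton, ← Ideal.Quotient.eq_zero_iff_mem]
    rw [hθ, RingHom.comp_apply, RingHom.comp_apply, map_eq_zero] at hQ
    exact (IsFractionRing.to_map_eq_zero_iff).1 hQ
  have hθP : θ P = 0 := by
    have : Ideal.Quotient.mk (Ideal.span {P}) P = 0 :=
      Ideal.Quotient.eq_zero_iff_mem.2 (Ideal.mem_span_singleton_self P)
    rw [hθ, RingHom.comp_apply, this, map_zero]
  set ι : ℝ →+* S := θ.comp MvPolynomial.C
  set x : Fin d → S := fun k => θ (MvPolynomial.X k)
  have hev : ∀ Q, MvPolynomial.eval₂ ι x Q = θ Q := fun Q => by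
    rw [← MvPolynomial.coe_eval₂Hom]
    exact congrFun (congrArg _ (MvPolynomial.ringHom_ext (by simp [ι]) (by simp [x]))) Q
  have hdeg : 0 < P.totalDegree := Nat.pos_of_ne_zero fun h => by
    rw [MvPolynomial.totalDegree_eq_zero_iff_eq_C] at h
    refine hP.not_isUnit (h ▸ (IsUnit.map MvPolynomial.C (isUnit_iff_ne_zero.2 ?_)))
    intro h0
    rw [h0, MvPolynomial.C_0] at h
    exact hP.ne_zero h
  obtain ⟨i, hi⟩ := MvPolynomial.exists_not_dvd_pderiv hdeg
  obtain ⟨t, ht⟩ := hS.exists_eval_mul_eval_neg (p := MvPolynomial.restrictLine ι x i P)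
    (by rw [MvPolynomial.eval_restrictLine]; simpa [hev] using hθP)
    (by rw [MvPolynomial.eval_derivative_restrictLine, hev]; exact fun h => hi (hker _ h))
  rw [MvPolynomial.eval_restrictLine, MvPolynomial.eval_restrictLine] at ht
  have key : ∀ y : Fin d → S, ∃ a : Fin d → ℝ,
      sign (MvPolynomial.eval a P) = sign (MvPolynomial.eval₂ ι y P) := fun y => by
    obtain ⟨a, ha⟩ := exists_real_point_sign_eq hS ι d y {P}
    exact ⟨a, ha P (Finset.mem_singleton_self P)⟩
  obtain ⟨a, ha⟩ := key fun k => x k + if k = i then t else 0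
  obtain ⟨b, hb⟩ := key fun k => x k + if k = i then -t else 0
  rcases mul_neg_iff.1 ht with ⟨h1, h2⟩ | ⟨h1, h2⟩
  · rw [sign_pos h1, sign_eq_one_iff] at ha
    rw [sign_neg h2, sign_eq_neg_one_iff] at hb
    exact ⟨a, b, ha, hb⟩
  · rw [sign_neg h1, sign_eq_neg_one_iff] at ha
    rw [sign_pos h2, sign_eq_one_iff] at hb
    exact ⟨b, a, hb, ha⟩

theorem Irreducible.exists_combination_eq_C_of_not_dvd {R : Type*} [CommRing R] [IsDomain R]
    [IsGCDMonoid R] {p q : R[X]} (hp : Irreducible p) (hdeg : p.natDegree ≠ 0) (hq : ¬ p ∣ q) :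
    ∃ (a b : R[X]) (r : R), r ≠ 0 ∧ a * p + b * q = C r := by
  set K := FractionRing R
  have hprim := hp.isPrimitive hdeg
  have hirr := (hprim.irreducible_iff_irreducible_map_fraction_map (K := K)).1 hp
  obtain ⟨a, b, hab⟩ := hirr.coprime_iff_not_dvd.2
    (fun h => hq (hprim.dvd_of_fraction_map_dvd_fraction_map h))
  obtain ⟨u, hu, hau⟩ := IsLocalization.integerNormalization_spec (nonZeroDivisors R) a
  obtain ⟨v, hv, hbv⟩ := IsLocalization.integerNormalization_spec (nonZeroDivisors R) b
  refine ⟨C v * IsLocalization.integerNormalization (nonZeroDivisors R) a,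
    C u * IsLocalization.integerNormalization (nonZeroDivisors R) b, u * v,
    mul_ne_zero (nonZeroDivisors.ne_zero hu) (nonZeroDivisors.ne_zero hv), ?_⟩
  apply map_injective (algebraMap R K) (IsFractionRing.injective R K)
  simp only [Polynomial.map_add, Polynomial.map_mul, map_C, hau, hbv, map_mul,
    Algebra.smul_def, Polynomial.algebraMap_apply]
  linear_combination (C (algebraMap R K u) * C (algebraMap R K v)) * hab

theorem MvPolynomial.dvd_of_forall_root {n : ℕ} {p q : (MvPolynomial (Fin n) ℝ)[X]}
    (hp : Irreducible p) {z : Fin n → ℝ} {s t : ℝ}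
    (hst : eval z (p.eval (C s)) * eval z (p.eval (C t)) < 0)
    (h : ∀ x c, (p.map (eval x)).eval c = 0 → (q.map (eval x)).eval c = 0) : p ∣ q := by
  have hdeg : p.natDegree ≠ 0 := fun h0 => by
    rw [Polynomial.eq_C_of_natDegree_eq_zero h0, Polynomial.eval_C, Polynomial.eval_C] at hst
    exact absurd hst (not_lt.2 (mul_self_nonneg _))
  wlog hlt : s < t generalizing s t
  · refine this (s := t) (t := s) (by rwa [mul_comm]) (lt_of_le_of_ne (not_lt.1 hlt) ?_)
    rintro rfl
    exact absurd hst (not_lt.2 (mul_self_nonneg _))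
  by_contra hdvd
  obtain ⟨a, b, r, hr, hab⟩ := hp.exists_combination_eq_C_of_not_dvd hdeg hdvd
  have hopen : IsOpen {x | eval x (p.eval (C s)) * eval x (p.eval (C t)) < 0} :=
    isOpen_lt ((continuous_eval _).mul (continuous_eval _)) continuous_const
  obtain ⟨ε, hε, hball⟩ := Metric.isOpen_iff.1 hopen z hst
  rw [ball_pi z hε] at hball
  refine hr (funext_set (fun i => Metric.ball (z i) ε) (fun i => ?_) fun x hx => ?_)
  · rw [Real.ball_eq_Ioo]
    exact Set.Ioo_infinite (by linarith)
  · have hx' : eval x (p.eval (C s)) * eval x (p.eval (C t)) < 0 := hball hx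
    have hev : ∀ c, eval x (p.eval (C c)) = (p.map (eval x)).eval c := fun c => by
      rw [← Polynomial.eval_map_apply, eval_C]
    rw [hev, hev] at hx'
    obtain ⟨c, -, -, hc⟩ := polynomialIVT_real _ _ _ hlt hx'
    have := congrArg (fun f : (MvPolynomial (Fin n) ℝ)[X] => (f.map (eval x)).eval c) hab
    simp only [Polynomial.map_add, Polynomial.map_mul, Polynomial.eval_add, Polynomial.eval_mul,
      hc, h x c hc, mul_zero, add_zero, Polynomial.map_C, Polynomial.eval_C] at this
    rw [← this, map_zero]

theorem MvPolynomial.exists_eval_eq_eval_update {d : ℕ} (P : MvPolynomial (Fin d) ℝ)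
    (x : Fin d → ℝ) (i : Fin d) :
    ∃ q : ℝ[X], ∀ t, q.eval t = eval (Function.update x i t) P := by
  refine ⟨eval₂Hom Polynomial.C (Function.update (fun k => Polynomial.C (x k)) i Polynomial.X) P,
    fun t => ?_⟩
  change Polynomial.evalRingHom t _ = _
  rw [coe_eval₂Hom, hom_eval₂, ← eval₂_id]
  congr 1
  · ext; simp
  · ext k
    rcases eq_or_ne k i with rfl | h <;> simp [*]

/-- A polynomial which changes sign does so along a line parallel to some axis. -/
theorem MvPolynomial.exists_eval_mul_eval_update_neg {d : ℕ} {P : MvPolynomial (Fin d) ℝ}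
    (s : Finset (Fin d)) {u v : Fin d → ℝ} (huv : ∀ i, i ∉ s → u i = v i) (hu : 0 < eval u P)
    (hv : eval v P < 0) : ∃ z i t, eval z P * eval (Function.update z i t) P < 0 := by
  induction s using Finset.induction_on generalizing u v with
  | empty =>
    have : u = v := _root_.funext fun i => huv i (Finset.notMem_empty i)
    subst this
    exact absurd hu (not_lt.2 hv.le)
  | insert i s _ ih =>
    obtain ⟨q, hq⟩ := exists_eval_eq_eval_update P v i
    have hq0 : q ≠ 0 := by
      rintro rfl
      have := hq (v i)
      rw [Function.update_eq_self, Polynomial.eval_zero] at this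
      exact hv.ne this.symm
    have hopen : IsOpen {t | 0 < eval (Function.update u i t) P} :=
      isOpen_lt continuous_const
        ((continuous_eval P).comp (continuous_const.update i continuous_id))
    have hmem : {t | 0 < eval (Function.update u i t) P} ∈ nhds (u i) :=
      hopen.mem_nhds (by simpa using hu)
    obtain ⟨t, ht, htq⟩ := ((infinite_of_mem_nhds _ hmem).sdiff
      (q.roots.toFinset.finite_toSet)).nonempty
    have hne : eval (Function.update v i t) P ≠ 0 := fun h0 => htq (by
      simpa [hq0, hq] using h0)
    rcases lt_or_gt_of_ne hne with hlt | hlt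
    · refine ih (fun k hk => ?_) ht hlt
      rcases eq_or_ne k i with rfl | hki
      · simp
      · rw [Function.update_of_ne hki, Function.update_of_ne hki]
        exact huv k (by simp [hki, hk])
    · exact ⟨v, i, t, mul_neg_of_neg_of_pos hv hlt⟩

/-- The real Nullstellensatz for an irreducible polynomial which changes sign. -/
theorem MvPolynomial.dvd_of_forall_eval_eq_zero {d : ℕ} {P Q : MvPolynomial (Fin d) ℝ}
    (hP : Irreducible P) {u v : Fin d → ℝ} (hu : 0 < eval u P) (hv : eval v P < 0)
    (h : ∀ x, eval x P = 0 → eval x Q = 0) : P ∣ Q := by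
  obtain ⟨z, i, t, hzt⟩ := exists_eval_mul_eval_update_neg Finset.univ
    (fun i hi => absurd (Finset.mem_univ i) hi) hu hv
  obtain ⟨n, rfl⟩ : ∃ n, d = n + 1 := Nat.exists_eq_succ_of_ne_zero (by
    rintro rfl
    exact i.elim0)
  set σ : Fin (n + 1) ≃ Fin (n + 1) := Equiv.swap i 0 with hσ
  set e : MvPolynomial (Fin (n + 1)) ℝ ≃ₐ[ℝ] (MvPolynomial (Fin n) ℝ)[X] :=
    (renameEquiv ℝ σ).trans (finSuccEquiv ℝ n) with he
  have hev : ∀ f x c, ((e f).map (eval x)).eval c = eval (Fin.cons c x ∘ σ) f := by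
    intro f x c
    rw [he, AlgEquiv.trans_apply, ← eval_eq_eval_mv_eval', renameEquiv_apply, eval_rename]
  have hev' : ∀ f x c, eval x ((e f).eval (C c)) = eval (Fin.cons c x ∘ σ) f := by
    intro f x c
    rw [← hev, ← Polynomial.eval_map_apply, eval_C]
  have hcons : ∀ c, (Fin.cons c (Fin.tail (z ∘ σ)) : Fin (n + 1) → ℝ) ∘ σ
      = Function.update z i c := by
    intro c
    ext k
    rcases eq_or_ne k i with rfl | hk
    · simp [hσ]
    · have : σ k ≠ 0 := fun h0 => hk (σ.injective (by rw [h0, hσ, Equiv.swap_apply_left]))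
      obtain ⟨m, hm⟩ := Fin.exists_succ_eq.2 this
      rw [Function.update_of_ne hk, Function.comp_apply, ← hm, Fin.cons_succ, Fin.tail,
        Function.comp_apply, hm, hσ, Equiv.swap_apply_self]
  rw [← map_dvd_iff e]
  refine dvd_of_forall_root ((MulEquiv.irreducible_iff e).2 hP) (z := Fin.tail (z ∘ σ))
    (s := z i) (t := t) ?_ fun x c hc => ?_
  · rwa [hev', hev', hcons, hcons, Function.update_eq_self]
  · rw [hev] at hc ⊢
    exact h _ hc

theorem isRealIdeal_of_pos_neg {d : ℕ} {P : MvPolynomial (Fin d) ℝ} (hP : Irreducible P)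
    {u v : Fin d → ℝ} (hu : 0 < MvPolynomial.eval u P) (hv : MvPolynomial.eval v P < 0) :
    IsRealIdeal (Ideal.span {P}) := by
  intro ℓ a ha j
  rw [Ideal.mem_span_singleton] at ha ⊢
  refine MvPolynomial.dvd_of_forall_eval_eq_zero hP hu hv fun x hx => ?_
  obtain ⟨q, hq⟩ := ha
  have h0 := congrArg (MvPolynomial.eval x) hq
  rw [map_mul, hx, zero_mul, map_sum] at h0
  simp only [map_pow] at h0
  exact pow_eq_zero_iff two_ne_zero |>.1
    ((Finset.sum_eq_zero_iff_of_nonneg fun k _ => sq_nonneg _).1 h0 j (Finset.mem_univ j))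

end

/-- For an irreducible real polynomial `P` in `d` variables, the principal prime
ideal `(P)` is real if and only if `P` changes sign somewhere on `ℝ^d`. -/
theorem stmt_8 (d : ℕ) (P : MvPolynomial (Fin d) ℝ) (hP : Irreducible P) :
    IsRealIdeal (Ideal.span {P}) ↔
      ∃ x y : Fin d → ℝ, 0 < MvPolynomial.eval x P ∧ MvPolynomial.eval y P < 0 := by
  exact ⟨exists_pos_neg_of_isRealIdeal hP, fun ⟨_, _, hx, hy⟩ => isRealIdeal_of_pos_neg hP hx hy⟩
end
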